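/- arXiv:2207.01957 — 2 statements merged into one kernel-verified Lean document; each statement's English description precedes it below -/
import Mathlib

section
/- Let ω and ρ be normal states on a von Neumann algebra R with center Z. There exists a normal unital completely positive map ψ in the point-weak* closure of E(R) satisfying ω∘ψ = ρ if and only if ρ|Z = ω|Z. Moreover, the condition ρ|Z = ω|Z holds if and only if ‖cρ‖ ≤ ‖cω‖ for all positive c ∈ Z. -/
universe u

open scoped ComplexConjugate ComplexOrder

noncomputable section

variable {H : Type u} [NormedAddCommGroup H] [InnerProductSpace ℂ H] [CompleteSpace H]

local notation "⟪" x ", " y "⟫" => @inner ℂ _ _ x y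

namespace VonNeumannAlgebraPaper

/-- Scalar multiples of elements of a von Neumann algebra stay in it. -/
instance : SMulMemClass (VonNeumannAlgebra H) ℂ (H →L[ℂ] H) where
  smul_mem {S} z x hx := by
    have h : z • x = algebraMap ℂ (H →L[ℂ] H) z * x := Algebra.smul_def z x
    rw [h]
    exact mul_mem (S.toStarSubalgebra.algebraMap_mem z) hx

instance (M : VonNeumannAlgebra H) : Algebra ℂ ↥M :=
  Algebra.ofModule
    (fun r x y => Subtype.ext (smul_mul_assoc r (x : H →L[ℂ] H) (y : H →L[ℂ] H)))
    (fun r x y => Subtype.ext (mul_smul_comm r (x : H →L[ℂ] H) (y : H →L[ℂ] H)))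

instance (M : VonNeumannAlgebra H) : NormedAlgebra ℂ ↥M where
  norm_smul_le r x := norm_smul_le r (x : H →L[ℂ] H)

variable {M : VonNeumannAlgebra H}

/-- A linear functional on `M` is positive if it is nonnegative on all
elements `a* a`. -/
def IsPositiveFunctional (ω : ↥M →L[ℂ] ℂ) : Prop :=
  ∀ a : ↥M, 0 ≤ ω (star a * a)

/-- A state is a positive unital linear functional. -/
def IsState (ω : ↥M →L[ℂ] ℂ) : Prop :=
  IsPositiveFunctional ω ∧ ω 1 = 1

/-- A hermitian (self-adjoint) linear functional. -/
def IsHermitianFunctional (ω : ↥M →L[ℂ] ℂ) : Prop :=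
  ∀ a : ↥M, ω (star a) = conj (ω a)

/-- `ωp`, `ωm` form the Jordan decomposition of the hermitian functional `ω`. -/
def IsJordanDecomposition (ω ωp ωm : ↥M →L[ℂ] ℂ) : Prop :=
  IsPositiveFunctional ωp ∧ IsPositiveFunctional ωm ∧ ω = ωp - ωm ∧ ‖ω‖ = ‖ωp‖ + ‖ωm‖

/-- An element of a C*-algebra is positive iff it is of the form `b* b`. -/
def IsPositiveElem (c : ↥M) : Prop :=
  ∃ b : ↥M, c = star b * b

/-- A normal (= weak* continuous) functional on the von Neumann algebra `M`:
it is given by a pair of ℓ²-sequences of vectors. -/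
def IsNormalFunctional (ω : ↥M →L[ℂ] ℂ) : Prop :=
  ∃ x y : ℕ → H, Summable (fun n => ‖x n‖ ^ 2) ∧ Summable (fun n => ‖y n‖ ^ 2) ∧
    ∀ a : ↥M, HasSum (fun n => ⟪x n, (a : H →L[ℂ] H) (y n)⟫) (ω a)

/-- `E(M)`: the unital completely positive elementary maps
`x ↦ ∑ i, (a i)* x (a i)` with `∑ i, (a i)* (a i) = 1`. -/
def IsElementaryUCP (φ : ↥M →L[ℂ] ↥M) : Prop :=
  ∃ (n : ℕ) (a : Fin n → ↥M), (∑ i, star (a i) * a i) = 1 ∧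
    ∀ x : ↥M, φ x = ∑ i, star (a i) * x * a i

/-- The set `ω ∘ E(M) = {ω ∘ φ : φ ∈ E(M)}`. -/
def mixSet (ω : ↥M →L[ℂ] ℂ) : Set (↥M →L[ℂ] ℂ) :=
  {ρ | ∃ φ : ↥M →L[ℂ] ↥M, IsElementaryUCP φ ∧ ρ = ω.comp φ}

/-- Membership in the weak* closure of a set of functionals on `M`. -/
def InWeakStarClosure (S : Set (↥M →L[ℂ] ℂ)) (ρ : ↥M →L[ℂ] ℂ) : Prop :=
  ∀ ε : ℝ, 0 < ε → ∀ (n : ℕ) (x : Fin n → ↥M), ∃ σ ∈ S, ∀ i, ‖ρ (x i) - σ (x i)‖ < ε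

/-- Membership in the point-weak* closure of a set `S` of maps on `M`: at
finitely many points, finitely many normal functionals are simultaneously
approximated by some member of `S`. -/
def InPointWeakStarClosure (S : Set (↥M →L[ℂ] ↥M)) (ψ : ↥M →L[ℂ] ↥M) : Prop :=
  ∀ ε : ℝ, 0 < ε → ∀ (n : ℕ) (x : Fin n → ↥M) (g : Fin n → (↥M →L[ℂ] ℂ)),
    (∀ i, IsNormalFunctional (g i)) →
    ∃ φ ∈ S, ∀ i j, ‖g i (ψ (x j)) - g i (φ (x j))‖ < ε

/-- A map on `M` is normal if pre-composition preserves normal functionals. -/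
def IsNormalMap (ψ : ↥M →L[ℂ] ↥M) : Prop :=
  ∀ ω : ↥M →L[ℂ] ℂ, IsNormalFunctional ω → IsNormalFunctional (ω.comp ψ)

/-- Complete positivity of a map on `M`. -/
def IsCompletelyPositiveMap (ψ : ↥M →L[ℂ] ↥M) : Prop :=
  ∀ (n : ℕ) (a : Fin n → ↥M) (v : Fin n → H),
    0 ≤ ∑ i, ∑ j, ⟪v i, ((ψ (star (a i) * a j) : ↥M) : H →L[ℂ] H) (v j)⟫

/-- The norm `‖cω‖` of the functional `x ↦ ω (c * x)`. -/
def mulNorm (ω : ↥M →L[ℂ] ℂ) (c : ↥M) : ℝ :=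
  sSup {r : ℝ | ∃ x : ↥M, ‖x‖ ≤ 1 ∧ r = ‖ω (c * x)‖}

/-- Norm-closed two-sided ideals of `M`. -/
def IsClosedIdeal (J : Set ↥M) : Prop :=
  IsClosed J ∧ (0 : ↥M) ∈ J ∧ (∀ x ∈ J, ∀ y ∈ J, x + y ∈ J) ∧
    (∀ (c : ℂ), ∀ x ∈ J, c • x ∈ J) ∧ (∀ (a : ↥M), ∀ x ∈ J, a * x ∈ J ∧ x * a ∈ J)

/-- The norm `‖ω|J‖` of the restriction of a functional `ω` to a subset `J`. -/
def normRestrict (ω : ↥M →L[ℂ] ℂ) (J : Set ↥M) : ℝ :=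
  sSup {r : ℝ | ∃ x ∈ J, ‖x‖ ≤ 1 ∧ r = ‖ω x‖}

/-- Maximal (norm-closed two-sided) ideals of `M`. -/
def IsMaximalIdeal (N : Set ↥M) : Prop :=
  IsClosedIdeal N ∧ N ≠ Set.univ ∧
    ∀ N' : Set ↥M, IsClosedIdeal N' → N' ≠ Set.univ → N ⊆ N' → N' = N

/-- The strong radical of `M`: the intersection of all maximal ideals. -/
def strongRadical (M : VonNeumannAlgebra H) : Set ↥M :=
  ⋂₀ {N : Set ↥M | IsMaximalIdeal N}

/-- A state `ω` is maximally mixed if every state `ρ` in the weak* closure of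
`ω ∘ E(M)` satisfies in turn that `ω` is in the weak* closure of `ρ ∘ E(M)`. -/
def IsMaximallyMixed (ω : ↥M →L[ℂ] ℂ) : Prop :=
  IsState ω ∧ ∀ ρ : ↥M →L[ℂ] ℂ, IsState ρ →
    InWeakStarClosure (mixSet ω) ρ → InWeakStarClosure (mixSet ρ) ω


set_option linter.unusedSectionVars false

open Filter Topology

/-! ### Preliminaries on von Neumann algebras -/

theorem mem_of_commutes {A : VonNeumannAlgebra H} {T : H →L[ℂ] H}
    (h : ∀ S ∈ A.commutant, S * T = T * S) : T ∈ A := by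
  rw [← A.commutant_commutant, VonNeumannAlgebra.mem_commutant_iff]
  exact h

theorem commutes_of_mem {A : VonNeumannAlgebra H} {T S : H →L[ℂ] H}
    (hT : T ∈ A) (hS : S ∈ A.commutant) : T * S = S * T :=
  VonNeumannAlgebra.mem_commutant_iff.1 hS T hT

theorem commutes_apply {A : VonNeumannAlgebra H} {T S : H →L[ℂ] H}
    (hT : T ∈ A) (hS : S ∈ A.commutant) (v : H) : T (S v) = S (T v) := by
  have := commutes_of_mem hT hS
  exact congrArg (fun f : H →L[ℂ] H => f v) this

theorem cfc_mem {A : VonNeumannAlgebra H} {T : H →L[ℂ] H} (hT : T ∈ A) (f : NNReal → NNReal) :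
    cfc f T ∈ A := by
  apply mem_of_commutes
  intro S hS
  have h : Commute T S := commutes_of_mem hT hS
  exact (h.cfc_nnreal f).symm

theorem sqrt_mem {A : VonNeumannAlgebra H} {T : H →L[ℂ] H} (hT : T ∈ A) :
    CFC.sqrt T ∈ A := by
  rw [CFC.sqrt_eq_cfc]; exact cfc_mem hT _

theorem rpow_mem {A : VonNeumannAlgebra H} {T : H →L[ℂ] H} (hT : T ∈ A) (y : ℝ) :
    T ^ y ∈ A := by
  rw [CFC.rpow_def]; exact cfc_mem hT _

theorem inner_star_left (T : H →L[ℂ] H) (x y : H) : ⟪(star T) x, y⟫ = ⟪x, T y⟫ := by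
  rw [ContinuousLinearMap.star_eq_adjoint, ContinuousLinearMap.adjoint_inner_left]

theorem inner_star_right (T : H →L[ℂ] H) (x y : H) : ⟪x, (star T) y⟫ = ⟪T x, y⟫ := by
  rw [ContinuousLinearMap.star_eq_adjoint, ContinuousLinearMap.adjoint_inner_right]

/-- Weak operator limits along ultrafilters. -/
theorem wot_limit {α : Type*} (u : Ultrafilter α) (X : α → H →L[ℂ] H) (r : ℝ) (hr : 0 ≤ r)
    (hX : ∀ᶠ a in (u : Filter α), ‖X a‖ ≤ r) :
    ∃ X0 : H →L[ℂ] H, ‖X0‖ ≤ r ∧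
      ∀ x y, Tendsto (fun a => ⟪x, X a y⟫) u (𝓝 ⟪x, X0 y⟫) := by
  have hlim : ∀ x y : H, ∃ c : ℂ, ‖c‖ ≤ r * ‖x‖ * ‖y‖ ∧ Tendsto (fun a => ⟪x, X a y⟫) u (𝓝 c) := by
    intro x y
    have hc := isCompact_closedBall (0 : ℂ) (r * ‖x‖ * ‖y‖)
    have hmem : Metric.closedBall (0 : ℂ) (r * ‖x‖ * ‖y‖) ∈ (u.map (fun a => ⟪x, X a y⟫)) := by
      rw [Ultrafilter.mem_map]
      filter_upwards [hX] with a ha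
      simp only [Set.mem_preimage, mem_closedBall_zero_iff]
      calc ‖⟪x, X a y⟫‖ ≤ ‖x‖ * ‖X a y‖ := norm_inner_le_norm _ _
        _ ≤ ‖x‖ * (r * ‖y‖) := by
            gcongr
            exact (X a).le_of_opNorm_le ha y
        _ = r * ‖x‖ * ‖y‖ := by ring
    obtain ⟨c, hc1, hc2⟩ := isCompact_iff_ultrafilter_le_nhds'.1 hc _ hmem
    exact ⟨c, by simpa using hc1, hc2⟩
  choose c hcb hct using hlim
  let B : H →L⋆[ℂ] H →L[ℂ] ℂ := LinearMap.mkContinuous₂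
    (LinearMap.mk₂'ₛₗ (starRingEnd ℂ) (RingHom.id ℂ) c
      (fun m₁ m₂ n => tendsto_nhds_unique (hct _ _)
        (by simpa [inner_add_left] using (hct m₁ n).add (hct m₂ n)))
      (fun k m n => tendsto_nhds_unique (hct _ _)
        (by simpa [inner_smul_left, mul_comm] using (hct m n).const_mul (conj k)))
      (fun m n₁ n₂ => tendsto_nhds_unique (hct _ _)
        (by simpa [inner_add_right] using (hct m n₁).add (hct m n₂)))
      (fun k m n => tendsto_nhds_unique (hct _ _)
        (by simpa [inner_smul_right] using (hct m n).const_mul k))) r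
      (fun x y => hcb x y)
  let X0 := star (InnerProductSpace.continuousLinearMapOfBilin B)
  have hX0 : ∀ x y, ⟪x, X0 y⟫ = c x y := fun x y => by
    rw [inner_star_right, InnerProductSpace.continuousLinearMapOfBilin_apply]
    rfl
  refine ⟨X0, ?_, fun x y => by rw [hX0]; exact hct x y⟩
  refine ContinuousLinearMap.opNorm_le_bound _ hr fun y => ?_
  have h1 := hcb (X0 y) y
  rw [← hX0, inner_self_eq_norm_sq_to_K] at h1
  simp only [Complex.coe_algebraMap, norm_pow, Complex.norm_real, norm_norm] at h1
  by_cases h0 : ‖X0 y‖ = 0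
  · rw [h0]; positivity
  · have : 0 < ‖X0 y‖ := lt_of_le_of_ne (norm_nonneg _) (Ne.symm h0)
    nlinarith

theorem wot_limit_mem {A : VonNeumannAlgebra H} {α : Type*} (u : Ultrafilter α)
    (X : α → H →L[ℂ] H) (X0 : H →L[ℂ] H)
    (hX : ∀ᶠ a in (u : Filter α), X a ∈ A)
    (h : ∀ x y, Tendsto (fun a => ⟪x, X a y⟫) u (𝓝 ⟪x, X0 y⟫)) : X0 ∈ A := by
  apply mem_of_commutes
  intro S hS
  ext v
  apply ext_inner_left ℂ
  intro w
  have h1 := h (star S w) v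
  have h2 := h w (S v)
  simp only [inner_star_left] at h1
  refine tendsto_nhds_unique h1 (h2.congr' ?_)
  filter_upwards [hX] with a ha
  rw [commutes_apply ha hS]

theorem separation {V : Type*} [AddCommGroup V] [Module ℂ V] (s : Set (V →ₗ[ℂ] ℂ))
    (hconv : ∀ L₁ ∈ s, ∀ L₂ ∈ s, ∀ t₁ t₂ : ℝ, 0 ≤ t₁ → 0 ≤ t₂ → t₁ + t₂ = 1 →
      (t₁ : ℂ) • L₁ + (t₂ : ℂ) • L₂ ∈ s)
    (hcl : ∀ (u : Ultrafilter (V →ₗ[ℂ] ℂ)) (L : V →ₗ[ℂ] ℂ), s ∈ u →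
      (∀ Y, Tendsto (fun L' : V →ₗ[ℂ] ℂ => L' Y) u (𝓝 (L Y))) → L ∈ s)
    (ψ : V →ₗ[ℂ] ℂ) (hψ : ψ ∉ s) :
    ∃ (Y : V) (c : ℝ), (∀ L ∈ s, (L Y).re < c) ∧ c < (ψ Y).re := by
  let B : (V →ₗ[ℂ] ℂ) →ₗ[ℂ] V →ₗ[ℂ] ℂ := LinearMap.id
  let s' : Set (WeakBilin B) := s
  have hs' : Convex ℝ s' := by
    intro x hx y hy a b ha hb hab
    have := hconv x hx y hy a b ha hb hab
    exact this
  have hcl' : IsClosed s' := by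
    rw [isClosed_iff_ultrafilter]
    intro L u hu hs
    refine hcl u L hs fun Y => ?_
    have := WeakBilin.eval_continuous B Y
    exact (this.tendsto L).mono_left hu
  obtain ⟨f, c, h1, h2⟩ := RCLike.geometric_hahn_banach_closed_point (𝕜 := ℂ) (E := WeakBilin B)
    hs' hcl' (x := ψ) hψ
  obtain ⟨Y, rfl⟩ := LinearMap.dualEmbedding_surjective B f
  exact ⟨Y, c, h1, h2⟩


open Filter Topology

theorem quarter_root {A : VonNeumannAlgebra H} {Y : H →L[ℂ] H} (hY : Y ∈ A) {ε : ℝ} (hε : 0 < ε) :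
    ∃ g ∈ A, ∃ k : H →L[ℂ] H, star g = g ∧ star k = k ∧ g * k = 1 ∧ k * g = 1 ∧
      g * (star Y * Y + (ε : ℂ) • 1) * g = k * k := by
  set C : H →L[ℂ] H := star Y * Y + (ε : ℂ) • 1 with hC
  have hCA : C ∈ A := add_mem (mul_mem (star_mem hY) hY) (SMulMemClass.smul_mem _ (one_mem A))
  have h0 : IsStrictlyPositive C := by
    have h1 : IsStrictlyPositive ((ε : ℂ) • (1 : H →L[ℂ] H)) :=
      IsStrictlyPositive.smul (by exact_mod_cast hε) isStrictlyPositive_one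
    exact IsStrictlyPositive.nonneg_add (star_mul_self_nonneg Y) h1
  have hu : IsUnit C := h0.isUnit
  refine ⟨C ^ (-(1/4) : ℝ), rpow_mem hCA _, C ^ ((1/4) : ℝ), ?_, ?_, ?_, ?_, ?_⟩
  · exact (CFC.rpow_nonneg.isSelfAdjoint : IsSelfAdjoint (C ^ (-(1/4) : ℝ)))
  · exact (CFC.rpow_nonneg.isSelfAdjoint : IsSelfAdjoint (C ^ ((1/4) : ℝ)))
  · exact CFC.rpow_neg_mul_rpow _ h0
  · exact CFC.rpow_mul_rpow_neg _ h0
  · conv_lhs => rw [← CFC.rpow_one C h0.nonneg]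
    rw [CFC.rpow_one C h0.nonneg]
    rw [← CFC.rpow_add hu]
    conv_lhs => enter [1,2]; rw [← CFC.rpow_one C h0.nonneg]
    rw [← CFC.rpow_add hu, ← CFC.rpow_add hu]
    norm_num

theorem polar_estimate {A : VonNeumannAlgebra H} {Y T : H →L[ℂ] H} (hY : Y ∈ A)
    (hT : T ∈ A.commutant) (ξ η : H) {l ε : ℝ} (hl : 0 < l) (hε : 0 < ε) :
    ∃ X ∈ A, ‖X‖ ≤ 1 ∧ ‖⟪T η, Y ξ⟫‖ ≤ ‖T‖ / (2 * √l) *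
      (((l : ℂ) * ⟪X ξ, Y ξ⟫ + ⟪star Y η, star X η⟫).re + l * (√ε * ‖ξ‖ ^ 2)) := by
  obtain ⟨g, hg, k, hgs, hks, hgk, hkg, hgc⟩ := quarter_root hY hε
  set C : H →L[ℂ] H := star Y * Y + (ε : ℂ) • 1 with hC
  have ig : ∀ x y, ⟪g x, y⟫ = ⟪x, g y⟫ := fun x y => by
    conv_lhs => rw [← hgs]
    rw [inner_star_left]
  have ik : ∀ x y, ⟪k x, y⟫ = ⟪x, k y⟫ := fun x y => by
    conv_lhs => rw [← hks]
    rw [inner_star_left]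
  have agk : ∀ x, g (k x) = x := fun x => congrArg (fun f : H →L[ℂ] H => f x) hgk
  have akg : ∀ x, k (g x) = x := fun x => congrArg (fun f : H →L[ℂ] H => f x) hkg
  have agc : ∀ x, g (C (g x)) = k (k x) := fun x => congrArg (fun f : H →L[ℂ] H => f x) hgc
  have aC : ∀ x, C x = star Y (Y x) + (ε : ℂ) • x := fun x => by simp [hC]
  have gC : ∀ x, g (C x) = C (g x) := fun x => by
    have h1 : g (C x) = k (k (k x)) := by
      rw [← agc, agk]
    have h2 : C (g x) = k (k (k x)) := by
      rw [← akg (C (g x)), agc]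
    rw [h1, h2]
  have gYY : ∀ x, g (star Y (Y x)) = star Y (Y (g x)) := fun x => by
    have := gC x
    rw [aC, aC, map_add, map_smul] at this
    exact add_right_cancel this
  -- norm identity
  have n1 : ∀ x, ⟪Y x, Y x⟫ + (ε : ℂ) * ⟪x, x⟫ = ⟪x, C x⟫ := fun x => by
    rw [aC, inner_add_right, inner_smul_right, inner_star_right]
  have n1' : ∀ x, ‖Y x‖ ^ 2 + ε * ‖x‖ ^ 2 = (⟪x, C x⟫).re := fun x => by
    rw [← n1, inner_self_eq_norm_sq_to_K, inner_self_eq_norm_sq_to_K]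
    simp only [Complex.coe_algebraMap]
    norm_cast
  have n2 : ∀ x, ‖Y (g (g x))‖ ^ 2 + ε * ‖g (g x)‖ ^ 2 = ‖x‖ ^ 2 := fun x => by
    rw [n1', ig, ig, agc, akg, agk, inner_self_eq_norm_sq_to_K]
    simp only [Complex.coe_algebraMap]
    norm_cast
  have n3 : ∀ x, ‖Y (g x)‖ ^ 2 + ε * ‖g x‖ ^ 2 = ‖k x‖ ^ 2 := fun x => by
    rw [n1', ig, agc, ← ik, inner_self_eq_norm_sq_to_K]
    simp only [Complex.coe_algebraMap]
    norm_cast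
  have n4 : ε * ‖g ξ‖ ^ 2 ≤ √ε * ‖ξ‖ ^ 2 := by
    have h1 : ‖g ξ‖ ^ 2 ≤ ‖ξ‖ * ‖g (g ξ)‖ := by
      have : ((‖g ξ‖ ^ 2 : ℝ) : ℂ) = ⟪ξ, g (g ξ)⟫ := by
        rw [← ig, inner_self_eq_norm_sq_to_K]; simp
      have h2 := norm_inner_le_norm (𝕜 := ℂ) ξ (g (g ξ))
      rw [← this, Complex.norm_real, Real.norm_of_nonneg (by positivity)] at h2
      exact h2
    have h2 : √ε * ‖g (g ξ)‖ ≤ ‖ξ‖ := by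
      apply le_of_sq_le_sq _ (norm_nonneg _)
      rw [mul_pow, Real.sq_sqrt hε.le]
      nlinarith [n2 ξ, sq_nonneg ‖Y (g (g ξ))‖]
    calc ε * ‖g ξ‖ ^ 2 = √ε * (√ε * ‖g ξ‖ ^ 2) := by
          rw [← mul_assoc, Real.mul_self_sqrt hε.le]
      _ ≤ √ε * (√ε * (‖ξ‖ * ‖g (g ξ)‖)) := by gcongr
      _ = √ε * (‖ξ‖ * (√ε * ‖g (g ξ)‖)) := by ring
      _ ≤ √ε * (‖ξ‖ * ‖ξ‖) := by gcongr
      _ = _ := by ring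
  refine ⟨Y * (g * g), mul_mem hY (mul_mem hg hg), ?_, ?_⟩
  · refine ContinuousLinearMap.opNorm_le_bound _ zero_le_one fun v => ?_
    rw [one_mul]
    apply le_of_sq_le_sq _ (norm_nonneg _)
    have := n2 v
    have h3 : 0 ≤ ε * ‖g (g v)‖ ^ 2 := by positivity
    change ‖Y (g (g v))‖ ^ 2 ≤ _
    linarith
  · have e1 : ⟪(Y * (g * g)) ξ, Y ξ⟫ = ((‖Y (g ξ)‖ ^ 2 : ℝ) : ℂ) := by
      change ⟪Y (g (g ξ)), Y ξ⟫ = _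
      rw [← inner_star_right, ig, gYY, inner_star_right, inner_self_eq_norm_sq_to_K]; simp
    have e2 : ⟪star Y η, star (Y * (g * g)) η⟫ = ((‖g (star Y η)‖ ^ 2 : ℝ) : ℂ) := by
      rw [star_mul, star_mul, hgs]
      change ⟪star Y η, g (g (star Y η))⟫ = _
      rw [← ig, inner_self_eq_norm_sq_to_K]; simp
    have e3 : ⟪T η, Y ξ⟫ = ⟪T (g (star Y η)), k ξ⟫ := by
      rw [← commutes_apply hg hT, ig, agk, ← commutes_apply (star_mem hY) hT, inner_star_left]
    rw [e1, e2, e3]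
    have e4 : ((l : ℂ) * ((‖Y (g ξ)‖ ^ 2 : ℝ) : ℂ) + ((‖g (star Y η)‖ ^ 2 : ℝ) : ℂ)).re
        = l * ‖Y (g ξ)‖ ^ 2 + ‖g (star Y η)‖ ^ 2 := by
      norm_cast
    rw [e4]
    set a := ‖g (star Y η)‖
    set b := ‖k ξ‖
    have hsl : 0 < √l := Real.sqrt_pos.2 hl
    have hab : ‖⟪T (g (star Y η)), k ξ⟫‖ ≤ ‖T‖ * (a * b) := by
      refine (norm_inner_le_norm _ _).trans ?_
      rw [← mul_assoc]
      gcongr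
      exact T.le_opNorm _
    refine hab.trans ?_
    rw [div_mul_eq_mul_div, mul_div_assoc]
    gcongr
    rw [le_div_iff₀ (by positivity)]
    have hb2 : b ^ 2 ≤ ‖Y (g ξ)‖ ^ 2 + √ε * ‖ξ‖ ^ 2 := by
      rw [← n3]; linarith
    have hll : √l * √l = l := Real.mul_self_sqrt hl.le
    nlinarith [sq_nonneg (a - √l * b), mul_le_mul_of_nonneg_left hb2 hl.le]


open Filter Topology

/-- The functional `Y ↦ l ⟪X ξ, Y ξ⟫ + ⟪Y* η, X* η⟫`. -/
def rnFun (A : VonNeumannAlgebra H) (l : ℝ) (ξ η : H) (X : H →L[ℂ] H) : ↥A →ₗ[ℂ] ℂ where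
  toFun Y := (l : ℂ) * ⟪X ξ, (Y : H →L[ℂ] H) ξ⟫ + ⟪star (Y : H →L[ℂ] H) η, star X η⟫
  map_add' Y Z := by
    simp only [inner_star_left]
    change (l : ℂ) * ⟪X ξ, ((Y : H →L[ℂ] H) + (Z : H →L[ℂ] H)) ξ⟫
      + ⟪η, ((Y : H →L[ℂ] H) + (Z : H →L[ℂ] H)) (star X η)⟫ = _
    simp only [add_apply, inner_add_right]
    ring
  map_smul' c Y := by
    simp only [inner_star_left]
    change (l : ℂ) * ⟪X ξ, (c • (Y : H →L[ℂ] H)) ξ⟫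
      + ⟪η, (c • (Y : H →L[ℂ] H)) (star X η)⟫ = _
    simp only [smul_apply, inner_smul_right, RingHom.id_apply, smul_eq_mul]
    ring

theorem rnFun_comb (A : VonNeumannAlgebra H) (l : ℝ) (ξ η : H) (X₁ X₂ : H →L[ℂ] H) (s t : ℝ) :
    (s : ℂ) • rnFun A l ξ η X₁ + (t : ℂ) • rnFun A l ξ η X₂
      = rnFun A l ξ η ((s : ℂ) • X₁ + (t : ℂ) • X₂) := by
  ext Y
  simp only [rnFun, LinearMap.add_apply, LinearMap.smul_apply, LinearMap.coe_mk, AddHom.coe_mk,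
    add_apply, smul_apply, inner_add_left, inner_smul_left,
    star_add, star_smul, inner_add_right, inner_smul_right, smul_eq_mul, Complex.conj_ofReal,
    RCLike.star_def]
  ring

theorem radon_nikodym {A : VonNeumannAlgebra H} {T : H →L[ℂ] H}
    (hT : T ∈ A.commutant) (ξ η : H) {l : ℝ} (hl : 0 < l) :
    ∃ X ∈ A, ∀ Y ∈ A, (l : ℂ) * ⟪X ξ, Y ξ⟫ + ⟪star Y η, star X η⟫ = ⟪T η, Y ξ⟫ := by
  set r : ℝ := ‖T‖ / (2 * √l) with hr
  have hr0 : 0 ≤ r := by positivity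
  let ψ : ↥A →ₗ[ℂ] ℂ :=
    { toFun := fun Y => ⟪T η, (Y : H →L[ℂ] H) ξ⟫
      map_add' := fun Y Z => by
        change ⟪T η, ((Y : H →L[ℂ] H) + (Z : H →L[ℂ] H)) ξ⟫ = _
        simp only [add_apply, inner_add_right]
      map_smul' := fun c Y => by
        change ⟪T η, (c • (Y : H →L[ℂ] H)) ξ⟫ = _
        simp only [smul_apply, inner_smul_right, RingHom.id_apply,
          smul_eq_mul] }
  let s : Set (↥A →ₗ[ℂ] ℂ) := {L | ∃ X ∈ A, ‖X‖ ≤ r ∧ L = rnFun A l ξ η X}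
  suffices hmem : ψ ∈ s by
    obtain ⟨X, hX, -, h⟩ := hmem
    exact ⟨X, hX, fun Y hY => (DFunLike.congr_fun h ⟨Y, hY⟩).symm⟩
  by_contra hψ
  have hsep : ∃ (Y : ↥A) (c : ℝ), (∀ L ∈ s, (L Y).re < c) ∧ c < (ψ Y).re := by
    refine separation s ?_ ?_ ψ hψ
    · rintro _ ⟨X₁, hX₁, hn₁, rfl⟩ _ ⟨X₂, hX₂, hn₂, rfl⟩ t₁ t₂ ht₁ ht₂ ht
      refine ⟨(t₁ : ℂ) • X₁ + (t₂ : ℂ) • X₂, add_mem (SMulMemClass.smul_mem _ hX₁)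
        (SMulMemClass.smul_mem _ hX₂), ?_, rnFun_comb ..⟩
      refine (norm_add_le _ _).trans ?_
      rw [norm_smul, norm_smul, Complex.norm_real, Complex.norm_real, Real.norm_of_nonneg ht₁,
        Real.norm_of_nonneg ht₂]
      nlinarith
    · intro u L hs hL
      classical
      have hch : ∀ L' : ↥A →ₗ[ℂ] ℂ, ∃ X : H →L[ℂ] H, L' ∈ s →
          (X ∈ A ∧ ‖X‖ ≤ r ∧ L' = rnFun A l ξ η X) := by
        intro L'
        by_cases h : L' ∈ s
        · obtain ⟨X, hX⟩ := h
          exact ⟨X, fun _ => hX⟩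
        · exact ⟨0, fun h' => absurd h' h⟩
      choose X hX using hch
      have hs' : ∀ᶠ L' in (u : Filter (↥A →ₗ[ℂ] ℂ)), L' ∈ s := hs
      obtain ⟨X0, hX0, hX0l⟩ := wot_limit u X r hr0 (hs'.mono fun L' h => (hX L' h).2.1)
      refine ⟨X0, wot_limit_mem u X X0 (hs'.mono fun L' h => (hX L' h).1) hX0l, hX0, ?_⟩
      ext Y
      refine tendsto_nhds_unique (hL Y) ?_
      have t1 : Tendsto (fun L' => (l : ℂ) * conj ⟪(Y : H →L[ℂ] H) ξ, X L' ξ⟫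
          + conj ⟪η, X L' (star (Y : H →L[ℂ] H) η)⟫) u
          (𝓝 ((l : ℂ) * conj ⟪(Y : H →L[ℂ] H) ξ, X0 ξ⟫
          + conj ⟪η, X0 (star (Y : H →L[ℂ] H) η)⟫)) :=
        (((Complex.continuous_conj.tendsto _).comp (hX0l _ _)).const_mul _).add
          ((Complex.continuous_conj.tendsto _).comp (hX0l _ _))
      have e : ∀ X' : H →L[ℂ] H, rnFun A l ξ η X' Y = (l : ℂ) * conj ⟪(Y : H →L[ℂ] H) ξ, X' ξ⟫
          + conj ⟪η, X' (star (Y : H →L[ℂ] H) η)⟫ := by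
        intro X'
        simp only [rnFun, LinearMap.coe_mk, AddHom.coe_mk, inner_conj_symm, inner_star_right]
      rw [e]
      refine t1.congr' ?_
      filter_upwards [hs'] with L' h
      rw [← e, ← (hX L' h).2.2]
  obtain ⟨⟨Y, hY⟩, c, h1, h2⟩ := hsep
  · -- contradiction with the polar estimate
    change c < (⟪T η, Y ξ⟫).re at h2
    have key : ∀ ε : ℝ, 0 < ε → (⟪T η, Y ξ⟫).re ≤ c + r * (l * (√ε * ‖ξ‖ ^ 2)) := by
      intro ε hε
      obtain ⟨X, hX, hX1, hX2⟩ := polar_estimate hY hT ξ η hl hε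
      have h3 := h1 (rnFun A l ξ η ((r : ℂ) • X + (0 : ℝ) • X))
        ⟨(r : ℂ) • X + (0 : ℝ) • X, ?_, ?_, rfl⟩
      · have h4 := rnFun_comb A l ξ η X X r 0
        have h5 : rnFun A l ξ η ((r : ℂ) • X + (0 : ℝ) • X) = (r : ℂ) • rnFun A l ξ η X := by
          simpa using h4.symm
        rw [h5] at h3
        have h6 : (((r : ℂ) • rnFun A l ξ η X) ⟨Y, hY⟩).re
          = r * ((l : ℂ) * ⟪X ξ, Y ξ⟫ + ⟪star Y η, star X η⟫).re := by
          simp only [LinearMap.smul_apply, smul_eq_mul, Complex.re_ofReal_mul]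
          rfl
        rw [h6] at h3
        have h7 := (Complex.re_le_norm _).trans hX2
        rw [mul_add] at h7
        linarith
      · rw [zero_smul, add_zero]; exact SMulMemClass.smul_mem _ hX
      · rw [zero_smul, add_zero, norm_smul, Complex.norm_real, Real.norm_of_nonneg hr0]
        exact mul_le_of_le_one_right hr0 hX1
    have hlim : Tendsto (fun ε : ℝ => c + r * (l * (√ε * ‖ξ‖ ^ 2))) (𝓝[>] 0)
        (𝓝 (c + r * (l * (√0 * ‖ξ‖ ^ 2)))) := by
      apply Tendsto.mono_left _ nhdsWithin_le_nhds
      apply Continuous.tendsto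
      fun_prop
    have := ge_of_tendsto hlim (by
      filter_upwards [self_mem_nhdsWithin] with ε hε
      exact key ε hε)
    simp at this
    linarith


set_option linter.unusedSectionVars false

open Filter Topology

/-! ### Amplifications -/

/-- The Hilbert space of square-summable families. -/
abbrev Amp (ι : Type*) (K : Type*) [NormedAddCommGroup K] := lp (fun _ : ι => K) 2

section amp
variable {ι : Type*} {G : Type*} [NormedAddCommGroup G] [InnerProductSpace ℂ G]

theorem two_pos' : 0 < (2 : ENNReal).toReal := by norm_num

theorem amp_hasSum_sq (v : Amp ι H) : HasSum (fun i => ‖v i‖ ^ 2) (‖v‖ ^ 2) := by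
  have := lp.hasSum_norm two_pos' v
  simpa using this

theorem amp_inner (v w : Amp ι H) : HasSum (fun i => ⟪v i, w i⟫) ⟪v, w⟫ := lp.hasSum_inner v w

theorem amp_ext {v w : Amp ι H} (h : ∀ i, v i = w i) : v = w := lp.ext (funext h)

/-- A square-summable family as an element of the amplification. -/
def toAmp (v : ι → H) (h : Summable fun i => ‖v i‖ ^ 2) : Amp ι H :=
  ⟨v, memℓp_gen (by simpa using h)⟩

@[simp] theorem toAmp_apply (v : ι → H) (h : Summable fun i => ‖v i‖ ^ 2) (i : ι) :
    toAmp v h i = v i := rfl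

theorem summable_sq_of_bound {f : ι → ℝ} {C : ℝ} (hf : ∀ i, 0 ≤ f i)
    (h : ∀ F : Finset ι, ∑ i ∈ F, f i ≤ C) : Summable f :=
  summable_of_sum_le hf h

/-- The column operator. -/
def colOp (a : ι → G →L[ℂ] H) (C : ℝ) (hC : 0 ≤ C)
    (h : ∀ (F : Finset ι) (v : G), ∑ i ∈ F, ‖a i v‖ ^ 2 ≤ (C * ‖v‖) ^ 2) : G →L[ℂ] Amp ι H :=
  LinearMap.mkContinuous
    { toFun := fun v => toAmp (fun i => a i v)
        (summable_sq_of_bound (fun i => by positivity) fun F => h F v)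
      map_add' := fun v w => amp_ext fun i => by simp
      map_smul' := fun c v => amp_ext fun i => by simp }
    C (fun v => by
      refine le_of_sq_le_sq ?_ (by positivity)
      rw [← (amp_hasSum_sq _).tsum_eq]
      exact (summable_sq_of_bound (fun i => by positivity) fun F => h F v).tsum_le_of_sum_le
        fun F => h F v)

@[simp] theorem colOp_apply (a : ι → G →L[ℂ] H) (C : ℝ) (hC : 0 ≤ C)
    (h : ∀ (F : Finset ι) (v : G), ∑ i ∈ F, ‖a i v‖ ^ 2 ≤ (C * ‖v‖) ^ 2) (v : G) (i : ι) :
    colOp a C hC h v i = a i v := rfl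

/-- Coordinate projection. -/
def pr (i : ι) : Amp ι H →L[ℂ] H := lp.evalCLM ℂ (fun _ : ι => H) 2 i

@[simp] theorem pr_apply (i : ι) (v : Amp ι H) : pr i v = v i := rfl

open Classical in
/-- Coordinate inclusion. -/
def sg (i : ι) : H →L[ℂ] Amp ι H := lp.singleContinuousLinearMap ℂ (fun _ : ι => H) 2 i

@[simp] theorem sg_self (i : ι) (v : H) : sg i v i = v := by
  classical
  exact lp.single_apply_self (E := fun _ : ι => H) 2 i v

theorem sg_ne {i j : ι} (h : j ≠ i) (v : H) : sg i v j = 0 := by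
  classical
  exact lp.single_apply_ne (E := fun _ : ι => H) 2 i v h

theorem inner_sg_left (i : ι) (v : H) (w : Amp ι H) : ⟪sg i v, w⟫ = ⟪v, w i⟫ := by
  classical
  exact lp.inner_single_left (G := fun _ : ι => H) i v w

theorem inner_sg_right (i : ι) (v : H) (w : Amp ι H) : ⟪w, sg i v⟫ = ⟪w i, v⟫ := by
  classical
  exact lp.inner_single_right (G := fun _ : ι => H) i v w

/-- The diagonal operator. -/
def diag (ι : Type*) (X : H →L[ℂ] H) : Amp ι H →L[ℂ] Amp ι H :=
  colOp (fun i => X ∘L pr i) ‖X‖ (norm_nonneg _) (fun F v => by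
    rw [mul_pow, ← (amp_hasSum_sq v).tsum_eq]
    calc ∑ i ∈ F, ‖(X ∘L pr i) v‖ ^ 2 ≤ ∑ i ∈ F, ‖X‖ ^ 2 * ‖v i‖ ^ 2 := by
          refine Finset.sum_le_sum fun i _ => ?_
          rw [← mul_pow]
          gcongr
          exact X.le_opNorm _
      _ = ‖X‖ ^ 2 * ∑ i ∈ F, ‖v i‖ ^ 2 := by rw [Finset.mul_sum]
      _ ≤ _ := by
          gcongr
          exact (amp_hasSum_sq v).summable.sum_le_tsum F fun i _ => by positivity)

@[simp] theorem diag_apply (X : H →L[ℂ] H) (v : Amp ι H) (i : ι) : diag ι X v i = X (v i) := rfl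

theorem diag_mul (X Y : H →L[ℂ] H) : diag ι (X * Y) = diag ι X * diag ι Y := by
  ext v i; rfl

theorem diag_one : diag ι (1 : H →L[ℂ] H) = 1 := by
  ext v i; rfl

theorem diag_add (X Y : H →L[ℂ] H) : diag ι (X + Y) = diag ι X + diag ι Y := by
  ext v i; rfl

theorem diag_smul (c : ℂ) (X : H →L[ℂ] H) : diag ι (c • X) = c • diag ι X := by
  ext v i; rfl

theorem diag_sg (X : H →L[ℂ] H) (i : ι) (v : H) : diag ι X (sg i v) = sg i (X v) := by
  apply amp_ext
  intro j
  by_cases h : j = i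
  · subst h; simp
  · simp [sg_ne h]

theorem inner_diag_star (X : H →L[ℂ] H) (v w : Amp ι H) :
    ⟪diag ι (star X) v, w⟫ = ⟪v, diag ι X w⟫ := by
  refine (amp_inner _ _).unique ?_
  convert amp_inner v (diag ι X w) using 2 with i
  rw [diag_apply, diag_apply, inner_star_left]

theorem star_diag (X : H →L[ℂ] H) : star (diag ι X) = diag ι (star X) := by
  ext1 v
  apply ext_inner_right ℂ
  intro w
  rw [inner_star_left, inner_diag_star]

theorem entry_mem {A : VonNeumannAlgebra H} {S : Amp ι H →L[ℂ] Amp ι H}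
    (hS : ∀ X ∈ A, ∀ v, diag ι X (S v) = S (diag ι X v)) (i j : ι) :
    pr i ∘L S ∘L sg j ∈ A.commutant := by
  rw [VonNeumannAlgebra.mem_commutant_iff]
  intro X hX
  ext v
  change X (S (sg j v) i) = S (sg j (X v)) i
  rw [← diag_apply, hS X hX, diag_sg]

end amp

/-! ### Projections onto invariant subspaces -/

/-- Projection onto the closure of a subspace. -/
def clProj (R : Submodule ℂ H) : H →L[ℂ] H := R.topologicalClosure.starProjection

theorem clProj_of_mem {R : Submodule ℂ H} {v : H} (h : v ∈ R) : clProj R v = v :=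
  Submodule.starProjection_eq_self_iff.2 (R.le_topologicalClosure h)

theorem clProj_inner {R : Submodule ℂ H} (v w : H) : ⟪clProj R v, w⟫ = ⟪v, clProj R w⟫ :=
  Submodule.inner_starProjection_left_eq_right _ _ _

theorem clProj_idem {R : Submodule ℂ H} (v : H) : clProj R (clProj R v) = clProj R v :=
  Submodule.starProjection_eq_self_iff.2 (Submodule.starProjection_apply_mem _ _)

theorem clProj_eq_zero {R : Submodule ℂ H} {v : H} (h : ∀ r ∈ R, ⟪r, v⟫ = 0) :
    clProj R v = 0 := by
  apply (Submodule.starProjection_apply_eq_zero_iff _).2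
  rw [Submodule.orthogonal_closure]
  exact (Submodule.mem_orthogonal _ _).2 h

theorem clProj_comm {R : Submodule ℂ H} {S : H →L[ℂ] H} (h1 : ∀ r ∈ R, S r ∈ R)
    (h2 : ∀ r ∈ R, star S r ∈ R) (v : H) : S (clProj R v) = clProj R (S v) := by
  have hcl : ∀ r ∈ R.topologicalClosure, S r ∈ R.topologicalClosure := by
    intro r hr
    have : Set.MapsTo S (R : Set H) (R : Set H) := h1
    exact this.closure S.continuous hr
  refine (Submodule.eq_starProjection_of_mem_orthogonal (hcl _ ?_) ?_).symm
  · exact Submodule.starProjection_apply_mem _ _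
  · rw [Submodule.orthogonal_closure, ← map_sub, Submodule.mem_orthogonal]
    intro r hr
    rw [← inner_star_left]
    have h3 : v - clProj R v ∈ R.topologicalClosureᗮ := Submodule.sub_starProjection_mem_orthogonal v
    rw [Submodule.orthogonal_closure] at h3
    exact (Submodule.mem_orthogonal _ _).1 h3 _ (h2 r hr)


open Filter Topology

/-- Vectors `diag X w`. -/
def cycD (A : VonNeumannAlgebra H) {ι : Type*} (w : Amp ι H) : Submodule ℂ (Amp ι H) where
  carrier := {v | ∃ X ∈ A, v = diag ι X w}
  add_mem' := by
    rintro _ _ ⟨X, hX, rfl⟩ ⟨Y, hY, rfl⟩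
    exact ⟨X + Y, add_mem hX hY, by rw [diag_add]; rfl⟩
  zero_mem' := ⟨0, zero_mem A, by apply amp_ext; intro i; simp⟩
  smul_mem' := by
    rintro c _ ⟨X, hX, rfl⟩
    exact ⟨c • X, SMulMemClass.smul_mem _ hX, by rw [diag_smul]; rfl⟩

theorem self_mem_cycD (A : VonNeumannAlgebra H) {ι : Type*} (w : Amp ι H) : w ∈ cycD A w :=
  ⟨1, one_mem A, by rw [diag_one]; rfl⟩

theorem cycD_comm (A : VonNeumannAlgebra H) {ι : Type*} (w : Amp ι H) {X : H →L[ℂ] H}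
    (hX : X ∈ A) (v : Amp ι H) :
    diag ι X (clProj (cycD A w) v) = clProj (cycD A w) (diag ι X v) := by
  apply clProj_comm
  · rintro _ ⟨Y, hY, rfl⟩
    exact ⟨X * Y, mul_mem hX hY, by rw [diag_mul]; rfl⟩
  · rintro _ ⟨Y, hY, rfl⟩
    exact ⟨star X * Y, mul_mem (star_mem hX) hY, by rw [diag_mul, star_diag]; rfl⟩

/-- Vectors `X w`. -/
def cyc (A : VonNeumannAlgebra H) (w : H) : Submodule ℂ H where
  carrier := {v | ∃ X ∈ A, v = X w}
  add_mem' := by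
    rintro _ _ ⟨X, hX, rfl⟩ ⟨Y, hY, rfl⟩
    exact ⟨X + Y, add_mem hX hY, rfl⟩
  zero_mem' := ⟨0, zero_mem A, rfl⟩
  smul_mem' := by
    rintro c _ ⟨X, hX, rfl⟩
    exact ⟨c • X, SMulMemClass.smul_mem _ hX, rfl⟩

theorem cyc_mem_commutant (A : VonNeumannAlgebra H) (w : H) : clProj (cyc A w) ∈ A.commutant := by
  rw [VonNeumannAlgebra.mem_commutant_iff]
  intro X hX
  ext v
  refine clProj_comm ?_ ?_ v
  · rintro _ ⟨Y, hY, rfl⟩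
    exact ⟨X * Y, mul_mem hX hY, rfl⟩
  · rintro _ ⟨Y, hY, rfl⟩
    exact ⟨star X * Y, mul_mem (star_mem hX) hY, rfl⟩

theorem inner_self_real (v : H) : ⟪v, v⟫ = ((‖v‖ ^ 2 : ℝ) : ℂ) := by
  rw [inner_self_eq_norm_sq_to_K]; simp

theorem duality_lemma {A : VonNeumannAlgebra H} (p q ξ η : H)
    (ha : ∀ X ∈ A, ⟪p, X ξ⟫ = ⟪star X η, q⟫)
    (hb : ∀ S ∈ A.commutant, ⟪p, S η⟫ + 2 * ⟪star S ξ, q⟫ = 0) :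
    ∀ X ∈ A, ⟪p, X ξ⟫ = 0 := by
  set w : Amp Bool H := sg false ξ + sg true q with hw
  set P := clProj (cycD A w) with hP
  have hPw : P w = w := clProj_of_mem (self_mem_cycD A w)
  have hP0 : P (sg false p - sg true η) = 0 := by
    apply clProj_eq_zero
    rintro _ ⟨X, hX, rfl⟩
    rw [hw, map_add, diag_sg, diag_sg, inner_add_left, inner_sg_left, inner_sg_left]
    simp only [lp.coeFn_sub, Pi.sub_apply, sg_self]
    rw [sg_ne (by decide), sg_ne (by decide), sub_zero, zero_sub, inner_neg_right]
    have h1 := congrArg conj (ha X hX)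
    rw [inner_conj_symm, inner_conj_symm, inner_star_right] at h1
    rw [h1, add_neg_cancel]
  have hP1 : P (sg true η) = P (sg false p) := by
    rw [map_sub, sub_eq_zero] at hP0; exact hP0.symm
  have hPi : ∀ v w, ⟪P v, w⟫ = ⟪v, P w⟫ := clProj_inner
  have hPP : ∀ v, P (P v) = P v := clProj_idem
  have hb' := hb _ (entry_mem (fun X hX v => cycD_comm A w hX v) false true)
  rw [inner_star_left] at hb'
  have e1 : ⟪p, (pr false ∘L P ∘L sg true) η⟫ = ((‖P (sg false p)‖ ^ 2 : ℝ) : ℂ) := by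
    change ⟪p, (P (sg true η)) false⟫ = _
    rw [← inner_sg_left, hP1, ← hPP, ← hPi, inner_self_real, hPP]
  set d := sg true q - P (sg true q) with hd
  have hPd : P d = 0 := by rw [hd, map_sub, hPP, sub_self]
  have e2 : P (sg false ξ) = sg false ξ + d := by
    have : P (sg false ξ) + P (sg true q) = sg false ξ + sg true q := by rw [← map_add]; exact hPw
    rw [hd, ← add_sub_assoc, ← this, add_sub_cancel_right]
  have e3 : ⟪ξ, (pr false ∘L P ∘L sg true) q⟫ = ((‖d‖ ^ 2 : ℝ) : ℂ) := by
    change ⟪ξ, (P (sg true q)) false⟫ = _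
    rw [← inner_sg_left, ← hPi, e2, inner_add_left, inner_sg_left, sg_ne (by decide),
      inner_zero_right, zero_add, ← inner_self_real]
    have h2 : ⟪d, P (sg true q)⟫ = 0 := by rw [← hPi, hPd, inner_zero_left]
    conv_rhs => rw [hd]
    rw [← hd, inner_sub_right, h2, sub_zero]
  rw [e1, e3] at hb'
  have hb2 : ‖P (sg false p)‖ ^ 2 + 2 * ‖d‖ ^ 2 = 0 := by exact_mod_cast hb'
  have h3 : ‖P (sg false p)‖ ^ 2 = 0 := by nlinarith [sq_nonneg ‖P (sg false p)‖, sq_nonneg ‖d‖]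
  have h4 : ‖d‖ ^ 2 = 0 := by nlinarith [sq_nonneg ‖P (sg false p)‖, sq_nonneg ‖d‖]
  have h5 : P (sg false p) = 0 := by simpa using h3
  have h6 : d = 0 := by simpa using h4
  rw [h6, add_zero] at e2
  intro X hX
  have h7 : ⟪p, X ξ⟫ = ⟪sg (ι := Bool) false p, diag Bool X (sg false ξ)⟫ := by
    rw [inner_sg_left, diag_apply, sg_self]
  rw [h7, ← e2, cycD_comm A w hX, ← hPi, h5, inner_zero_left]

theorem key_lemma {A : VonNeumannAlgebra H} (ξ η : H) {T Y₀ : H →L[ℂ] H} (hT : T ∈ A.commutant)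
    (hY₀ : Y₀ ∈ A) (hne : ⟪T η, Y₀ ξ⟫ ≠ 0) :
    ∃ Z ∈ A, ∃ S ∈ A.commutant, Z ξ = S η ∧ Z ξ ≠ 0 := by
  obtain ⟨X₁, hX₁, E1⟩ := radon_nikodym hT ξ η (l := 1) one_pos
  obtain ⟨X₂, hX₂, E2⟩ := radon_nikodym hT ξ η (l := 2) two_pos
  have hX₁' : (1/2 : ℂ) • X₁ ∈ A.commutant.commutant := by
    rw [A.commutant_commutant]; exact SMulMemClass.smul_mem _ hX₁
  obtain ⟨T₂, hT₂, E3⟩ := radon_nikodym hX₁' η ξ (l := 1/2) (by norm_num)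
  set Z : H →L[ℂ] H := (2 : ℂ) • X₂ - X₁ with hZdef
  have hZ : Z ∈ A := sub_mem (SMulMemClass.smul_mem _ hX₂) hX₁
  have hD : X₁ - X₂ ∈ A := sub_mem hX₁ hX₂
  have aZ : ∀ v, Z v = (2 : ℂ) • X₂ v - X₁ v := fun v => rfl
  have D : ∀ Y ∈ A, ⟪Z ξ, Y ξ⟫ = ⟪star Y η, star (X₁ - X₂) η⟫ := by
    intro Y hY
    have h1 := E1 Y hY
    have h2 := E2 Y hY
    rw [aZ, star_sub, sub_apply, inner_sub_left, inner_sub_right, inner_smul_left]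
    simp only [Complex.ofReal_one, Complex.ofReal_ofNat, map_ofNat] at h1 h2 ⊢
    linear_combination h2 - h1
  refine ⟨Z, hZ, clProj (cyc A ξ) * T₂, mul_mem (cyc_mem_commutant A ξ) hT₂, ?_, ?_⟩
  · have hdual := duality_lemma (A := A) (Z ξ - T₂ η) (star (X₁ - X₂) η - star T₂ ξ) ξ η ?_ ?_
    · have h0 : clProj (cyc A ξ) (Z ξ - T₂ η) = 0 := by
        apply clProj_eq_zero
        rintro _ ⟨X, hX, rfl⟩
        rw [← inner_conj_symm, hdual X hX, map_zero]
      rw [map_sub, clProj_of_mem (show Z ξ ∈ cyc A ξ from ⟨Z, hZ, rfl⟩), sub_eq_zero] at h0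
      exact h0
    · intro Y hY
      rw [inner_sub_left, inner_sub_right, D Y hY, inner_star_right T₂,
        ← commutes_apply (star_mem hY) hT₂, inner_star_left Y (T₂ η)]
    · intro S hS
      have h3 := E3 S hS
      have h4 : ⟪star S ξ, star (X₁ - X₂) η⟫ = ⟪X₁ ξ, S η⟫ - ⟪X₂ ξ, S η⟫ := by
        rw [inner_star_right, commutes_apply hD (star_mem hS), inner_star_left, sub_apply,
          inner_sub_left]
      rw [inner_sub_left, inner_sub_right, h4, aZ, inner_sub_left, inner_smul_left]
      rw [smul_apply, inner_smul_left] at h3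
      simp only [Complex.ofReal_div, Complex.ofReal_one, Complex.ofReal_ofNat, map_ofNat, map_div₀,
        map_one] at h3 ⊢
      linear_combination (-2) * h3
  · intro h0
    have h1 : star (X₁ - X₂) η = 0 := by
      have := D _ hD
      rw [h0, inner_zero_left] at this
      exact inner_self_eq_zero.1 this.symm
    have h2 : (X₁ - X₂) ξ = X₂ ξ := by
      rw [aZ, sub_eq_zero] at h0
      rw [sub_apply, ← h0, two_smul, add_sub_cancel_right]
    have h3 : ⟪T η, X₂ ξ⟫ = 0 := by
      rw [← h2, ← inner_star_left, commutes_apply (star_mem hD) hT, h1, map_zero, inner_zero_left]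
    have h4 := E2 X₂ hX₂
    rw [h3, inner_self_real, inner_self_real] at h4
    have h5 : 2 * ‖X₂ ξ‖ ^ 2 + ‖star X₂ η‖ ^ 2 = 0 := by exact_mod_cast h4
    have h6 : ‖X₂ ξ‖ ^ 2 = 0 := by nlinarith [sq_nonneg ‖X₂ ξ‖, sq_nonneg ‖star X₂ η‖]
    have h7 : ‖star X₂ η‖ ^ 2 = 0 := by nlinarith [sq_nonneg ‖X₂ ξ‖, sq_nonneg ‖star X₂ η‖]
    have h8 : X₂ ξ = 0 := by simpa using h6
    have h9 : star X₂ η = 0 := by simpa only [ne_eq, OfNat.ofNat_ne_zero, not_false_eq_true, pow_eq_zero_iff, norm_eq_zero] using h7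
    apply hne
    rw [← E2 Y₀ hY₀, h8, h9]
    simp

theorem overlap {A : VonNeumannAlgebra H} (ξ η : H)
    (hz : ∀ z ∈ A, z ∈ A.commutant → ⟪ξ, z ξ⟫ = ⟪η, z η⟫)
    (h : ∀ T ∈ A.commutant, ∀ Y ∈ A, ⟪T η, Y ξ⟫ = 0) : ξ = 0 := by
  set R : Submodule ℂ H := Submodule.span ℂ {v | ∃ T ∈ A.commutant, ∃ Y ∈ A, v = T (Y ξ)} with hR
  have inv1 : ∀ X ∈ A, ∀ r ∈ R, X r ∈ R := by
    intro X hX r hr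
    have : R ≤ R.comap (X : H →ₗ[ℂ] H) := by
      conv_lhs => rw [hR]
      rw [Submodule.span_le]
      rintro _ ⟨T, hT, Y, hY, rfl⟩
      change X (T (Y ξ)) ∈ R
      rw [commutes_apply hX hT]
      exact Submodule.subset_span ⟨T, hT, X * Y, mul_mem hX hY, rfl⟩
    exact this hr
  have inv2 : ∀ S ∈ A.commutant, ∀ r ∈ R, S r ∈ R := by
    intro S hS r hr
    have : R ≤ R.comap (S : H →ₗ[ℂ] H) := by
      conv_lhs => rw [hR]
      rw [Submodule.span_le]
      rintro _ ⟨T, hT, Y, hY, rfl⟩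
      exact Submodule.subset_span ⟨S * T, mul_mem hS hT, Y, hY, rfl⟩
    exact this hr
  have m1 : clProj R ∈ A := by
    apply mem_of_commutes
    intro S hS
    ext v
    exact clProj_comm (inv2 S hS) (inv2 _ (star_mem hS)) v
  have m2 : clProj R ∈ A.commutant := by
    rw [VonNeumannAlgebra.mem_commutant_iff]
    intro X hX
    ext v
    exact clProj_comm (inv1 X hX) (inv1 _ (star_mem hX)) v
  have e1 : clProj R ξ = ξ :=
    clProj_of_mem (Submodule.subset_span ⟨1, one_mem _, 1, one_mem _, rfl⟩)
  have e2 : clProj R η = 0 := by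
    apply clProj_eq_zero
    intro r hr
    have : R ≤ LinearMap.ker (innerSL ℂ η : H →ₗ[ℂ] ℂ) := by
      rw [hR, Submodule.span_le]
      rintro _ ⟨T, hT, Y, hY, rfl⟩
      change ⟪η, T (Y ξ)⟫ = 0
      rw [← inner_star_left]
      exact h _ (star_mem hT) Y hY
    have h1 : ⟪η, r⟫ = 0 := this hr
    rw [← inner_conj_symm, h1, map_zero]
  have := hz _ m1 m2
  rw [e1, e2, inner_zero_right] at this
  exact inner_self_eq_zero.1 this


open Filter Topology

theorem defect_sqrt {A : VonNeumannAlgebra H} {ι : Type*} (a : ι → H →L[ℂ] H) (ha : ∀ k, a k ∈ A)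
    (h : ∀ (F : Finset ι) (v : H), ∑ k ∈ F, ‖a k v‖ ^ 2 ≤ ‖v‖ ^ 2) :
    ∃ s ∈ A, star s = s ∧ ∀ x y, HasSum (fun k => ⟪a k x, a k y⟫) (⟪x, y⟫ - ⟪s x, s y⟫) := by
  let V : H →L[ℂ] Amp ι H := colOp a 1 zero_le_one (fun F v => by rw [one_mul]; exact h F v)
  let N : H →L[ℂ] H := ContinuousLinearMap.adjoint V ∘L V
  have hN : ∀ x y, ⟪x, N y⟫ = ⟪V x, V y⟫ := fun x y => ContinuousLinearMap.adjoint_inner_right V x (V y)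
  have hV : ∀ x y, HasSum (fun k => ⟪a k x, a k y⟫) ⟪V x, V y⟫ := fun x y => amp_inner (V x) (V y)
  have hNA : N ∈ A := by
    apply mem_of_commutes
    intro S hS
    ext v
    apply ext_inner_left ℂ
    intro w
    change ⟪w, S (N v)⟫ = ⟪w, N (S v)⟫
    rw [← inner_star_left, hN, hN]
    refine (hV _ _).unique ?_
    convert hV w (S v) using 2 with k
    rw [commutes_apply (ha k) hS, commutes_apply (ha k) (star_mem hS), inner_star_left]
  have hVn : ∀ v, ‖V v‖ ^ 2 ≤ ‖v‖ ^ 2 := fun v => by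
    have h1 := amp_hasSum_sq (V v)
    exact le_of_tendsto h1 (Eventually.of_forall fun F => h F v)
  have hpos : (0 : H →L[ℂ] H) ≤ 1 - N := by
    rw [ContinuousLinearMap.nonneg_iff_isPositive, ContinuousLinearMap.isPositive_iff_complex]
    intro x
    have e : ⟪(1 - N) x, x⟫ = ((‖x‖ ^ 2 - ‖V x‖ ^ 2 : ℝ) : ℂ) := by
      rw [← inner_conj_symm, sub_apply, inner_sub_right, hN]
      change conj (⟪x, x⟫ - _) = _
      rw [inner_self_real, inner_self_real, ← Complex.ofReal_sub, Complex.conj_ofReal]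
    rw [e]
    constructor
    · simp only [RCLike.re_to_complex, Complex.ofReal_re]
    · simp only [RCLike.re_to_complex, Complex.ofReal_re]
      linarith [hVn x]
  have hs := CFC.sqrt_mul_sqrt_self (1 - N) hpos
  refine ⟨CFC.sqrt (1 - N), sqrt_mem (sub_mem (one_mem A) hNA),
    (CFC.sqrt_nonneg (1 - N)).isSelfAdjoint, fun x y => ?_⟩
  have hss : star (CFC.sqrt (1 - N)) = CFC.sqrt (1 - N) := (CFC.sqrt_nonneg (1 - N)).isSelfAdjoint
  convert hV x y using 1
  have : ⟪CFC.sqrt (1 - N) x, CFC.sqrt (1 - N) y⟫ = ⟪x, y⟫ - ⟪x, N y⟫ := by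
    have h0 : ⟪CFC.sqrt (1 - N) x, CFC.sqrt (1 - N) y⟫
        = ⟪star (CFC.sqrt (1 - N)) x, CFC.sqrt (1 - N) y⟫ := by rw [hss]
    rw [h0, inner_star_left]
    have h2 : CFC.sqrt (1 - N) (CFC.sqrt (1 - N) y) = (1 - N) y :=
      congrArg (fun f : H →L[ℂ] H => f y) hs
    rw [h2, sub_apply, inner_sub_right]
    rfl
  rw [this, hN]
  ring

/-- Admissible families for the exhaustion argument. -/
def GoodFam (A : VonNeumannAlgebra H) (ξ η : H)
    (s : Set (((H →L[ℂ] H) × (H →L[ℂ] H)) × ℕ)) : Prop :=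
  (∀ t ∈ s, t.1.1 ∈ A ∧ t.1.2 ∈ A.commutant ∧ t.1.1 ξ = t.1.2 η ∧ t.1.1 ξ ≠ 0) ∧
  ∀ F : Finset (((H →L[ℂ] H) × (H →L[ℂ] H)) × ℕ), ↑F ⊆ s → ∀ v : H,
    ∑ t ∈ F, ‖t.1.1 v‖ ^ 2 ≤ ‖v‖ ^ 2 ∧ ∑ t ∈ F, ‖t.1.2 v‖ ^ 2 ≤ ‖v‖ ^ 2

theorem exists_maximal_fam (A : VonNeumannAlgebra H) (ξ η : H) :
    ∃ s, Maximal (· ∈ {s | GoodFam A ξ η s}) s := by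
  apply zorn_subset
  intro c hc hchain
  rcases c.eq_empty_or_nonempty with rfl | hne
  · refine ⟨∅, ⟨fun t ht => absurd ht (Set.notMem_empty t), fun F hF v => ?_⟩,
      fun s hs => absurd hs (Set.notMem_empty s)⟩
    have : F = ∅ := by simpa using hF
    subst this
    simp
  · refine ⟨⋃₀ c, ⟨?_, ?_⟩, fun s hs => Set.subset_sUnion_of_mem hs⟩
    · rintro t ⟨s, hs, ht⟩
      exact (hc hs).1 t ht
    · intro F hF v
      obtain ⟨s, hs, hFs⟩ := hchain.directedOn.exists_mem_subset_of_finite_of_subset_sUnion hne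
        F.finite_toSet hF
      exact (hc hs).2 F hFs v

theorem exhaustion {A : VonNeumannAlgebra H} (ξ η : H)
    (hz : ∀ z ∈ A, z ∈ A.commutant → ⟪ξ, z ξ⟫ = ⟪η, z η⟫) :
    ∃ (ι : Type u) (a b : ι → H →L[ℂ] H) (s d : H →L[ℂ] H), (∀ k, a k ∈ A) ∧
      (∀ k, b k ∈ A.commutant) ∧ (∀ k, a k ξ = b k η) ∧ (∀ k, a k ξ ≠ 0) ∧ s ∈ A ∧
      (∀ x y, HasSum (fun k => ⟪a k x, a k y⟫) (⟪x, y⟫ - ⟪s x, s y⟫)) ∧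
      (∀ x y, HasSum (fun k => ⟪b k x, b k y⟫) (⟪x, y⟫ - ⟪d x, d y⟫)) ∧
      s ξ = 0 ∧ d η = 0 := by
  classical
  obtain ⟨𝒮, hmax⟩ := exists_maximal_fam A ξ η
  have hgood : GoodFam A ξ η 𝒮 := hmax.prop
  let a : ↥𝒮 → H →L[ℂ] H := fun t => t.1.1.1
  let b : ↥𝒮 → H →L[ℂ] H := fun t => t.1.1.2
  have ha : ∀ k, a k ∈ A := fun k => (hgood.1 k.1 k.2).1
  have hb : ∀ k, b k ∈ A.commutant := fun k => (hgood.1 k.1 k.2).2.1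
  have hab : ∀ k, a k ξ = b k η := fun k => (hgood.1 k.1 k.2).2.2.1
  have hsub : ∀ F : Finset ↥𝒮, (↑(F.map (Function.Embedding.subtype _)) :
      Set (((H →L[ℂ] H) × (H →L[ℂ] H)) × ℕ)) ⊆ 𝒮 := by
    intro F t ht
    simp only [Finset.coe_map, Set.mem_image] at ht
    obtain ⟨t', -, rfl⟩ := ht
    exact t'.2
  obtain ⟨s, hs, hss, hsum⟩ := defect_sqrt a ha (fun F v => by
    have := (hgood.2 _ (hsub F) v).1
    rwa [Finset.sum_map] at this)
  obtain ⟨d, hd, hds, hdsum⟩ := defect_sqrt b hb (fun F v => by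
    have := (hgood.2 _ (hsub F) v).2
    rwa [Finset.sum_map] at this)
  have hz' : ∀ z ∈ A, z ∈ A.commutant → ⟪s ξ, z (s ξ)⟫ = ⟪d η, z (d η)⟫ := by
    intro z hzA hzC
    rw [← commutes_apply hs hzC, commutes_apply hzA hd]
    have h1 := hsum ξ (z ξ)
    have h2 := hdsum η (z η)
    have h3 : (fun k => ⟪a k ξ, a k (z ξ)⟫) = fun k => ⟪b k η, b k (z η)⟫ := by
      funext k
      rw [commutes_apply (ha k) hzC, ← commutes_apply hzA (hb k), hab]
    rw [h3] at h1
    have h4 := h1.unique h2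
    rw [hz z hzA hzC] at h4
    exact sub_right_injective h4
  have hsξ : s ξ = 0 := by
    by_contra hne
    have : ∃ T ∈ A.commutant, ∃ Y ∈ A, ⟪T (d η), Y (s ξ)⟫ ≠ 0 := by
      by_contra! hcon
      exact hne (overlap _ _ hz' hcon)
    obtain ⟨T, hT, Y, hY, hTY⟩ := this
    obtain ⟨Z, hZ, S, hS, hZS, hZ0⟩ := key_lemma (s ξ) (d η) hT hY hTY
    set c : ℝ := (1 + ‖Z‖ + ‖S‖)⁻¹ with hc
    have hc0 : 0 < c := by positivity
    have hcZ : c * ‖Z‖ ≤ 1 := by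
      rw [hc, inv_mul_le_iff₀ (by positivity)]; linarith [norm_nonneg S]
    have hcS : c * ‖S‖ ≤ 1 := by
      rw [hc, inv_mul_le_iff₀ (by positivity)]; linarith [norm_nonneg Z]
    set a' : H →L[ℂ] H := (c : ℂ) • (Z * s) with ha'
    set b' : H →L[ℂ] H := (c : ℂ) • (S * d) with hb'
    have na : ∀ v, ‖a' v‖ ^ 2 ≤ ‖s v‖ ^ 2 := fun v => by
      have h1 : ‖a' v‖ ≤ ‖s v‖ := by
        change ‖(c : ℂ) • Z (s v)‖ ≤ _
        rw [norm_smul, Complex.norm_real, Real.norm_of_nonneg hc0.le]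
        calc c * ‖Z (s v)‖ ≤ c * (‖Z‖ * ‖s v‖) := by gcongr; exact Z.le_opNorm _
          _ = (c * ‖Z‖) * ‖s v‖ := by ring
          _ ≤ 1 * ‖s v‖ := by gcongr
          _ = _ := one_mul _
      gcongr
    have nb : ∀ v, ‖b' v‖ ^ 2 ≤ ‖d v‖ ^ 2 := fun v => by
      have h1 : ‖b' v‖ ≤ ‖d v‖ := by
        change ‖(c : ℂ) • S (d v)‖ ≤ _
        rw [norm_smul, Complex.norm_real, Real.norm_of_nonneg hc0.le]
        calc c * ‖S (d v)‖ ≤ c * (‖S‖ * ‖d v‖) := by gcongr; exact S.le_opNorm _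
          _ = (c * ‖S‖) * ‖d v‖ := by ring
          _ ≤ 1 * ‖d v‖ := by gcongr
          _ = _ := one_mul _
      gcongr
    have hab' : a' ξ = b' η := by
      change (c : ℂ) • Z (s ξ) = (c : ℂ) • S (d η)
      rw [hZS]
    have ha0 : a' ξ ≠ 0 := by
      change (c : ℂ) • Z (s ξ) ≠ 0
      exact smul_ne_zero (by exact_mod_cast hc0.ne') hZ0
    have hfresh : ∃ n : ℕ, ((a', b'), n) ∉ 𝒮 := by
      by_contra! hall
      have hbd : ∀ N : ℕ, (N : ℝ) * ‖a' ξ‖ ^ 2 ≤ ‖ξ‖ ^ 2 := by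
        intro N
        have h1 := (hgood.2 ((Finset.range N).map
          ⟨fun n => ((a', b'), n), fun m n h => (Prod.ext_iff.1 h).2⟩) ?_ ξ).1
        · rw [Finset.sum_map] at h1
          change ∑ _n ∈ Finset.range N, ‖a' ξ‖ ^ 2 ≤ _ at h1
          simpa using h1
        · intro t ht
          simp only [Finset.coe_map, Set.mem_image] at ht
          obtain ⟨n, -, rfl⟩ := ht
          exact hall n
      have hp : 0 < ‖a' ξ‖ ^ 2 := by
        have := norm_pos_iff.2 ha0
        positivity
      obtain ⟨N, hN⟩ := exists_nat_gt (‖ξ‖ ^ 2 / ‖a' ξ‖ ^ 2)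
      rw [div_lt_iff₀ hp] at hN
      linarith [hbd N]
    obtain ⟨n, hn⟩ := hfresh
    -- partial sums together with the defect
    have sumA : ∀ F : Finset (((H →L[ℂ] H) × (H →L[ℂ] H)) × ℕ), ↑F ⊆ 𝒮 → ∀ v : H,
        ∑ t ∈ F, ‖t.1.1 v‖ ^ 2 + ‖s v‖ ^ 2 ≤ ‖v‖ ^ 2 := by
      intro F hF v
      have h1 : HasSum (fun k => ‖a k v‖ ^ 2) (‖v‖ ^ 2 - ‖s v‖ ^ 2) := by
        have := hsum v v
        simp only [inner_self_real] at this
        exact_mod_cast this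
      have h2 := sum_le_hasSum (F.subtype (· ∈ 𝒮)) (fun k _ => by positivity) h1
      have h3 : ∑ k ∈ F.subtype (· ∈ 𝒮), ‖a k v‖ ^ 2 = ∑ t ∈ F, ‖t.1.1 v‖ ^ 2 :=
        Finset.sum_subtype_of_mem (fun t => ‖t.1.1 v‖ ^ 2) (fun t ht => hF ht)
      linarith
    have sumB : ∀ F : Finset (((H →L[ℂ] H) × (H →L[ℂ] H)) × ℕ), ↑F ⊆ 𝒮 → ∀ v : H,
        ∑ t ∈ F, ‖t.1.2 v‖ ^ 2 + ‖d v‖ ^ 2 ≤ ‖v‖ ^ 2 := by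
      intro F hF v
      have h1 : HasSum (fun k => ‖b k v‖ ^ 2) (‖v‖ ^ 2 - ‖d v‖ ^ 2) := by
        have := hdsum v v
        simp only [inner_self_real] at this
        exact_mod_cast this
      have h2 := sum_le_hasSum (F.subtype (· ∈ 𝒮)) (fun k _ => by positivity) h1
      have h3 : ∑ k ∈ F.subtype (· ∈ 𝒮), ‖b k v‖ ^ 2 = ∑ t ∈ F, ‖t.1.2 v‖ ^ 2 :=
        Finset.sum_subtype_of_mem (fun t => ‖t.1.2 v‖ ^ 2) (fun t ht => hF ht)
      linarith
    have hnew : GoodFam A ξ η (insert ((a', b'), n) 𝒮) := by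
      refine ⟨?_, ?_⟩
      · rintro t (rfl | ht)
        · exact ⟨SMulMemClass.smul_mem _ (mul_mem hZ hs), SMulMemClass.smul_mem _ (mul_mem hS hd),
            hab', ha0⟩
        · exact hgood.1 t ht
      · intro F hF v
        have hE : ↑(F.erase ((a', b'), n)) ⊆ 𝒮 := by
          intro t ht
          simp only [Finset.coe_erase, Set.mem_sdiff, Finset.mem_coe, Set.mem_singleton_iff] at ht
          exact (hF ht.1).resolve_left ht.2
        by_cases hmem : ((a', b'), n) ∈ F
        · rw [← Finset.add_sum_erase F _ hmem, ← Finset.add_sum_erase F _ hmem]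
          have h1 := sumA _ hE v
          have h2 := sumB _ hE v
          have h3 := na v
          have h4 := nb v
          constructor
          · change ‖a' v‖ ^ 2 + _ ≤ _
            linarith
          · change ‖b' v‖ ^ 2 + _ ≤ _
            linarith
        · rw [Finset.erase_eq_of_notMem hmem] at hE
          exact hgood.2 F hE v
    have h5 := hmax.le_of_ge (y := insert ((a', b'), n) 𝒮) hnew (Set.subset_insert _ _)
    exact hn (h5 (Set.mem_insert _ _))
  have hdη : d η = 0 := by
    have := hz' 1 (one_mem _) (one_mem _)
    rw [hsξ, map_zero, inner_zero_left] at this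
    exact inner_self_eq_zero.1 this.symm
  exact ⟨↥𝒮, a, b, s, d, ha, hb, hab, fun k => (hgood.1 k.1 k.2).2.2.2, hs, hsum, hdsum, hsξ, hdη⟩

theorem theorem_A {A : VonNeumannAlgebra H} (ξ η : H)
    (hz : ∀ z ∈ A, z ∈ A.commutant → ⟪ξ, z ξ⟫ = ⟪η, z η⟫) :
    ∃ a : ℕ → H →L[ℂ] H, (∀ k, a k ∈ A) ∧
      (∀ x y, HasSum (fun k => ⟪a k x, a k y⟫) ⟪x, y⟫) ∧
      ∀ X ∈ A, HasSum (fun k => ⟪a k ξ, X (a k ξ)⟫) ⟪η, X η⟫ := by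
  obtain ⟨ι, a, b, s, d, ha, hb, hab, hne, hs, hsum, hdsum, hsξ, hdη⟩ := exhaustion ξ η hz
  have hcount : Countable ι := by
    have h1 : HasSum (fun k => ‖a k ξ‖ ^ 2) (‖ξ‖ ^ 2 - ‖s ξ‖ ^ 2) := by
      have := hsum ξ ξ
      simp only [inner_self_real] at this
      exact_mod_cast this
    have h2 := h1.summable.countable_support
    have h3 : (Function.support fun k => ‖a k ξ‖ ^ 2) = Set.univ := by
      ext k
      simp [hne k]
    rw [h3] at h2
    exact Set.countable_univ_iff.1 h2
  obtain ⟨e, he⟩ := exists_injective_nat ι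
  let c : ℕ → H →L[ℂ] H := Function.extend e a 0
  let g : ℕ → H →L[ℂ] H := fun n => Nat.casesOn n s c
  have cz : ∀ n, n ∉ Set.range e → c n = 0 := fun n hn =>
    Function.extend_apply' _ _ _ (fun ⟨t, ht⟩ => hn ⟨t, ht⟩)
  have ce : ∀ t, c (e t) = a t := fun t => he.extend_apply _ _ _
  refine ⟨g, ?_, ?_, ?_⟩
  · intro n
    cases n with
    | zero => exact hs
    | succ n =>
      change c n ∈ A
      by_cases hn : n ∈ Set.range e
      · obtain ⟨t, rfl⟩ := hn
        rw [ce]; exact ha t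
      · rw [cz n hn]; exact zero_mem A
  · intro x y
    have h1 : HasSum (fun n => ⟪c n x, c n y⟫) (⟪x, y⟫ - ⟪s x, s y⟫) := by
      refine (he.hasSum_iff ?_).1 ?_
      · intro n hn
        simp [cz n hn]
      · convert hsum x y using 2 with t
        simp only [Function.comp_apply, ce]
    have h2 := (hasSum_nat_add_iff (f := fun n => ⟪g n x, g n y⟫) 1).1 h1
    simp only [Finset.range_one, Finset.sum_singleton] at h2
    change HasSum _ (_ - _ + ⟪s x, s y⟫) at h2
    rwa [sub_add_cancel] at h2
  · intro X hX
    have h1 : HasSum (fun n => ⟪c n ξ, X (c n ξ)⟫) ⟪η, X η⟫ := by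
      refine (he.hasSum_iff ?_).1 ?_
      · intro n hn
        simp [cz n hn]
      · have h3 := hdsum η (X η)
        rw [hdη, inner_zero_left, sub_zero] at h3
        convert h3 using 2 with t
        simp only [Function.comp_apply, ce]
        rw [hab, commutes_apply hX (hb t)]
    have h2 := (hasSum_nat_add_iff (f := fun n => ⟪g n ξ, X (g n ξ)⟫) 1).1 h1
    simp only [Finset.range_one, Finset.sum_singleton] at h2
    change HasSum _ (_ + ⟪s ξ, X (s ξ)⟫) at h2
    rwa [hsξ, inner_zero_left, add_zero] at h2


open Filter Topology

section perm
variable {ι : Type*}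

/-- Permutation of coordinates. -/
def permOp (σ : Equiv.Perm ι) : Amp ι H →L[ℂ] Amp ι H :=
  colOp (fun i => pr (σ i)) 1 zero_le_one (fun F v => by
    rw [one_mul, ← (amp_hasSum_sq v).tsum_eq]
    calc ∑ i ∈ F, ‖pr (σ i) v‖ ^ 2 = ∑ j ∈ F.map σ.toEmbedding, ‖v j‖ ^ 2 := by
          rw [Finset.sum_map]; rfl
      _ ≤ _ := (amp_hasSum_sq v).summable.sum_le_tsum _ fun i _ => by positivity)

@[simp] theorem permOp_apply (σ : Equiv.Perm ι) (v : Amp ι H) (i : ι) :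
    permOp σ v i = v (σ i) := rfl

theorem inner_permOp (σ : Equiv.Perm ι) (hσ : ∀ i, σ (σ i) = i) (v w : Amp ι H) :
    ⟪permOp σ v, w⟫ = ⟪v, permOp σ w⟫ := by
  refine (amp_inner _ _).unique ?_
  have := (σ.hasSum_iff).2 (amp_inner v (permOp σ w))
  refine this.congr_fun ?_ |> fun h => h
  intro i
  simp [hσ]

end perm

theorem hermitian_of_pos (ω : ↥M →L[ℂ] ℂ) (h : IsPositiveFunctional ω) (a : ↥M) :
    conj (ω (star a)) = ω a := by
  have e1 : (ω (star a * a)).im = 0 := (Complex.nonneg_iff.1 (h a)).2.symm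
  have e0 : (ω 1).im = 0 := by
    have := (Complex.nonneg_iff.1 (h 1)).2.symm
    simpa using this
  have e2 : (ω (star (1 + a) * (1 + a))).im = 0 := (Complex.nonneg_iff.1 (h _)).2.symm
  have e3 : (ω (star (1 + Complex.I • a) * (1 + Complex.I • a))).im = 0 :=
    (Complex.nonneg_iff.1 (h _)).2.symm
  have k2 : star (1 + a) * (1 + a) = 1 + a + star a + star a * a := by
    rw [star_add, star_one, add_mul, mul_add, mul_add]; simp; abel
  have k3 : star (1 + Complex.I • a) * (1 + Complex.I • a)
      = 1 + Complex.I • a - Complex.I • star a + star a * a := by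
    have hs : star (Complex.I • a) = -(Complex.I • star a) := by
      apply Subtype.ext
      change star (Complex.I • (a : H →L[ℂ] H)) = -(Complex.I • star (a : H →L[ℂ] H))
      rw [star_smul]
      simp
    rw [star_add, star_one, hs, add_mul, mul_add, mul_add, neg_mul, neg_mul,
      smul_mul_smul_comm, Complex.I_mul_I]
    simp; abel
  rw [k2] at e2
  rw [k3] at e3
  simp only [map_add, map_sub, map_smul, Complex.add_im, Complex.sub_im, smul_eq_mul,
    Complex.mul_im, Complex.I_re, Complex.I_im, e0, e1] at e2 e3
  apply Complex.ext
  · simp only [Complex.conj_re]; linarith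
  · simp only [Complex.conj_im]; linarith

/-- The index set of the amplification. -/
abbrev Ix := Bool × ℕ

/-- Swap of the boolean coordinate. -/
def swp : Equiv.Perm Ix where
  toFun p := (!p.1, p.2)
  invFun p := (!p.1, p.2)
  left_inv p := by simp
  right_inv p := by simp

theorem exists_sqrt {D : H →L[ℂ] H} (hpos : 0 ≤ D) : ∃ S : H →L[ℂ] H, star S = S ∧
    (∀ v, S (S v) = D v) ∧ ∀ T, Commute D T → Commute S T := by
  refine ⟨CFC.sqrt D, (CFC.sqrt_nonneg D).isSelfAdjoint, fun v => ?_, fun T hT => ?_⟩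
  · exact congrArg (fun f : H →L[ℂ] H => f v) (CFC.sqrt_mul_sqrt_self D hpos)
  · rw [CFC.sqrt_eq_cfc]; exact hT.cfc_nnreal _

theorem vector_form (ω : ↥M →L[ℂ] ℂ) (hp : IsPositiveFunctional ω) (hn : IsNormalFunctional ω) :
    ∃ ξ : Amp Ix H, ∀ a : ↥M, ω a = ⟪ξ, diag Ix (a : H →L[ℂ] H) ξ⟫ := by
  obtain ⟨x, y, hx, hy, hxy⟩ := hn
  have hsum : Summable fun p : Ix => ‖(bif p.1 then y p.2 else x p.2)‖ ^ 2 := by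
    rw [summable_prod_of_nonneg (fun p => by positivity)]
    constructor
    · rintro (_ | _)
      · exact hx
      · exact hy
    · exact (hasSum_fintype _).summable
  set w : Amp Ix H := toAmp (fun p : Ix => bif p.1 then y p.2 else x p.2) hsum with hw
  set J : Amp Ix H →L[ℂ] Amp Ix H := permOp swp with hJ
  have hJs : ∀ v u, ⟪J v, u⟫ = ⟪v, J u⟫ := inner_permOp swp (fun i => by simp [swp])
  have hB : ∀ a : ↥M, ⟪w, J (diag Ix (a : H →L[ℂ] H) w)⟫ = 2 * ω a := by
    intro a
    have h1 := amp_inner w (J (diag Ix (a : H →L[ℂ] H) w))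
    have h2 := h1.prod_fiberwise (g := fun b => bif b then conj (ω (star a)) else ω a) (by
      rintro (_ | _)
      · exact hxy a
      · have := (hxy (star a)).map (starRingEnd ℂ) Complex.continuous_conj
        refine this.congr_fun fun n => ?_
        simp only [Function.comp]
        rw [inner_conj_symm]
        change ⟪y n, (a : H →L[ℂ] H) (x n)⟫ = ⟪star (a : H →L[ℂ] H) (y n), x n⟫
        rw [inner_star_left])
    have h3 := h2.unique (hasSum_fintype _)
    rw [h3, Fintype.sum_bool, cond_true, cond_false, hermitian_of_pos ω hp]
    ring
  set P := clProj (cycD M w) with hP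
  have hPw : P w = w := clProj_of_mem (self_mem_cycD M w)
  have hPd : ∀ X ∈ M, ∀ v, diag Ix X (P v) = P (diag Ix X v) := fun X hX v => cycD_comm M w hX v
  have hPi : ∀ v u, ⟪P v, u⟫ = ⟪v, P u⟫ := fun v u => clProj_inner v u
  have hJd : ∀ X : H →L[ℂ] H, ∀ v, diag Ix X (J v) = J (diag Ix X v) := fun X v => rfl
  set D : Amp Ix H →L[ℂ] Amp Ix H := ((1 / 2 : ℝ) : ℂ) • (P ∘L J ∘L P) with hD
  have hDi : ∀ v u, ⟪v, D u⟫ = ((1 / 2 : ℝ) : ℂ) * ⟪P v, J (P u)⟫ := by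
    intro v u
    rw [hD, smul_apply, inner_smul_right, hPi]; rfl
  have hcone : ∀ v ∈ (cycD M w).topologicalClosure, 0 ≤ (⟪v, J v⟫).re := by
    intro v hv
    have hc : IsClosed {v : Amp Ix H | 0 ≤ (⟪v, J v⟫).re} := by
      apply isClosed_le continuous_const
      apply Complex.continuous_re.comp
      exact continuous_id.inner J.continuous
    refine closure_minimal ?_ hc hv
    rintro _ ⟨X, hX, rfl⟩
    change 0 ≤ (⟪diag Ix X w, J (diag Ix X w)⟫).re
    have e : ⟪diag Ix X w, J (diag Ix X w)⟫ = 2 * ω (star ⟨X, hX⟩ * ⟨X, hX⟩) := by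
      rw [← hB]
      change _ = ⟪w, J (diag Ix (star X * X) w)⟫
      rw [diag_mul]
      change _ = ⟪w, diag Ix (star X) (J (diag Ix X w))⟫
      rw [← inner_diag_star, star_star]
    rw [e]
    have := (Complex.nonneg_iff.1 (hp ⟨X, hX⟩)).1
    simp only [Complex.mul_re, Complex.re_ofNat, Complex.im_ofNat, zero_mul, sub_zero]
    linarith
  have hpos : (0 : Amp Ix H →L[ℂ] Amp Ix H) ≤ D := by
    rw [ContinuousLinearMap.nonneg_iff_isPositive, ContinuousLinearMap.isPositive_iff_complex]
    intro v
    have him : conj ⟪P v, J (P v)⟫ = ⟪P v, J (P v)⟫ := by rw [inner_conj_symm, hJs]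
    have hre := Complex.conj_eq_iff_re.1 him
    have hge := hcone (P v) (Submodule.starProjection_apply_mem _ _)
    have e : ⟪D v, v⟫ = ((1 / 2 * (⟪P v, J (P v)⟫).re : ℝ) : ℂ) := by
      rw [← inner_conj_symm, hDi, map_mul, him, Complex.conj_ofReal, Complex.ofReal_mul, hre]
    rw [e]
    constructor
    · simp only [RCLike.re_to_complex, Complex.ofReal_re]
    · simp only [RCLike.re_to_complex, Complex.ofReal_re]
      linarith
  obtain ⟨S, hss, hs, hSc⟩ := exists_sqrt hpos
  refine ⟨S w, fun a => ?_⟩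
  have hc1 : Commute D (diag Ix (a : H →L[ℂ] H)) := by
    ext1 v
    change D (diag Ix (a : H →L[ℂ] H) v) = diag Ix (a : H →L[ℂ] H) (D v)
    rw [hD, smul_apply, smul_apply, map_smul]
    change _ • P (J (P _)) = _ • diag Ix (a : H →L[ℂ] H) (P (J (P v)))
    rw [hPd _ a.2, hJd, hPd _ a.2]
  have hc3 : diag Ix (a : H →L[ℂ] H) (S w) = S (diag Ix (a : H →L[ℂ] H) w) :=
    congrArg (fun f : Amp Ix H →L[ℂ] Amp Ix H => f w) (hSc _ hc1).eq.symm
  have e : ⟪S w, S (diag Ix (a : H →L[ℂ] H) w)⟫ = ⟪w, D (diag Ix (a : H →L[ℂ] H) w)⟫ := by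
    have h1 := inner_star_left S w (S (diag Ix (a : H →L[ℂ] H) w))
    rw [hss, hs] at h1
    exact h1
  rw [hc3, e, hDi, hPw, ← hPd _ a.2, hPw, hB]
  push_cast
  ring


open Filter Topology

/-- The commutant of the amplification. -/
def ampComm (ι : Type*) (M : VonNeumannAlgebra H) : Set (Amp ι H →L[ℂ] Amp ι H) :=
  {T | ∀ X ∈ M, diag ι X * T = T * diag ι X}

theorem ampComm_star {ι : Type*} {T : Amp ι H →L[ℂ] Amp ι H} (h : T ∈ ampComm ι M) :
    star T ∈ ampComm ι M := by
  intro X hX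
  have := congrArg star (h (star X) (star_mem hX))
  rw [star_mul, star_mul, star_diag, star_star] at this
  exact this.symm

/-- The amplification of a von Neumann algebra. -/
def ampAlg (ι : Type*) (M : VonNeumannAlgebra H) : VonNeumannAlgebra (Amp ι H) where
  toStarSubalgebra := StarSubalgebra.centralizer ℂ (ampComm ι M)
  centralizer_centralizer' := by simp

theorem mem_ampAlg {ι : Type*} {T : Amp ι H →L[ℂ] Amp ι H} :
    T ∈ ampAlg ι M ↔ ∀ S ∈ ampComm ι M, S * T = T * S := by
  change T ∈ StarSubalgebra.centralizer ℂ (ampComm ι M) ↔ _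
  rw [StarSubalgebra.mem_centralizer_iff]
  constructor
  · intro h S hS
    exact (h S hS).1
  · intro h S hS
    exact ⟨h S hS, h _ (ampComm_star hS)⟩

theorem diag_mem_ampAlg {ι : Type*} {X : H →L[ℂ] H} (hX : X ∈ M) : diag ι X ∈ ampAlg ι M :=
  mem_ampAlg.2 fun _ hS => (hS X hX).symm

theorem ampAlg_eq_diag {ι : Type*} (i0 : ι) {T : Amp ι H →L[ℂ] Amp ι H} (hT : T ∈ ampAlg ι M) :
    ∃ t ∈ M, T = diag ι t := by
  rw [mem_ampAlg] at hT
  have key : ∀ w, T w = diag ι (pr i0 ∘L T ∘L sg i0) w := by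
    intro w
    apply amp_ext
    intro j
    have hE : (sg i0 ∘L pr j : Amp ι H →L[ℂ] Amp ι H) ∈ ampComm ι M := by
      intro X _
      ext1 v
      change diag ι X (sg i0 (v j)) = sg i0 (X (v j))
      rw [diag_sg]
    have h1 : sg i0 (T w j) = T (sg i0 (w j)) :=
      congrArg (fun f : Amp ι H →L[ℂ] Amp ι H => f w) (hT _ hE)
    have h2 := congrArg (fun u : Amp ι H => u i0) h1
    simp only [sg_self] at h2
    exact h2
  refine ⟨pr i0 ∘L T ∘L sg i0, ?_, ContinuousLinearMap.ext key⟩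
  apply mem_of_commutes
  intro S hS
  have hd : diag ι S ∈ ampComm ι M := by
    intro X hX
    rw [← diag_mul, ← diag_mul, commutes_of_mem hX hS]
  ext v
  have h1 : diag ι S (T (sg i0 v)) = T (diag ι S (sg i0 v)) :=
    congrArg (fun f : Amp ι H →L[ℂ] Amp ι H => f (sg i0 v)) (hT _ hd)
  rw [diag_sg] at h1
  exact congrArg (fun u : Amp ι H => u i0) h1

theorem diag_inj {ι : Type*} (i0 : ι) {X Y : H →L[ℂ] H} (h : diag ι X = diag ι Y) : X = Y := by
  ext v
  have h1 := congrArg (fun f : Amp ι H →L[ℂ] Amp ι H => f (sg i0 v) i0) h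
  simpa using h1

theorem theorem_B (ω ρ : ↥M →L[ℂ] ℂ) (hωp : IsPositiveFunctional ω) (hρp : IsPositiveFunctional ρ)
    (hωn : IsNormalFunctional ω) (hρn : IsNormalFunctional ρ)
    (hz : ∀ z ∈ Set.center ↥M, ρ z = ω z) :
    ∃ b : ℕ → ↥M, (∀ x y : H, HasSum (fun k => ⟪(b k : H →L[ℂ] H) x, (b k : H →L[ℂ] H) y⟫) ⟪x, y⟫) ∧
      ∀ X : ↥M, HasSum (fun k => ω (star (b k) * X * b k)) (ρ X) := by
  obtain ⟨ξ, hξ⟩ := vector_form ω hωp hωn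
  obtain ⟨η, hη⟩ := vector_form ρ hρp hρn
  let i0 : Ix := (true, 0)
  obtain ⟨a, ha, h1, h2⟩ := theorem_A (A := ampAlg Ix M) ξ η (by
    intro z hz1 hz2
    obtain ⟨t, ht, rfl⟩ := ampAlg_eq_diag i0 hz1
    have hc : (⟨t, ht⟩ : ↥M) ∈ Set.center ↥M := by
      rw [Semigroup.mem_center_iff]
      intro g
      apply Subtype.ext
      change (g : H →L[ℂ] H) * t = t * g
      apply diag_inj i0
      rw [diag_mul, diag_mul]
      exact VonNeumannAlgebra.mem_commutant_iff.1 hz2 _ (diag_mem_ampAlg g.2)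
    have := hz _ hc
    rw [hξ, hη] at this
    exact this.symm)
  choose b hb hab using fun k => ampAlg_eq_diag i0 (ha k)
  refine ⟨fun k => ⟨b k, hb k⟩, fun x y => ?_, fun X => ?_⟩
  · have := h1 (sg i0 x) (sg i0 y)
    simpa only [hab, diag_sg, inner_sg_left, sg_self] using this
  · have := h2 _ (diag_mem_ampAlg X.2)
    rw [hη]
    refine this.congr_fun fun k => ?_
    rw [hξ, hab]
    change ⟪ξ, diag Ix (star (b k) * (X : H →L[ℂ] H) * b k) ξ⟫ = _
    rw [diag_mul, diag_mul]
    change ⟪ξ, diag Ix (star (b k)) (diag Ix X (diag Ix (b k) ξ))⟫ = _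
    rw [← inner_diag_star, star_star]


open Filter Topology

theorem diag_norm_le {ι : Type*} (X : H →L[ℂ] H) : ‖diag ι X‖ ≤ ‖X‖ := by
  unfold diag colOp
  exact LinearMap.mkContinuous_norm_le _ (norm_nonneg _) _

/-- The isometry condition. -/
def IsoFam (b : ℕ → ↥M) : Prop :=
  ∀ x y : H, HasSum (fun k => ⟪(b k : H →L[ℂ] H) x, (b k : H →L[ℂ] H) y⟫) ⟪x, y⟫

theorem IsoFam.norm_sq {b : ℕ → ↥M} (hb : IsoFam b) (x : H) :
    HasSum (fun k => ‖(b k : H →L[ℂ] H) x‖ ^ 2) (‖x‖ ^ 2) := by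
  have := hb x x
  simp only [inner_self_real] at this
  exact Complex.hasSum_ofReal.1 this

theorem IsoFam.bound {b : ℕ → ↥M} (hb : IsoFam b) (F : Finset ℕ) (x : H) :
    ∑ k ∈ F, ‖(b k : H →L[ℂ] H) x‖ ^ 2 ≤ ‖x‖ ^ 2 :=
  sum_le_hasSum F (fun k _ => by positivity) (hb.norm_sq x)

theorem exists_psi {b : ℕ → ↥M} (hb : IsoFam b) :
    ∃ ψ : ↥M →L[ℂ] ↥M, IsCompletelyPositiveMap ψ ∧ ψ 1 = 1 ∧
      ∀ (X : ↥M) (x y : H), HasSum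
        (fun k => ⟪(b k : H →L[ℂ] H) x, (X : H →L[ℂ] H) ((b k : H →L[ℂ] H) y)⟫)
        ⟪x, (ψ X : H →L[ℂ] H) y⟫ := by
  let V : H →L[ℂ] Amp ℕ H := colOp (fun k => (b k : H →L[ℂ] H)) 1 zero_le_one
    (fun F v => by rw [one_mul]; exact hb.bound F v)
  let T : (H →L[ℂ] H) → (H →L[ℂ] H) := fun X => ContinuousLinearMap.adjoint V ∘L diag ℕ X ∘L V
  have hT : ∀ X x y, ⟪x, T X y⟫ = ⟪V x, diag ℕ X (V y)⟫ :=
    fun X x y => ContinuousLinearMap.adjoint_inner_right V x _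
  have hTs : ∀ (X : H →L[ℂ] H) (x y : H), HasSum
        (fun k => ⟪(b k : H →L[ℂ] H) x, X ((b k : H →L[ℂ] H) y)⟫) ⟪x, T X y⟫ := fun X x y => by
    rw [hT]; exact amp_inner (V x) (diag ℕ X (V y))
  have hTM : ∀ X ∈ M, T X ∈ M := by
    intro X hX
    apply mem_of_commutes
    intro S hS
    ext v
    apply ext_inner_left ℂ
    intro w
    change ⟪w, S (T X v)⟫ = ⟪w, T X (S v)⟫
    rw [← inner_star_left]
    refine (hTs _ _ _).unique ?_
    refine (hTs X w (S v)).congr_fun fun k => ?_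
    rw [commutes_apply (b k).2 hS, commutes_apply hX hS, commutes_apply (b k).2 (star_mem hS),
      inner_star_left]
  let ψ : ↥M →L[ℂ] ↥M := LinearMap.mkContinuous
    { toFun := fun X => ⟨T X, hTM X X.2⟩
      map_add' := fun X Y => by
        apply Subtype.ext
        change T ((X : H →L[ℂ] H) + Y) = T X + T Y
        ext v
        simp only [T, diag_add]
        simp
      map_smul' := fun c X => by
        apply Subtype.ext
        change T (c • (X : H →L[ℂ] H)) = c • T X
        ext v
        simp only [T, diag_smul]
        simp }
    (‖ContinuousLinearMap.adjoint V‖ * ‖V‖) (fun X => by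
      change ‖T X‖ ≤ _ * ‖(X : H →L[ℂ] H)‖
      calc ‖T X‖ ≤ ‖ContinuousLinearMap.adjoint V‖ * (‖diag ℕ (X : H →L[ℂ] H)‖ * ‖V‖) :=
            (ContinuousLinearMap.opNorm_comp_le _ _).trans
              (mul_le_mul_of_nonneg_left (ContinuousLinearMap.opNorm_comp_le _ _) (norm_nonneg _))
        _ ≤ ‖ContinuousLinearMap.adjoint V‖ * (‖(X : H →L[ℂ] H)‖ * ‖V‖) := by
            gcongr
            exact diag_norm_le _
        _ = _ := by ring)
  refine ⟨ψ, ?_, ?_, fun X x y => hTs X x y⟩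
  · intro n a v
    have e : ∑ i, ∑ j, ⟪v i, ((ψ (star (a i) * a j) : ↥M) : H →L[ℂ] H) (v j)⟫
        = ⟪∑ i, diag ℕ (a i : H →L[ℂ] H) (V (v i)), ∑ i, diag ℕ (a i : H →L[ℂ] H) (V (v i))⟫ := by
      rw [sum_inner]
      refine Finset.sum_congr rfl fun i _ => ?_
      rw [inner_sum]
      refine Finset.sum_congr rfl fun j _ => ?_
      change ⟪v i, T (star (a i : H →L[ℂ] H) * (a j : H →L[ℂ] H)) (v j)⟫ = _
      rw [hT, diag_mul]
      change ⟪_, diag ℕ (star (a i : H →L[ℂ] H)) (diag ℕ (a j : H →L[ℂ] H) (V (v j)))⟫ = _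
      rw [← inner_diag_star, star_star]
    rw [e, inner_self_real]
    exact Complex.zero_le_real.2 (by positivity)
  · apply Subtype.ext
    change T 1 = 1
    ext v
    apply ext_inner_left ℂ
    intro w
    exact (hTs 1 w v).unique (hb w v)

/-- Double sums. -/
theorem double_sum {b : ℕ → ↥M} (hb : IsoFam b) (ψ : ↥M →L[ℂ] ↥M)
    (hψ : ∀ (X : ↥M) (x y : H), HasSum
        (fun k => ⟪(b k : H →L[ℂ] H) x, (X : H →L[ℂ] H) ((b k : H →L[ℂ] H) y)⟫)
        ⟪x, (ψ X : H →L[ℂ] H) y⟫) (ω : ↥M →L[ℂ] ℂ) (x y : ℕ → H)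
    (hx : Summable (fun n => ‖x n‖ ^ 2)) (hy : Summable (fun n => ‖y n‖ ^ 2))
    (hω : ∀ a : ↥M, HasSum (fun n => ⟪x n, (a : H →L[ℂ] H) (y n)⟫) (ω a)) :
    Summable (fun p : ℕ × ℕ => ‖(b p.2 : H →L[ℂ] H) (x p.1)‖ ^ 2) ∧
    Summable (fun p : ℕ × ℕ => ‖(b p.2 : H →L[ℂ] H) (y p.1)‖ ^ 2) ∧
    ∀ a : ↥M, HasSum (fun p : ℕ × ℕ => ⟪(b p.2 : H →L[ℂ] H) (x p.1),
      (a : H →L[ℂ] H) ((b p.2 : H →L[ℂ] H) (y p.1))⟫) (ω (ψ a)) := by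
  have hs : ∀ x : ℕ → H, Summable (fun n => ‖x n‖ ^ 2) →
      Summable (fun p : ℕ × ℕ => ‖(b p.2 : H →L[ℂ] H) (x p.1)‖ ^ 2) := by
    intro x hx
    rw [summable_prod_of_nonneg (fun p => by positivity)]
    refine ⟨fun n => (hb.norm_sq (x n)).summable, ?_⟩
    simpa only [(hb.norm_sq _).tsum_eq] using hx
  refine ⟨hs x hx, hs y hy, fun a => ?_⟩
  have h1 := amp_inner (toAmp _ (hs x hx)) (diag (ℕ × ℕ) (a : H →L[ℂ] H) (toAmp _ (hs y hy)))
  have h2 := h1.prod_fiberwise (fun n => hψ a (x n) (y n))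
  rw [(hω (ψ a)).unique h2]
  exact h1

theorem psi_normal {b : ℕ → ↥M} (hb : IsoFam b) (ψ : ↥M →L[ℂ] ↥M)
    (hψ : ∀ (X : ↥M) (x y : H), HasSum
        (fun k => ⟪(b k : H →L[ℂ] H) x, (X : H →L[ℂ] H) ((b k : H →L[ℂ] H) y)⟫)
        ⟪x, (ψ X : H →L[ℂ] H) y⟫) : IsNormalMap ψ := by
  intro ω hωn
  obtain ⟨x, y, hx, hy, hω⟩ := hωn
  obtain ⟨h1, h2, h3⟩ := double_sum hb ψ hψ ω x y hx hy hω
  obtain ⟨e⟩ : Nonempty (ℕ ≃ ℕ × ℕ) := ⟨Nat.pairEquiv.symm⟩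
  refine ⟨fun m => (b (e m).2 : H →L[ℂ] H) (x (e m).1),
    fun m => (b (e m).2 : H →L[ℂ] H) (y (e m).1), ?_, ?_, ?_⟩
  · exact h1.comp_injective e.injective
  · exact h2.comp_injective e.injective
  · intro a
    have h4 := e.hasSum_iff.2 (h3 a)
    exact h4

theorem psi_comp {b : ℕ → ↥M} (hb : IsoFam b) (ψ : ↥M →L[ℂ] ↥M)
    (hψ : ∀ (X : ↥M) (x y : H), HasSum
        (fun k => ⟪(b k : H →L[ℂ] H) x, (X : H →L[ℂ] H) ((b k : H →L[ℂ] H) y)⟫)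
        ⟪x, (ψ X : H →L[ℂ] H) y⟫) (ω : ↥M →L[ℂ] ℂ) (hωn : IsNormalFunctional ω) (X : ↥M) :
    HasSum (fun k => ω (star (b k) * X * b k)) (ω (ψ X)) := by
  obtain ⟨x, y, hx, hy, hω⟩ := hωn
  obtain ⟨h1, h2, h3⟩ := double_sum hb ψ hψ ω x y hx hy hω
  have h4 := (Equiv.prodComm ℕ ℕ).hasSum_iff.2 (h3 X)
  refine h4.prod_fiberwise fun k => ?_
  refine (hω (star (b k) * X * b k)).congr_fun fun n => ?_
  change ⟪(b k : H →L[ℂ] H) (x n), (X : H →L[ℂ] H) ((b k : H →L[ℂ] H) (y n))⟫ =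
    ⟪x n, star (b k : H →L[ℂ] H) ((X : H →L[ℂ] H) ((b k : H →L[ℂ] H) (y n)))⟫
  rw [inner_star_right]


open Filter Topology

theorem elem_approx {b : ℕ → ↥M} (hb : IsoFam b) (n : ℕ) :
    ∃ (φ : ↥M →L[ℂ] ↥M) (s : H →L[ℂ] H), IsElementaryUCP φ ∧
      (∀ (X : ↥M) (x y : H), ⟪x, (φ X : H →L[ℂ] H) y⟫ = (∑ k ∈ Finset.range n,
        ⟪(b k : H →L[ℂ] H) x, (X : H →L[ℂ] H) ((b k : H →L[ℂ] H) y)⟫)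
          + ⟪s x, (X : H →L[ℂ] H) (s y)⟫) ∧
      ∀ x, ‖s x‖ ^ 2 = ‖x‖ ^ 2 - ∑ k ∈ Finset.range n, ‖(b k : H →L[ℂ] H) x‖ ^ 2 := by
  obtain ⟨s, hsM, hss, hs⟩ := defect_sqrt (A := M) (fun k : Fin n => (b k : H →L[ℂ] H))
    (fun k => (b k).2) (fun F v => by
      have := hb.bound (F.map Fin.valEmbedding) v
      rwa [Finset.sum_map] at this)
  have hs' : ∀ x y, ⟪s x, s y⟫ = ⟪x, y⟫ - ∑ k : Fin n,
      ⟪(b k : H →L[ℂ] H) x, (b k : H →L[ℂ] H) y⟫ := by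
    intro x y
    rw [(hasSum_fintype _).unique (hs x y)]; ring
  let a : Fin (n + 1) → ↥M := Fin.snoc (α := fun _ => ↥M) (fun k : Fin n => b k) ⟨s, hsM⟩
  have ha1 : ∀ k : Fin n, a k.castSucc = b k := fun k => by simp [a]
  have ha2 : a (Fin.last n) = ⟨s, hsM⟩ := by simp [a]
  let φ : ↥M →L[ℂ] ↥M := ∑ i, ContinuousLinearMap.mulLeftRight ℂ ↥M (star (a i)) (a i)
  have hφ : ∀ X, φ X = ∑ i, star (a i) * X * a i := by
    intro X
    simp [φ]
  have hφi : ∀ (X : ↥M) (x y : H), ⟪x, ((∑ i, star (a i) * X * a i : ↥M) : H →L[ℂ] H) y⟫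
      = (∑ k : Fin n, ⟪(b k : H →L[ℂ] H) x, (X : H →L[ℂ] H) ((b k : H →L[ℂ] H) y)⟫)
          + ⟪s x, (X : H →L[ℂ] H) (s y)⟫ := by
    intro X x y
    have hterm : ∀ c : ↥M, ⟪x, ((star c * X * c : ↥M) : H →L[ℂ] H) y⟫ =
        ⟪(c : H →L[ℂ] H) x, (X : H →L[ℂ] H) ((c : H →L[ℂ] H) y)⟫ := by
      intro c
      change ⟪x, star (c : H →L[ℂ] H) ((X : H →L[ℂ] H) ((c : H →L[ℂ] H) y))⟫ = _
      rw [inner_star_right]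
    have hsum : ((∑ i, star (a i) * X * a i : ↥M) : H →L[ℂ] H) y
        = ∑ i, ((star (a i) * X * a i : ↥M) : H →L[ℂ] H) y := by
      rw [AddSubmonoidClass.coe_finsetSum, sum_apply]
    rw [hsum, inner_sum, Fin.sum_univ_castSucc]
    simp only [hterm, ha1, ha2]
  refine ⟨φ, s, ⟨n + 1, a, ?_, hφ⟩, fun X x y => ?_, fun x => ?_⟩
  · apply Subtype.ext
    ext y
    apply ext_inner_left ℂ
    intro x
    have := hφi 1 x y
    simp only [mul_one] at this
    rw [this]
    change _ + ⟪s x, s y⟫ = ⟪x, y⟫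
    rw [hs']
    change (∑ k : Fin n, ⟪(b k : H →L[ℂ] H) x, (b k : H →L[ℂ] H) y⟫) + _ = _
    ring
  · rw [hφ, hφi, Finset.sum_range]
  · have := hs' x x
    simp only [inner_self_real] at this
    rw [Finset.sum_range]
    exact_mod_cast this

theorem psi_closure {b : ℕ → ↥M} (hb : IsoFam b) (ψ : ↥M →L[ℂ] ↥M)
    (hψ : ∀ (X : ↥M) (x y : H), HasSum
        (fun k => ⟪(b k : H →L[ℂ] H) x, (X : H →L[ℂ] H) ((b k : H →L[ℂ] H) y)⟫)
        ⟪x, (ψ X : H →L[ℂ] H) y⟫) :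
    InPointWeakStarClosure {φ : ↥M →L[ℂ] ↥M | IsElementaryUCP φ} ψ := by
  choose φ s hφ1 hφ2 hs using elem_approx hb
  have hcs : ∀ (X : H →L[ℂ] H) (u v : H), ‖⟪u, X v⟫‖ ≤ ‖X‖ * (‖u‖ * ‖v‖) := by
    intro X u v
    calc ‖⟪u, X v⟫‖ ≤ ‖u‖ * ‖X v‖ := norm_inner_le_norm _ _
      _ ≤ ‖u‖ * (‖X‖ * ‖v‖) := by gcongr; exact X.le_opNorm _
      _ = _ := by ring
  have hcs2 : ∀ (X : H →L[ℂ] H) (u v : H), ‖⟪u, X v⟫‖ ≤ ‖X‖ / 2 * (‖u‖ ^ 2 + ‖v‖ ^ 2) := by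
    intro X u v
    refine (hcs X u v).trans ?_
    have : ‖u‖ * ‖v‖ ≤ (‖u‖ ^ 2 + ‖v‖ ^ 2) / 2 := by nlinarith [sq_nonneg (‖u‖ - ‖v‖)]
    calc ‖X‖ * (‖u‖ * ‖v‖) ≤ ‖X‖ * ((‖u‖ ^ 2 + ‖v‖ ^ 2) / 2) := by gcongr
      _ = _ := by ring
  have hbd : ∀ (n : ℕ) (X : ↥M) (x y : H), ‖⟪x, (φ n X : H →L[ℂ] H) y⟫‖ ≤
      ‖(X : H →L[ℂ] H)‖ / 2 * (‖x‖ ^ 2 + ‖y‖ ^ 2) := by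
    intro n X x y
    rw [hφ2]
    refine (norm_add_le _ _).trans ?_
    have h1 : ‖∑ k ∈ Finset.range n,
        ⟪(b k : H →L[ℂ] H) x, (X : H →L[ℂ] H) ((b k : H →L[ℂ] H) y)⟫‖ ≤
        ‖(X : H →L[ℂ] H)‖ / 2 * (∑ k ∈ Finset.range n, ‖(b k : H →L[ℂ] H) x‖ ^ 2
          + ∑ k ∈ Finset.range n, ‖(b k : H →L[ℂ] H) y‖ ^ 2) := by
      refine (norm_sum_le _ _).trans ?_
      rw [← Finset.sum_add_distrib, Finset.mul_sum]
      exact Finset.sum_le_sum fun k _ => hcs2 _ _ _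
    refine (add_le_add h1 (hcs2 _ _ _)).trans (le_of_eq ?_)
    rw [hs, hs]
    ring
  have hs0 : ∀ x, Tendsto (fun n => ‖s n x‖) atTop (𝓝 0) := by
    intro x
    have h1 : Tendsto (fun n => ‖s n x‖ ^ 2) atTop (𝓝 0) := by
      simp only [hs]
      have := (hb.norm_sq x).tendsto_sum_nat.const_sub (‖x‖ ^ 2)
      simpa using this
    have h2 := h1.sqrt
    simpa [Real.sqrt_sq] using h2
  have hlim : ∀ (X : ↥M) (x y : H), Tendsto (fun n => ⟪x, (φ n X : H →L[ℂ] H) y⟫) atTop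
      (𝓝 ⟪x, (ψ X : H →L[ℂ] H) y⟫) := by
    intro X x y
    simp only [hφ2]
    have h1 := (hψ X x y).tendsto_sum_nat
    have h2 : Tendsto (fun n => ⟪s n x, (X : H →L[ℂ] H) (s n y)⟫) atTop (𝓝 0) := by
      refine squeeze_zero_norm (fun n => hcs _ _ _) ?_
      have := ((hs0 x).mul (hs0 y)).const_mul ‖(X : H →L[ℂ] H)‖
      simpa using this
    simpa using h1.add h2
  have hg : ∀ (g : ↥M →L[ℂ] ℂ), IsNormalFunctional g → ∀ X : ↥M,
      Tendsto (fun n => g (φ n X)) atTop (𝓝 (g (ψ X))) := by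
    rintro g ⟨x, y, hx, hy, hxy⟩ X
    have h1 := tendsto_tsum_of_dominated_convergence (𝓕 := atTop)
      (f := fun n m => ⟪x m, (φ n X : H →L[ℂ] H) (y m)⟫)
      (g := fun m => ⟪x m, (ψ X : H →L[ℂ] H) (y m)⟫)
      (bound := fun m => ‖(X : H →L[ℂ] H)‖ / 2 * (‖x m‖ ^ 2 + ‖y m‖ ^ 2))
      ((hx.add hy).mul_left _) (fun m => hlim X _ _)
      (Eventually.of_forall fun n m => hbd n X _ _)
    simpa only [(hxy _).tsum_eq] using h1
  intro ε hε N x g hgn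
  have hev : ∀ᶠ n in atTop, ∀ i j, ‖g i (ψ (x j)) - g i (φ n (x j))‖ < ε := by
    rw [eventually_all]
    intro i
    rw [eventually_all]
    intro j
    have := (Metric.tendsto_nhds.1 (hg (g i) (hgn i) (x j))) ε hε
    filter_upwards [this] with n hn
    rwa [dist_comm, dist_eq_norm] at hn
  obtain ⟨n, hn⟩ := hev.exists
  exact ⟨φ n, hφ1 n, hn⟩


open Filter Topology

theorem elem_central {φ : ↥M →L[ℂ] ↥M} (hφ : IsElementaryUCP φ) {z : ↥M}
    (hz : z ∈ Set.center ↥M) : φ z = z := by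
  obtain ⟨n, a, ha, h⟩ := hφ
  rw [Semigroup.mem_center_iff] at hz
  rw [h]
  have : ∀ i, star (a i) * z * a i = (star (a i) * a i) * z := fun i => by
    rw [mul_assoc, ← hz (a i), mul_assoc]
  simp only [this]
  rw [← Finset.sum_mul, ha, one_mul]

theorem forward1 {ω ρ : ↥M →L[ℂ] ℂ} (hωn : IsNormalFunctional ω) {ψ : ↥M →L[ℂ] ↥M}
    (hψ : InPointWeakStarClosure {φ : ↥M →L[ℂ] ↥M | IsElementaryUCP φ} ψ)
    (h : ω.comp ψ = ρ) {z : ↥M} (hz : z ∈ Set.center ↥M) : ρ z = ω z := by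
  subst h
  rw [← sub_eq_zero, ← norm_le_zero_iff]
  refine le_of_forall_pos_le_add fun ε hε => ?_
  obtain ⟨φ, hφ, hk⟩ := hψ ε hε 1 (fun _ => z) (fun _ => ω) (fun _ => hωn)
  have := hk 0 0
  rw [elem_central hφ hz] at this
  rw [zero_add]
  exact this.le

theorem mulNorm_eq {ω : ↥M →L[ℂ] ℂ} (hp : IsPositiveFunctional ω) (hn : IsNormalFunctional ω)
    {c : ↥M} (hc : c ∈ Set.center ↥M) (hcp : IsPositiveElem c) :
    mulNorm ω c = (ω c).re := by
  rw [Semigroup.mem_center_iff] at hc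
  obtain ⟨ξ, hξ⟩ := vector_form ω hp hn
  obtain ⟨b, hb⟩ := hcp
  have hω0 : 0 ≤ ω c := by rw [hb]; exact hp b
  have hpos : (0 : H →L[ℂ] H) ≤ (c : H →L[ℂ] H) := by
    have e : (c : H →L[ℂ] H) = star (b : H →L[ℂ] H) * (b : H →L[ℂ] H) := by rw [hb]; rfl
    rw [e]; exact star_mul_self_nonneg _
  obtain ⟨s, hss, hs, hsc⟩ := exists_sqrt hpos
  have hcs : ∀ x : ↥M, ω (c * x) =
      ⟪diag Ix s ξ, diag Ix (x : H →L[ℂ] H) (diag Ix s ξ)⟫ := by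
    intro x
    have hcx : Commute (c : H →L[ℂ] H) (x : H →L[ℂ] H) :=
      (congrArg (fun y : ↥M => (y : H →L[ℂ] H)) (hc x)).symm
    have e : (c : H →L[ℂ] H) * (x : H →L[ℂ] H) = s * ((x : H →L[ℂ] H) * s) := by
      rw [← (hsc _ hcx).eq, ← mul_assoc]
      congr 1
      ext v
      exact (hs v).symm
    rw [hξ]
    change ⟪ξ, diag Ix ((c : H →L[ℂ] H) * (x : H →L[ℂ] H)) ξ⟫ = _
    rw [e, diag_mul, diag_mul]
    change ⟪ξ, diag Ix s (diag Ix (x : H →L[ℂ] H) (diag Ix s ξ))⟫ = _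
    rw [← inner_diag_star, hss]
  have h1 : (ω c).re = ‖diag Ix s ξ‖ ^ 2 := by
    have := hcs 1
    rw [mul_one] at this
    rw [this]
    change (⟪diag Ix s ξ, diag Ix (1 : H →L[ℂ] H) (diag Ix s ξ)⟫).re = _
    rw [diag_one]
    change (⟪diag Ix s ξ, diag Ix s ξ⟫).re = _
    rw [inner_self_real, Complex.ofReal_re]
  have hup : ∀ r ∈ {r : ℝ | ∃ x : ↥M, ‖x‖ ≤ 1 ∧ r = ‖ω (c * x)‖}, r ≤ (ω c).re := by
    rintro r ⟨x, hx, rfl⟩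
    rw [hcs, h1]
    calc _ ≤ ‖diag Ix s ξ‖ * ‖diag Ix (x : H →L[ℂ] H) (diag Ix s ξ)‖ := norm_inner_le_norm _ _
      _ ≤ ‖diag Ix s ξ‖ * (1 * ‖diag Ix s ξ‖) := by
          gcongr
          exact (diag Ix (x : H →L[ℂ] H)).le_of_opNorm_le ((diag_norm_le _).trans hx) _
      _ = _ := by ring
  have hmem : (ω c).re ∈ {r : ℝ | ∃ x : ↥M, ‖x‖ ≤ 1 ∧ r = ‖ω (c * x)‖} := by
    refine ⟨1, ?_, ?_⟩
    · change ‖(1 : H →L[ℂ] H)‖ ≤ 1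
      exact ContinuousLinearMap.norm_id_le
    · rw [mul_one]
      have := Complex.re_eq_norm.2 hω0
      exact this
  exact (IsGreatest.csSup_eq ⟨hmem, hup⟩)

theorem positive_shift {h : ↥M} (hh : star h = h) :
    IsPositiveElem (((‖h‖ : ℝ) : ℂ) • (1 : ↥M) + h) := by
  have hsa : IsSelfAdjoint (h : H →L[ℂ] H) := congrArg (fun y : ↥M => (y : H →L[ℂ] H)) hh
  have hpos : (0 : H →L[ℂ] H) ≤ ((‖h‖ : ℝ) : ℂ) • (1 : H →L[ℂ] H) + h := by
    have := hsa.neg_algebraMap_norm_le_self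
    rw [neg_le_iff_add_nonneg'] at this
    exact this
  refine ⟨⟨CFC.sqrt (((‖h‖ : ℝ) : ℂ) • (1 : H →L[ℂ] H) + h), sqrt_mem ?_⟩, ?_⟩
  · exact add_mem (SMulMemClass.smul_mem _ (one_mem M)) h.2
  · apply Subtype.ext
    change ((‖h‖ : ℝ) : ℂ) • (1 : H →L[ℂ] H) + h =
      star (CFC.sqrt (((‖h‖ : ℝ) : ℂ) • (1 : H →L[ℂ] H) + h)) * CFC.sqrt _
    have hss := (CFC.sqrt_nonneg (((‖h‖ : ℝ) : ℂ) • (1 : H →L[ℂ] H) + h)).isSelfAdjoint.star_eq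
    rw [hss, CFC.sqrt_mul_sqrt_self _ hpos]

theorem mem_center_lin {z w : ↥M} (hz : z ∈ Set.center ↥M) (hw : w ∈ Set.center ↥M) (c d : ℂ) :
    c • z + d • w ∈ Set.center ↥M := by
  rw [Semigroup.mem_center_iff] at *
  intro g
  rw [mul_add, add_mul, mul_smul_comm, mul_smul_comm, smul_mul_assoc, smul_mul_assoc, hz, hw]

theorem backward2 {ω ρ : ↥M →L[ℂ] ℂ} (hωs : IsState ω) (hρs : IsState ρ)
    (hωn : IsNormalFunctional ω) (hρn : IsNormalFunctional ρ)
    (h : ∀ c ∈ Set.center ↥M, IsPositiveElem c → mulNorm ρ c ≤ mulNorm ω c)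
    {z : ↥M} (hz : z ∈ Set.center ↥M) : ρ z = ω z := by
  have h1 : ∀ k ∈ Set.center ↥M, star k = k → (ρ k).re ≤ (ω k).re := by
    intro k hk hks
    have hc : ((‖k‖ : ℝ) : ℂ) • (1 : ↥M) + k ∈ Set.center ↥M := by
      have := mem_center_lin (Set.one_mem_center (M := ↥M)) hk ((‖k‖ : ℝ) : ℂ) 1
      rwa [one_smul] at this
    have hp := positive_shift hks
    have h2 := h _ hc hp
    rw [mulNorm_eq hρs.1 hρn hc hp, mulNorm_eq hωs.1 hωn hc hp, map_add, map_add, map_smul,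
      map_smul, hρs.2, hωs.2, Complex.add_re, Complex.add_re] at h2
    linarith
  have him : ∀ σ : ↥M →L[ℂ] ℂ, IsPositiveFunctional σ → ∀ k : ↥M, star k = k → (σ k).im = 0 := by
    intro σ hσ k hk
    have := hermitian_of_pos σ hσ k
    rw [hk] at this
    exact Complex.conj_eq_iff_im.1 this
  have h3 : ∀ k ∈ Set.center ↥M, star k = k → ρ k = ω k := by
    intro k hk hks
    have hn : -k ∈ Set.center ↥M := by
      have := mem_center_lin hk hk (-1) 0
      simpa using this
    have h4 := h1 (-k) hn (by rw [star_neg, hks])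
    rw [map_neg, map_neg, Complex.neg_re, Complex.neg_re] at h4
    apply Complex.ext
    · linarith [h1 k hk hks]
    · rw [him ρ hρs.1 k hks, him ω hωs.1 k hks]
  have hzs : star z ∈ Set.center ↥M := Set.star_mem_center hz
  have hI : ∀ k : ↥M, star (Complex.I • k) = -(Complex.I • star k) := by
    intro k
    apply Subtype.ext
    change star (Complex.I • (k : H →L[ℂ] H)) = -(Complex.I • star (k : H →L[ℂ] H))
    rw [star_smul]
    simp
  have hA := h3 ((1 : ℂ) • z + (1 : ℂ) • star z) (mem_center_lin hz hzs 1 1) (by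
    rw [one_smul, one_smul, star_add, star_star, add_comm])
  have hB := h3 (Complex.I • z + (-Complex.I) • star z) (mem_center_lin hz hzs _ _) (by
    rw [neg_smul, star_add, star_neg, hI, hI, star_star, neg_neg, add_comm])
  simp only [map_add, map_smul, smul_eq_mul, one_mul] at hA hB
  have hB2 : Complex.I * ((ρ z - ρ (star z)) - (ω z - ω (star z))) = 0 := by linear_combination hB
  have hB3 := (mul_eq_zero.1 hB2).resolve_left Complex.I_ne_zero
  linear_combination (1 / 2) * hA + (1 / 2) * hB3

theorem normal_state_transfer_iff
    (ω ρ : ↥M →L[ℂ] ℂ) (hωs : IsState ω) (hρs : IsState ρ)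
    (hωn : IsNormalFunctional ω) (hρn : IsNormalFunctional ρ) :
    ((∃ ψ : ↥M →L[ℂ] ↥M, IsNormalMap ψ ∧ IsCompletelyPositiveMap ψ ∧ ψ 1 = 1 ∧
        InPointWeakStarClosure {φ : ↥M →L[ℂ] ↥M | IsElementaryUCP φ} ψ ∧
        ω.comp ψ = ρ) ↔
      (∀ z ∈ Set.center ↥M, ρ z = ω z)) ∧
    ((∀ z ∈ Set.center ↥M, ρ z = ω z) ↔
      (∀ c ∈ Set.center ↥M, IsPositiveElem c → mulNorm ρ c ≤ mulNorm ω c)) := by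
  refine ⟨⟨?_, ?_⟩, ⟨?_, ?_⟩⟩
  · rintro ⟨ψ, -, -, -, hψ, h⟩ z hz
    exact forward1 hωn hψ h hz
  · intro hz
    obtain ⟨b, hb, hsum⟩ := theorem_B ω ρ hωs.1 hρs.1 hωn hρn hz
    obtain ⟨ψ, hcp, h1, hψ⟩ := exists_psi hb
    refine ⟨ψ, psi_normal hb ψ hψ, hcp, h1, psi_closure hb ψ hψ, ?_⟩
    ext X
    exact (psi_comp hb ψ hψ ω hωn X).unique (hsum X)
  · intro hz c hc hp
    rw [mulNorm_eq hρs.1 hρn hc hp, mulNorm_eq hωs.1 hωn hc hp, hz c hc]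
  · intro h z hz
    exact backward2 hωs hρs hωn hρn h hz

end VonNeumannAlgebraPaper

end
end

section
/- Let ω and ρ be normal states on a von Neumann algebra R. The following statements are equivalent: (i) there exists a quantum channel φ on R such that ω∘φ = ρ; (ii) for every faithful normal representation π of R on a Hilbert space H_π and every normal state ω̃ on B(H_π) extending ω∘π⁻¹, there exists a normal state ρ̃ on B(H_π) extending ρ∘π⁻¹ such that ω̃ and ρ̃ agree on the commutant π(R)′; (iii) for some faithful normal representation of R on a Hilbert space H in which ω is the restriction to R of a vector state ω̃ on B(H), there exists a normal state ρ̃ on B(H) with ρ̃|R = ρ and ρ̃|R′ = ω̃|R′; (iv) letting π_ω be the GNS representation of R induced by ω on H_ω with cyclic vector ξ_ω, the state ρ annihilates ker(π_ω) and there exists a normal state ρ̃ on B(H_ω) whose restriction to π_ω(R) is the state induced by ρ on π_ω(R) ≅ R/ker(π_ω) and whose restriction to π_ω(R)′ agrees with the vector state x ↦ ⟨x ξ_ω, ξ_ω⟩. -/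
universe u

open scoped ComplexConjugate ComplexOrder

noncomputable section

variable {H : Type u} [NormedAddCommGroup H] [InnerProductSpace ℂ H] [CompleteSpace H]

local notation "⟪" x ", " y "⟫" => @inner ℂ _ _ x y

namespace VonNeumannAlgebraPaper

variable {M : VonNeumannAlgebra H}

/-- A normal (σ-weakly continuous) functional on `B(K)`, given by a pair of
ℓ²-sequences of vectors. -/
def IsNormalFunctionalB {K : Type u} [NormedAddCommGroup K] [InnerProductSpace ℂ K]
    [CompleteSpace K] (g : (K →L[ℂ] K) →L[ℂ] ℂ) : Prop :=
  ∃ x y : ℕ → K, Summable (fun n => ‖x n‖ ^ 2) ∧ Summable (fun n => ‖y n‖ ^ 2) ∧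
    ∀ T : K →L[ℂ] K, HasSum (fun n => ⟪x n, T (y n)⟫) (g T)

/-- A state on `B(K)`. -/
def IsStateB {K : Type u} [NormedAddCommGroup K] [InnerProductSpace ℂ K]
    [CompleteSpace K] (g : (K →L[ℂ] K) →L[ℂ] ℂ) : Prop :=
  (∀ T : K →L[ℂ] K, 0 ≤ g (star T * T)) ∧ g 1 = 1

/-- A faithful normal (unital) representation of the von Neumann algebra `M` on
a Hilbert space. -/
structure FaithfulNormalRep (M : VonNeumannAlgebra H) : Type (u + 1) where
  /-- the representation Hilbert space -/
  space : Type u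
  [nacg : NormedAddCommGroup space]
  [ips : InnerProductSpace ℂ space]
  [cplt : CompleteSpace space]
  /-- the representation map -/
  π : ↥M →L[ℂ] (space →L[ℂ] space)
  map_mul' : ∀ x y : ↥M, π (x * y) = π x * π y
  map_star' : ∀ x : ↥M, π (star x) = star (π x)
  map_one' : π 1 = 1
  faithful' : Function.Injective π
  normal' : ∀ g : (space →L[ℂ] space) →L[ℂ] ℂ, IsNormalFunctionalB g →
    IsNormalFunctional (g.comp π)

attribute [instance] FaithfulNormalRep.nacg FaithfulNormalRep.ips FaithfulNormalRep.cplt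

/-- A quantum channel on `M`: a map of the form `x ↦ ∑ j, (a j)* x (a j)` with
`∑ j, (a j)* (a j) = 1`, the sums converging in the strong (resp. weak)
operator topology. -/
def IsQuantumChannel (φ : ↥M →L[ℂ] ↥M) : Prop :=
  ∃ (ι : Type u) (a : ι → ↥M),
    (∀ h : H, HasSum (fun j => ‖((a j : ↥M) : H →L[ℂ] H) h‖ ^ 2) (‖h‖ ^ 2)) ∧
    ∀ (x : ↥M) (h k : H),
      HasSum (fun j => ⟪((a j : ↥M) : H →L[ℂ] H) h,
          ((x : ↥M) : H →L[ℂ] H) (((a j : ↥M) : H →L[ℂ] H) k)⟫)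
        ⟪h, ((φ x : ↥M) : H →L[ℂ] H) k⟫

section General

set_option linter.unusedSectionVars false

open ContinuousLinearMap

/-- The Hilbert space direct sum of copies of `K` indexed by `ι`. -/
abbrev L2 (ι : Type*) (K : Type*) [NormedAddCommGroup K] := lp (fun _ : ι => K) 2

variable {K K' K'' : Type*} [NormedAddCommGroup K] [InnerProductSpace ℂ K]
  [NormedAddCommGroup K'] [InnerProductSpace ℂ K']
  [NormedAddCommGroup K''] [InnerProductSpace ℂ K'']
  {ι : Type*}

theorem L2_hasSum_norm (v : L2 ι K) : HasSum (fun i => ‖v i‖ ^ 2) (‖v‖ ^ 2) := by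
  have := lp.hasSum_norm (by norm_num) v
  simpa using this

theorem memL2 {f : ι → K} (hf : Summable fun i => ‖f i‖ ^ 2) : Memℓp f 2 := by
  apply memℓp_gen
  simpa using hf

/-- Vector in the direct sum from a square summable family. -/
def mkL2 (f : ι → K) (hf : Summable fun i => ‖f i‖ ^ 2) : L2 ι K := ⟨f, memL2 hf⟩

@[simp] theorem mkL2_apply (f : ι → K) (hf : Summable fun i => ‖f i‖ ^ 2) (i : ι) :
    mkL2 f hf i = f i := rfl

theorem L2_summable_amp (T : K →L[ℂ] K') (v : L2 ι K) : Summable fun i => ‖T (v i)‖ ^ 2 := by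
  refine Summable.of_nonneg_of_le (fun i => by positivity) (fun i => ?_)
    ((L2_hasSum_norm v).summable.mul_left (‖T‖ ^ 2))
  rw [← mul_pow]
  gcongr
  exact T.le_opNorm _

theorem L2_norm_le (v : L2 ι K) (w : L2 ι K') (C : ℝ) (hC : 0 ≤ C)
    (h : ∀ i, ‖w i‖ ≤ C * ‖v i‖) : ‖w‖ ≤ C * ‖v‖ := by
  have h1 := L2_hasSum_norm w
  have h2 := (L2_hasSum_norm v).mul_left (C ^ 2)
  have h3 := hasSum_le (fun i => by
    rw [← mul_pow]
    gcongr
    exact h i) h1 h2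
  rw [← mul_pow] at h3
  exact le_of_sq_le_sq h3 (by positivity)

/-- Amplification of an operator. -/
def amp₀ (ι : Type*) (T : K →L[ℂ] K') : L2 ι K →L[ℂ] L2 ι K' :=
  LinearMap.mkContinuous
    { toFun := fun v => mkL2 (fun i => T (v i)) (L2_summable_amp T v)
      map_add' := fun v w => by ext i; simp
      map_smul' := fun c v => by ext i; simp } ‖T‖
    (fun v => L2_norm_le _ _ _ (norm_nonneg _) (fun i => T.le_opNorm _))

theorem amp₀_apply (T : K →L[ℂ] K') (v : L2 ι K) (i : ι) : amp₀ ι T v i = T (v i) := rfl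

/-- Amplification as a continuous linear map. -/
def amp (ι : Type*) : (K →L[ℂ] K') →L[ℂ] (L2 ι K →L[ℂ] L2 ι K') :=
  LinearMap.mkContinuous
    { toFun := fun T : K →L[ℂ] K' => amp₀ ι T
      map_add' := fun S T => by ext v i; simp [amp₀_apply]
      map_smul' := fun c T => by ext v i; simp [amp₀_apply] } 1
    (fun T => by
      rw [one_mul]
      refine ContinuousLinearMap.opNorm_le_bound _ (norm_nonneg T) (fun v => ?_)
      exact L2_norm_le _ _ _ (norm_nonneg _) (fun i => T.le_opNorm _))

@[simp] theorem amp_apply (T : K →L[ℂ] K') (v : L2 ι K) (i : ι) : amp ι T v i = T (v i) := rfl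

theorem amp_comp (S : K' →L[ℂ] K'') (T : K →L[ℂ] K') :
    amp ι (S ∘L T) = amp ι S ∘L amp ι T := by
  ext v i; simp

theorem amp_mul (S T : K →L[ℂ] K) : amp ι (S * T) = amp ι S * amp ι T := amp_comp S T

theorem amp_one : amp ι (1 : K →L[ℂ] K) = 1 := by
  ext v i; simp

variable [CompleteSpace K] [CompleteSpace K']

theorem amp_adjoint (T : K →L[ℂ] K') : amp ι (adjoint T) = adjoint (amp ι T) := by
  rw [eq_adjoint_iff]
  intro x y
  rw [lp.inner_eq_tsum, lp.inner_eq_tsum]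
  congr 1; ext i
  simp [adjoint_inner_left]

theorem amp_star (T : K →L[ℂ] K) : amp ι (star T) = star (amp ι T) := amp_adjoint T

/-- evaluation at a coordinate -/
def evL (i : ι) : L2 ι K →L[ℂ] K :=
  LinearMap.mkContinuous
    { toFun := fun v => v i
      map_add' := fun v w => by simp
      map_smul' := fun c v => by simp } 1
    (fun v => by
      rw [one_mul]
      exact lp.norm_apply_le_norm (by norm_num) v i)

@[simp] theorem evL_apply (i : ι) (v : L2 ι K) : evL i v = v i := rfl

open Classical in
/-- inclusion of a coordinate -/
def inL (i : ι) : K →L[ℂ] L2 ι K :=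
  LinearMap.mkContinuous (lp.lsingle (𝕜 := ℂ) (E := fun _ : ι => K) 2 i) 1
    (fun v => by
      rw [one_mul]
      exact (lp.norm_single (E := fun _ : ι => K) (p := 2) (by norm_num) i v).le)

theorem norm_inL (i : ι) (k : K) : ‖inL i k‖ = ‖k‖ := by
  classical
  exact lp.norm_single (E := fun _ : ι => K) (p := 2) (by norm_num) i k

@[simp] theorem inL_apply_self (i : ι) (k : K) : inL i k i = k := by
  classical
  exact lp.single_apply_self (E := fun _ : ι => K) 2 i k

theorem inL_apply_ne (i j : ι) (k : K) (h : j ≠ i) : inL i k j = 0 := by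
  classical
  exact lp.single_apply_ne (E := fun _ : ι => K) 2 i k h

theorem amp_inL (T : K →L[ℂ] K') (i : ι) (k : K) : amp ι T (inL i k) = inL i (T k) := by
  ext j
  by_cases h : j = i
  · subst h; simp
  · simp [inL_apply_ne _ _ _ h]

theorem inner_inL (i : ι) (h k : K) : ⟪inL i h, inL i k⟫ = ⟪h, k⟫ := by
  have : ⟪inL i h, inL i k⟫ = ⟪h, inL i k i⟫ := by
    classical
    exact lp.inner_single_left (G := fun _ : ι => K) (𝕜 := ℂ) i h _
  rw [this, inL_apply_self]

/-- the column operator of a family of operators. -/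
def colL {J : Type*} (b : J → (K →L[ℂ] K')) (hb : ∀ k, HasSum (fun j => ‖b j k‖ ^ 2) (‖k‖ ^ 2)) :
    K →L[ℂ] L2 J K' :=
  LinearMap.mkContinuous
    { toFun := fun k => mkL2 (fun j => b j k) (hb k).summable
      map_add' := fun v w => by ext i; simp
      map_smul' := fun c v => by ext i; simp } 1
    (fun k => by
      rw [one_mul]
      have h1 := L2_hasSum_norm (mkL2 (fun j => b j k) (hb k).summable)
      have h2 := h1.unique (hb k)
      exact le_of_sq_le_sq h2.le (by positivity))

@[simp] theorem colL_apply {J : Type*} (b : J → (K →L[ℂ] K')) (hb) (k : K) (j : J) :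
    colL b hb k j = b j k := rfl

theorem norm_colL {J : Type*} (b : J → (K →L[ℂ] K')) (hb) (k : K) :
    ‖colL b hb k‖ = ‖k‖ := by
  have h1 := L2_hasSum_norm (colL b hb k)
  have h2 := h1.unique (hb k)
  exact (sq_eq_sq₀ (norm_nonneg _) (norm_nonneg _)).1 h2

theorem adjoint_colL {J : Type*} (b : J → (K →L[ℂ] K')) (hb) :
    adjoint (colL b hb) ∘L colL b hb = 1 :=
  (norm_map_iff_adjoint_comp_self _).1 (norm_colL b hb)

/-- Double sums. -/
theorem hasSum_double {N J : Type*} (x y : N → L2 J K) (hx : Summable fun n => ‖x n‖ ^ 2)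
    (hy : Summable fun n => ‖y n‖ ^ 2) (T : K →L[ℂ] K) (s : ℂ)
    (h : HasSum (fun n => ⟪x n, amp J T (y n)⟫) s) :
    HasSum (fun p : N × J => ⟪x p.1 p.2, T (y p.1 p.2)⟫) s := by
  have key : ∀ z : N → L2 J K, (Summable fun n => ‖z n‖ ^ 2) →
      Summable fun p : N × J => ‖z p.1 p.2‖ ^ 2 := by
    intro z hz
    rw [summable_prod_of_nonneg (fun p => by positivity)]
    refine ⟨fun n => (L2_hasSum_norm (z n)).summable, ?_⟩
    simpa [(L2_hasSum_norm (z _)).tsum_eq] using hz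
  have hs : Summable (fun p : N × J => ⟪x p.1 p.2, T (y p.1 p.2)⟫) := by
    refine Summable.of_norm_bounded (g := fun p : N × J =>
      ‖T‖ * (‖x p.1 p.2‖ ^ 2 + ‖y p.1 p.2‖ ^ 2)) (((key x hx).add (key y hy)).mul_left _) ?_
    intro p
    have h1 := norm_inner_le_norm (𝕜 := ℂ) (x p.1 p.2) (T (y p.1 p.2))
    have h2 := T.le_opNorm (y p.1 p.2)
    have h3 : ‖x p.1 p.2‖ * ‖T (y p.1 p.2)‖ ≤ ‖x p.1 p.2‖ * (‖T‖ * ‖y p.1 p.2‖) := by gcongr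
    have h4 : ‖x p.1 p.2‖ * ‖y p.1 p.2‖ ≤ ‖x p.1 p.2‖ ^ 2 + ‖y p.1 p.2‖ ^ 2 := by
      nlinarith [sq_nonneg (‖x p.1 p.2‖ - ‖y p.1 p.2‖), sq_nonneg (‖x p.1 p.2‖), 
        sq_nonneg (‖y p.1 p.2‖)]
    have h5 := mul_le_mul_of_nonneg_left h4 (norm_nonneg T)
    linarith
  have h6 := hs.hasSum.prod_fiberwise (fun n => lp.hasSum_inner (𝕜 := ℂ) (x n) (amp J T (y n)))
  rw [← h6.unique h]
  exact hs.hasSum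

theorem summable_double {N J : Type*} (z : N → L2 J K) (hz : Summable fun n => ‖z n‖ ^ 2) :
      Summable fun p : N × J => ‖z p.1 p.2‖ ^ 2 := by
    rw [summable_prod_of_nonneg (fun p => by positivity)]
    refine ⟨fun n => (L2_hasSum_norm (z n)).summable, ?_⟩
    simpa [(L2_hasSum_norm (z _)).tsum_eq] using hz

/-- Reindexing square summable families by natural numbers. -/
theorem reindex {N : Type*} (x y : N → K) (hx : Summable fun n => ‖x n‖ ^ 2)
    (hy : Summable fun n => ‖y n‖ ^ 2) :
    ∃ x' y' : ℕ → K, (Summable fun n => ‖x' n‖ ^ 2) ∧ (Summable fun n => ‖y' n‖ ^ 2) ∧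
      ∀ (T : K →L[ℂ] K) (s : ℂ), HasSum (fun n => ⟪x n, T (y n)⟫) s →
        HasSum (fun n => ⟪x' n, T (y' n)⟫) s := by
  classical
  have hc : (Function.support (fun n => ‖x n‖ ^ 2 + ‖y n‖ ^ 2)).Countable :=
    (hx.add hy).countable_support
  set S := Function.support (fun n => ‖x n‖ ^ 2 + ‖y n‖ ^ 2) with hS
  have hxS : ∀ n, n ∉ S → x n = 0 := by
    intro n hn
    simp only [hS, Function.mem_support, not_not] at hn
    have : ‖x n‖ ^ 2 = 0 := by nlinarith [sq_nonneg ‖x n‖, sq_nonneg ‖y n‖]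
    simpa using this
  have hyS : ∀ n, n ∉ S → y n = 0 := by
    intro n hn
    simp only [hS, Function.mem_support, not_not] at hn
    have : ‖y n‖ ^ 2 = 0 := by nlinarith [sq_nonneg ‖x n‖, sq_nonneg ‖y n‖]
    simpa using this
  obtain ⟨e, he⟩ := (Set.countable_iff_exists_injective).1 hc
  have hext : ∀ (f : S → ℂ) (s : ℂ), HasSum f s → HasSum (Function.extend e f 0) s :=
    fun f s h => (hasSum_extend_zero he).2 h
  have hextr : ∀ (z : N → K), Summable (fun n => ‖z n‖ ^ 2) →
      Summable (fun n => ‖Function.extend e (fun i : S => z i) 0 n‖ ^ 2) := by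
    intro z hz
    have h1 : Summable (fun i : S => ‖z i‖ ^ 2) := hz.comp_injective Subtype.val_injective
    have h2 := (summable_extend_zero he).2 h1
    convert h2 using 1
    ext n
    by_cases hn : ∃ a, e a = n
    · obtain ⟨a, rfl⟩ := hn
      simp [he.extend_apply]
    · simp [Function.extend_apply' _ _ _ hn]
  refine ⟨_, _, hextr x hx, hextr y hy, ?_⟩
  intro T s h
  have h1 : HasSum (fun i : S => ⟪x i, T (y i)⟫) s := by
    refine (hasSum_subtype_iff_of_support_subset (f := fun n => ⟪x n, T (y n)⟫) ?_).2 h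
    intro n hn
    by_contra hn'
    exact hn (by simp [hxS n hn'])
  have h2 := hext _ _ h1
  convert h2 using 1
  ext n
  by_cases hn : ∃ a, e a = n
  · obtain ⟨a, rfl⟩ := hn
    simp [he.extend_apply]
  · simp [Function.extend_apply' _ _ _ hn]

/-- The partial isometry determined by isometric data. -/
theorem exists_partialIsometry {E : Type*} [AddCommGroup E] [Module ℂ E]
    (f : E →ₗ[ℂ] K) (g : E →ₗ[ℂ] K') (hfg : ∀ e, ‖g e‖ = ‖f e‖) :
    ∃ V : K →L[ℂ] K', (∀ e, V (f e) = g e) ∧ (∀ e, adjoint V (V (f e)) = f e) ∧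
      (∀ k, V (adjoint V (V k)) = V k) ∧ (∀ k, V k ∈ closure (Set.range g)) ∧
      ∀ (S : K →L[ℂ] K) (S' : K' →L[ℂ] K'),
        (∀ e, ∃ e', S (f e) = f e' ∧ S' (g e) = g e') →
        (∀ e, ∃ e', adjoint S (f e) = f e') → V ∘L S = S' ∘L V := by
  set R : Submodule ℂ K := (LinearMap.range f).topologicalClosure with hR
  have hRc : IsClosed (R : Set K) := Submodule.isClosed_topologicalClosure _
  have : CompleteSpace R := hRc.completeSpace_coe
  have hfR : ∀ e, f e ∈ R := fun e =>
    Submodule.le_topologicalClosure _ (LinearMap.mem_range_self f e)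
  have hRcl : (R : Set K) = closure (Set.range f) := by
    rw [hR, Submodule.topologicalClosure_coe, LinearMap.coe_range]
  set f0 : E →ₗ[ℂ] R := f.codRestrict R hfR with hf0
  have hdense : DenseRange f0 := by
    intro r
    rw [closure_subtype, ← Set.range_comp]
    have h1 : (Subtype.val ∘ f0) = f := rfl
    rw [h1, ← hRcl]
    exact r.2
  have hn : ∀ e, ‖g e‖ ≤ 1 * ‖f0 e‖ := fun e => by
    rw [one_mul, hfg]; rfl
  set V0 : R →L[ℂ] K' := g.extendOfNorm f0 with hV0
  have hV0f : ∀ e, V0 (f0 e) = g e := LinearMap.extendOfNorm_eq hdense ⟨1, hn⟩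
  have hV0n : ∀ r, ‖V0 r‖ ≤ ‖r‖ := fun r => by
    simpa using LinearMap.norm_extendOfNorm_apply_le hdense 1 hn r
  set V : K →L[ℂ] K' := V0 ∘L R.orthogonalProjectionOnto with hV
  have hVf : ∀ e, V (f e) = g e := by
    intro e
    have : R.orthogonalProjectionOnto (f e) = f0 e :=
      Submodule.orthogonalProjectionOnto_mem_subspace_eq_self (K := R) (f0 e)
    simp [hV, this, hV0f]
  have hVn : ∀ k, ‖V k‖ ≤ ‖k‖ := by
    intro k
    exact (hV0n _).trans (Submodule.norm_orthogonalProjectionOnto_apply_le R k)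
  have hVperp : ∀ k ∈ Rᗮ, V k = 0 := by
    intro k hk
    simp [hV, Submodule.orthogonalProjectionOnto_apply_of_mem_orthogonal hk]
  have hVa : ∀ k, ‖adjoint V k‖ ≤ ‖k‖ := by
    intro k
    have h1 : ‖V‖ ≤ 1 := V.opNorm_le_bound zero_le_one (fun k => by simpa using hVn k)
    have h2 := (adjoint V).le_opNorm k
    rw [LinearIsometryEquiv.norm_map] at h2
    nlinarith [norm_nonneg k]
  have hVV : ∀ e, adjoint V (V (f e)) = f e := by
    intro e
    have h1 : ‖V (f e)‖ = ‖f e‖ := by rw [hVf, hfg]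
    have h2 := norm_sub_sq (𝕜 := ℂ) (adjoint V (V (f e))) (f e)
    rw [adjoint_inner_left, inner_self_eq_norm_sq (𝕜 := ℂ), h1] at h2
    have h3 := hVa (V (f e))
    rw [h1] at h3
    have h4 : ‖adjoint V (V (f e))‖ ^ 2 ≤ ‖f e‖ ^ 2 := by gcongr
    have h5 : ‖adjoint V (V (f e)) - f e‖ ^ 2 ≤ 0 := by linarith
    have h6 : ‖adjoint V (V (f e)) - f e‖ = 0 := by
      nlinarith [norm_nonneg (adjoint V (V (f e)) - f e), sq_nonneg (‖adjoint V (V (f e)) - f e‖)]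
    exact sub_eq_zero.1 (norm_eq_zero.1 h6)
  -- extensionality principle
  have hext : ∀ A B : K →L[ℂ] K', (∀ e, A (f e) = B (f e)) → (∀ k ∈ Rᗮ, A k = B k) → A = B := by
    intro A B h1 h2
    have h3 : ∀ k ∈ R, A k = B k := by
      intro k hk
      have hk' : k ∈ closure (Set.range f) := by rw [← hRcl]; exact hk
      have hcl : IsClosed {k | A k = B k} := isClosed_eq A.continuous B.continuous
      refine closure_minimal ?_ hcl hk'
      rintro _ ⟨e, rfl⟩
      exact h1 e
    ext k
    have h4 : k = R.starProjection k + (k - R.starProjection k) := by abel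
    rw [h4, map_add, map_add, h3 _ (Submodule.starProjection_apply_mem R k),
      h2 _ (Submodule.sub_starProjection_mem_orthogonal k)]
  refine ⟨V, hVf, hVV, ?_, ?_, ?_⟩
  · intro k
    have : V ∘L adjoint V ∘L V = V := by
      apply hext
      · intro e
        simp [hVV]
      · intro k hk
        simp [hVperp k hk]
    exact congrArg (fun W : K →L[ℂ] K' => W k) this
  · intro k
    have h1 : ∀ r : R, V0 r ∈ closure (Set.range g) := by
      intro r
      have hcl : IsClosed {r : R | V0 r ∈ closure (Set.range g)} :=
        isClosed_closure.preimage V0.continuous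
      refine hdense.induction_on r hcl ?_
      intro e
      rw [hV0f]
      exact subset_closure ⟨e, rfl⟩
    exact h1 _
  · intro S S' h1 h2
    apply hext
    · intro e
      obtain ⟨e', h3, h4⟩ := h1 e
      simp [h3, hVf, h4]
    · intro k hk
      have h3 : S k ∈ Rᗮ := by
        rw [hR, Submodule.orthogonal_closure] at hk ⊢
        rw [Submodule.mem_orthogonal] at hk ⊢
        rintro _ ⟨e, rfl⟩
        obtain ⟨e', h4⟩ := h2 e
        rw [← adjoint_inner_left, h4]
        exact hk _ ⟨e', rfl⟩
      simp [hVperp _ h3, hVperp _ hk]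

end General

section Positive

set_option linter.unusedSectionVars false

open ContinuousLinearMap

variable {K : Type*} [NormedAddCommGroup K] [InnerProductSpace ℂ K] [CompleteSpace K]

theorem positive_rep {L : Type*} [NormedAddCommGroup L] [InnerProductSpace ℂ L] [CompleteSpace L]
    {A : Type*} [Ring A] [StarRing A] [Module ℂ A]
    (σ : A →ₗ[ℂ] (L →L[ℂ] L)) (hmul : ∀ a b, σ (a * b) = σ a * σ b)
    (hstar : ∀ a, σ (star a) = star (σ a)) (hone : σ 1 = 1) (u : L) (J : L →L[ℂ] L)
    (hJ : ∀ a, Commute J (σ a)) (hpos : ∀ a, 0 ≤ ⟪u, J (σ (star a * a) u)⟫) :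
    ∃ z : L, ∀ a, ⟪u, J (σ a u)⟫ = ⟪z, σ a z⟫ := by
  let f : A →ₗ[ℂ] L :=
    { toFun := fun a => σ a u
      map_add' := fun a b => by simp
      map_smul' := fun c a => by simp }
  have hf : ∀ a, f a = σ a u := fun a => rfl
  have hfm : ∀ a b, σ b (f a) = f (b * a) := fun a b => by
    rw [hf, hf, hmul]; rfl
  have hfone : f 1 = u := by rw [hf, hone]; rfl
  obtain ⟨V, hV1, -, -, hV4, hV5⟩ := exists_partialIsometry f f (fun _ => rfl)
  have hVc : ∀ b, Commute V (σ b) := by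
    intro b
    refine hV5 (σ b) (σ b) (fun e => ⟨b * e, hfm _ _, hfm _ _⟩) (fun e => ⟨star b * e, ?_⟩)
    rw [← hfm, hstar]; rfl
  have hVc' : ∀ b, Commute (star V) (σ b) := by
    intro b
    have := (hVc (star b)).star_star
    rwa [hstar, star_star] at this
  set T : L →L[ℂ] L := star V * J * V with hT
  have hTc : ∀ b, Commute T (σ b) := fun b => ((hVc' b).mul_left (hJ b)).mul_left (hVc b)
  have hJpos : ∀ w ∈ closure (Set.range f), 0 ≤ ⟪w, J w⟫ := by
    intro w hw
    have hcl : IsClosed {w : L | 0 ≤ ⟪w, J w⟫} := by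
      apply isClosed_le continuous_const
      fun_prop
    refine closure_minimal ?_ hcl hw
    rintro _ ⟨a, rfl⟩
    have h1 := hpos a
    rw [hmul, hstar] at h1
    have h2 : J ((star (σ a) * σ a) u) = star (σ a) (J (σ a u)) := by
      have := hJ (star a)
      rw [hstar] at this
      exact congrArg (fun W : L →L[ℂ] L => W (σ a u)) this.eq
    rw [h2, star_eq_adjoint, adjoint_inner_right] at h1
    exact h1
  have hTin : ∀ k l, ⟪k, T l⟫ = ⟪V k, J (V l)⟫ := by
    intro k l
    have h1 : T l = adjoint V (J (V l)) := rfl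
    rw [h1, adjoint_inner_right]
  have hTpos : 0 ≤ T := by
    rw [nonneg_iff_isPositive, isPositive_iff_complex]
    intro k
    have h1 : 0 ≤ ⟪k, T k⟫ := by rw [hTin]; exact hJpos _ (hV4 k)
    have h2 : ⟪T k, k⟫ = ⟪k, T k⟫ := by
      rw [← inner_conj_symm]
      exact Complex.conj_eq_iff_im.2 (Complex.nonneg_iff.1 h1).2.symm
    rw [h2]
    have := Complex.nonneg_iff.1 h1
    refine ⟨?_, this.1⟩
    apply Complex.ext
    · simp
    · simp [← this.2]
  set S : L →L[ℂ] L := CFC.sqrt T with hS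
  have hSS : S * S = T := CFC.sqrt_mul_sqrt_self T hTpos
  have hSsa : star S = S := (IsSelfAdjoint.of_nonneg (CFC.sqrt_nonneg T)).star_eq
  have hSc : ∀ b, Commute S (σ b) := fun b => by
    rw [hS, CFC.sqrt]
    exact (hTc b).cfcₙ_nnreal _
  refine ⟨S u, fun a => ?_⟩
  have h1 : ⟪S u, σ a (S u)⟫ = ⟪u, T (σ a u)⟫ := by
    rw [← adjoint_inner_right, ← star_eq_adjoint, hSsa]
    have h2 : S (σ a (S u)) = (S * (σ a * S)) u := rfl
    rw [h2, ← (hSc a).eq, ← mul_assoc, hSS]; rfl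
  rw [h1, hTin]
  have h3 : V u = u := by
    have := hV1 1
    rwa [hfone] at this
  rw [h3, ← hf, hV1]

theorem summable_sum_of {f : ℕ ⊕ ℕ → ℝ} (h1 : Summable fun n => f (Sum.inl n))
    (h2 : Summable fun n => f (Sum.inr n)) : Summable f :=
  (HasSum.sum (f := f) h1.hasSum h2.hasSum).summable

/-- the operator `(v, w) ↦ (w, 0)` on `K^ℕ ⊕ K^ℕ`. -/
def shiftJ : L2 (ℕ ⊕ ℕ) K →L[ℂ] L2 (ℕ ⊕ ℕ) K :=
  LinearMap.mkContinuous
    { toFun := fun v => mkL2 (Sum.elim (fun n => v (Sum.inr n)) (fun _ => 0)) (by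
        refine summable_sum_of ?_ ?_
        · exact (L2_hasSum_norm v).summable.comp_injective Sum.inr_injective
        · simp)
      map_add' := fun v w => by ext i; cases i <;> simp
      map_smul' := fun c v => by ext i; cases i <;> simp } 1
    (fun v => by
      rw [one_mul]
      refine le_of_sq_le_sq ?_ (norm_nonneg v)
      refine (hasSum_le_inj (Sum.swap) Sum.swap_leftInverse.injective ?_ ?_
        (L2_hasSum_norm _) (L2_hasSum_norm v))
      · intro c _; positivity
      · intro i; cases i <;> simp)

theorem shiftJ_inl (v : L2 (ℕ ⊕ ℕ) K) (n : ℕ) : shiftJ v (Sum.inl n) = v (Sum.inr n) := rfl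
theorem shiftJ_inr (v : L2 (ℕ ⊕ ℕ) K) (n : ℕ) : shiftJ v (Sum.inr n) = 0 := rfl

/-- A positive functional given by a pair of square summable sequences is given by a single one. -/
theorem positive_normal {A : Type*} [Ring A] [StarRing A] [Module ℂ A]
    (π : A →ₗ[ℂ] (K →L[ℂ] K)) (hmul : ∀ a b, π (a * b) = π a * π b)
    (hstar : ∀ a, π (star a) = star (π a)) (hone : π 1 = 1) (g : A → ℂ)
    (hpos : ∀ a, 0 ≤ g (star a * a)) (x y : ℕ → K) (hx : Summable fun n => ‖x n‖ ^ 2)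
    (hy : Summable fun n => ‖y n‖ ^ 2) (hg : ∀ a, HasSum (fun n => ⟪x n, π a (y n)⟫) (g a)) :
    ∃ z : L2 (ℕ ⊕ ℕ) K, ∀ a, g a = ⟪z, amp (ℕ ⊕ ℕ) (π a) z⟫ := by
  have hu : Summable fun i => ‖Sum.elim x y i‖ ^ 2 := summable_sum_of hx hy
  set u : L2 (ℕ ⊕ ℕ) K := mkL2 _ hu with hudef
  have hgu : ∀ a, g a = ⟪u, shiftJ (amp (ℕ ⊕ ℕ) (π a) u)⟫ := by
    intro a
    have h1 := lp.hasSum_inner (𝕜 := ℂ) u (shiftJ (amp (ℕ ⊕ ℕ) (π a) u))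
    refine HasSum.unique ?_ h1
    have h2 : HasSum (fun n : ℕ => (0 : ℂ)) 0 := hasSum_zero
    have h3 := HasSum.sum (f := fun i => ⟪u i, shiftJ (amp (ℕ ⊕ ℕ) (π a) u) i⟫)
      (a := g a) (b := 0) ?_ ?_
    · simpa using h3
    · exact hg a
    · convert h2 using 1
      ext n
      exact inner_zero_right _
  have hJ : ∀ a, Commute shiftJ (amp (ℕ ⊕ ℕ) (π a)) := by
    intro a
    ext v i
    cases i <;> simp [shiftJ_inr, shiftJ_inl]
  obtain ⟨z, hz⟩ := positive_rep (((amp (ℕ ⊕ ℕ)).toLinearMap).comp π : A →ₗ[ℂ] _)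
    (fun a b => by simp [hmul, amp_mul]) (fun a => by simp [hstar, amp_star])
    (by simp [hone, amp_one]) u shiftJ hJ (fun a => by
      have := hpos a
      rw [hgu] at this
      exact this)
  exact ⟨z, fun a => (hgu a).trans (hz a)⟩

end Positive

section Forward

open ContinuousLinearMap

set_option linter.unusedSectionVars false

/-- The inclusion of `M` into the bounded operators. -/
def coeL (M : VonNeumannAlgebra H) : ↥M →L[ℂ] (H →L[ℂ] H) :=
  LinearMap.mkContinuous
    { toFun := fun r : ↥M => (r : H →L[ℂ] H)
      map_add' := fun _ _ => rfl
      map_smul' := fun _ _ => rfl } 1 (fun r => by rw [one_mul]; exact le_rfl)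

@[simp] theorem coeL_apply (r : ↥M) : coeL M r = (r : H →L[ℂ] H) := rfl

/-- Compression `T ↦ V* T V`. -/
def conjL {K L : Type*} [NormedAddCommGroup K] [InnerProductSpace ℂ K] [CompleteSpace K]
    [NormedAddCommGroup L] [InnerProductSpace ℂ L] [CompleteSpace L] (V : K →L[ℂ] L) :
    (L →L[ℂ] L) →L[ℂ] (K →L[ℂ] K) :=
  (compL ℂ K L K (adjoint V)) ∘L ((compL ℂ K L L).flip V)

theorem conjL_apply {K L : Type*} [NormedAddCommGroup K] [InnerProductSpace ℂ K] [CompleteSpace K]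
    [NormedAddCommGroup L] [InnerProductSpace ℂ L] [CompleteSpace L] (V : K →L[ℂ] L)
    (T : L →L[ℂ] L) : conjL V T = adjoint V ∘L (T ∘L V) := rfl

theorem inner_conjL {K L : Type*} [NormedAddCommGroup K] [InnerProductSpace ℂ K] [CompleteSpace K]
    [NormedAddCommGroup L] [InnerProductSpace ℂ L] [CompleteSpace L] (V : K →L[ℂ] L)
    (T : L →L[ℂ] L) (h k : K) : ⟪h, conjL V T k⟫ = ⟪V h, T (V k)⟫ := by
  rw [conjL_apply, comp_apply, adjoint_inner_right]; rfl

theorem conjL_nonneg {K L : Type*} [NormedAddCommGroup K] [InnerProductSpace ℂ K]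
    [CompleteSpace K] [NormedAddCommGroup L] [InnerProductSpace ℂ L] [CompleteSpace L]
    (V : K →L[ℂ] L) (T : L →L[ℂ] L) : 0 ≤ conjL V (star T * T) := by
  have h : conjL V (star T * T) = adjoint (T ∘L V) ∘L (T ∘L V) := by
    rw [adjoint_comp]; rfl
  rw [h, nonneg_iff_isPositive]
  exact isPositive_adjoint_comp_self _

theorem channel_hasSum {φ : ↥M →L[ℂ] ↥M} {ι : Type u} {a : ι → ↥M}
    (h1 : ∀ h : H, HasSum (fun j => ‖((a j : ↥M) : H →L[ℂ] H) h‖ ^ 2) (‖h‖ ^ 2))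
    (h2 : ∀ (x : ↥M) (h k : H),
      HasSum (fun j => ⟪((a j : ↥M) : H →L[ℂ] H) h,
          ((x : ↥M) : H →L[ℂ] H) (((a j : ↥M) : H →L[ℂ] H) k)⟫)
        ⟪h, ((φ x : ↥M) : H →L[ℂ] H) k⟫)
    (g : ↥M →L[ℂ] ℂ) (hg : IsNormalFunctional g) (r : ↥M) :
    HasSum (fun j => g (star (a j) * r * a j)) (g (φ r)) := by
  obtain ⟨x, y, hx, hy, hxy⟩ := hg
  let V : H →L[ℂ] L2 ι H := colL (fun j => (a j : H →L[ℂ] H)) h1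
  have hV : ∀ h j, V h j = (a j : H →L[ℂ] H) h := fun h j => rfl
  have hVr : ∀ h k, ⟪V h, amp ι (r : H →L[ℂ] H) (V k)⟫ = ⟪h, (φ r : H →L[ℂ] H) k⟫ := fun h k =>
    (lp.hasSum_inner (𝕜 := ℂ) (V h) (amp ι (r : H →L[ℂ] H) (V k))).unique (h2 r h k)
  have hd := hasSum_double (fun n => V (x n)) (fun n => V (y n))
    (by simpa [V, norm_colL] using hx) (by simpa [V, norm_colL] using hy) (r : H →L[ℂ] H)
    (g (φ r)) (by simpa only [hVr] using hxy (φ r))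
  have hd' := (Equiv.prodComm ι ℕ).hasSum_iff.2 hd
  refine hd'.prod_fiberwise (fun j => ?_)
  convert hxy (star (a j) * r * a j) using 1
  ext n
  have h3 : ((star (a j) * r * a j : ↥M) : H →L[ℂ] H) =
    adjoint (a j : H →L[ℂ] H) * (r : H →L[ℂ] H) * (a j : H →L[ℂ] H) := rfl
  rw [h3]
  change ⟪V (x n) j, (r : H →L[ℂ] H) (V (y n) j)⟫ =
    ⟪x n, adjoint (a j : H →L[ℂ] H) ((r : H →L[ℂ] H) ((a j : H →L[ℂ] H) (y n)))⟫
  rw [adjoint_inner_right, hV, hV]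

theorem channel_one {φ : ↥M →L[ℂ] ↥M} {ι : Type u} {a : ι → ↥M}
    (h1 : ∀ h : H, HasSum (fun j => ‖((a j : ↥M) : H →L[ℂ] H) h‖ ^ 2) (‖h‖ ^ 2))
    (h2 : ∀ (x : ↥M) (h k : H),
      HasSum (fun j => ⟪((a j : ↥M) : H →L[ℂ] H) h,
          ((x : ↥M) : H →L[ℂ] H) (((a j : ↥M) : H →L[ℂ] H) k)⟫)
        ⟪h, ((φ x : ↥M) : H →L[ℂ] H) k⟫) : φ 1 = 1 := by
  let V : H →L[ℂ] L2 ι H := colL (fun j => (a j : H →L[ℂ] H)) h1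
  apply Subtype.ext
  ext k
  apply ext_inner_left ℂ
  intro h
  have h3 := (lp.hasSum_inner (𝕜 := ℂ) (V h) (V k)).unique (h2 1 h k)
  rw [← h3, ← adjoint_inner_right]
  have h4 : adjoint V (V k) = k :=
    congrArg (fun W : H →L[ℂ] H => W k) (adjoint_colL (fun j => (a j : H →L[ℂ] H)) h1)
  rw [h4]; rfl

set_option maxHeartbeats 1000000 in
theorem forward {K : Type u} [NormedAddCommGroup K] [InnerProductSpace ℂ K] [CompleteSpace K]
    (ω ρ : ↥M →L[ℂ] ℂ) (hφ : ∃ φ : ↥M →L[ℂ] ↥M, IsQuantumChannel φ ∧ ω.comp φ = ρ)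
    (π : ↥M →L[ℂ] (K →L[ℂ] K))
    (hmul : ∀ x y : ↥M, π (x * y) = π x * π y) (hstar : ∀ x : ↥M, π (star x) = star (π x))
    (hone : π 1 = 1)
    (hnorm : ∀ η ζ : K, ∃ g : ↥M →L[ℂ] ℂ, IsNormalFunctional g ∧ ∀ r, g r = ⟪η, π r ζ⟫)
    (tω : (K →L[ℂ] K) →L[ℂ] ℂ) (hs : IsStateB tω) (hn : IsNormalFunctionalB tω)
    (htω : ∀ r : ↥M, tω (π r) = ω r) :
    ∃ tρ : (K →L[ℂ] K) →L[ℂ] ℂ,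
      IsStateB tρ ∧ IsNormalFunctionalB tρ ∧ (∀ r : ↥M, tρ (π r) = ρ r) ∧
      ∀ T : K →L[ℂ] K, (∀ r : ↥M, T * π r = π r * T) → tρ T = tω T := by
  obtain ⟨φ, ⟨ι, a, h1, h2⟩, rfl⟩ := hφ
  have hterm : ∀ (r : ↥M) (j : ι) (η ζ : K), ⟪η, π (star (a j) * r * a j) ζ⟫ =
      ⟪π (a j) η, π r (π (a j) ζ)⟫ := by
    intro r j η ζ
    rw [hmul, hmul, hstar, star_eq_adjoint]
    change ⟪η, adjoint (π (a j)) (π r (π (a j) ζ))⟫ = _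
    rw [adjoint_inner_right]
  have hsum : ∀ (r : ↥M) (η ζ : K), HasSum (fun j => ⟪π (a j) η, π r (π (a j) ζ)⟫)
      ⟪η, π (φ r) ζ⟫ := by
    intro r η ζ
    obtain ⟨g, hg, hg'⟩ := hnorm η ζ
    have := channel_hasSum h1 h2 g hg r
    simpa only [hg', hterm] using this
  have hcol : ∀ η, HasSum (fun j => ‖π (a j) η‖ ^ 2) (‖η‖ ^ 2) := by
    intro η
    have h3 := hsum 1 η η
    rw [channel_one h1 h2, hone] at h3
    have h4 := Complex.hasSum_re h3
    simp only [one_apply_eq_self] at h4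
    simpa only [← RCLike.re_eq_complex_re, inner_self_eq_norm_sq] using h4
  let V : K →L[ℂ] L2 ι K := colL (fun j => π (a j)) hcol
  have hV : ∀ h j, V h j = π (a j) h := fun h j => rfl
  have hVV : adjoint V ∘L V = 1 := adjoint_colL _ hcol
  let tρ : (K →L[ℂ] K) →L[ℂ] ℂ := tω ∘L (conjL V) ∘L (amp ι)
  have htρ : ∀ T, tρ T = tω (conjL V (amp ι T)) := fun T => rfl
  have hcomm : ∀ T : K →L[ℂ] K, (∀ r : ↥M, T * π r = π r * T) → conjL V (amp ι T) = T := by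
    intro T hT
    have h3 : amp ι T ∘L V = V ∘L T := by
      ext k j
      exact congrArg (fun W : K →L[ℂ] K => W k) (hT (a j))
    rw [conjL_apply, h3, ← comp_assoc, hVV]
    rfl
  have hπ : ∀ r, conjL V (amp ι (π r)) = π (φ r) := by
    intro r
    ext k
    apply ext_inner_left ℂ
    intro h
    rw [inner_conjL]
    exact (lp.hasSum_inner (𝕜 := ℂ) (V h) (amp ι (π r) (V k))).unique (hsum r h k)
  refine ⟨tρ, ⟨?_, ?_⟩, ?_, ?_, ?_⟩
  · intro T
    rw [htρ]
    have h3 : 0 ≤ conjL V (amp ι (star T * T)) := by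
      rw [amp_mul, amp_star]
      exact conjL_nonneg V _
    obtain ⟨S, hS⟩ := CStarAlgebra.nonneg_iff_eq_star_mul_self.1 h3
    rw [hS]
    exact hs.1 S
  · rw [htρ, hcomm 1 (fun r => by rw [one_mul, mul_one])]
    exact hs.2
  · obtain ⟨x, y, hx, hy, hxy⟩ := hn
    have hx' : Summable fun n => ‖V (x n)‖ ^ 2 := by simpa [V, norm_colL] using hx
    have hy' : Summable fun n => ‖V (y n)‖ ^ 2 := by simpa [V, norm_colL] using hy
    obtain ⟨x', y', hx'', hy'', h3⟩ := reindex (fun p : ℕ × ι => V (x p.1) p.2)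
      (fun p : ℕ × ι => V (y p.1) p.2) 
      (summable_double (fun n => V (x n)) hx') (summable_double (fun n => V (y n)) hy')
    refine ⟨x', y', hx'', hy'', fun T => h3 T _ ?_⟩
    refine hasSum_double (fun n => V (x n)) (fun n => V (y n)) hx' hy' T _ ?_
    have := hxy (conjL V (amp ι T))
    simpa only [inner_conjL, ← htρ] using this
  · intro r
    rw [htρ, hπ, htω]; rfl
  · intro T hT
    rw [htρ, hcomm T hT]

end Forward

section Backward

open ContinuousLinearMap

set_option linter.unusedSectionVars false

variable {K L : Type*} [NormedAddCommGroup K] [InnerProductSpace ℂ K] [CompleteSpace K]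
    [NormedAddCommGroup L] [InnerProductSpace ℂ L] [CompleteSpace L]

theorem rep_inner (π : ↥M →L[ℂ] (K →L[ℂ] K))
    (hmul : ∀ x y : ↥M, π (x * y) = π x * π y) (hstar : ∀ x : ↥M, π (star x) = star (π x))
    (r s : ↥M) (x y : K) : ⟪π r x, π s y⟫ = ⟪x, π (star r * s) y⟫ := by
  rw [hmul, hstar, star_eq_adjoint]
  change _ = ⟪x, adjoint (π r) (π s y)⟫
  rw [adjoint_inner_right]

theorem norm_eq_of_inner_self_eq {x : K} {y : L} (h : ⟪x, x⟫ = ⟪y, y⟫) : ‖x‖ = ‖y‖ := by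
  rw [inner_self_eq_norm_sq_to_K, inner_self_eq_norm_sq_to_K] at h
  have h2 : ‖x‖ ^ 2 = ‖y‖ ^ 2 := by exact_mod_cast h
  exact (sq_eq_sq₀ (norm_nonneg _) (norm_nonneg _)).1 h2

/-- Intertwining partial isometry between the cyclic subspaces. -/
theorem exists_intertwiner (π : ↥M →L[ℂ] (K →L[ℂ] K)) (σ : ↥M →L[ℂ] (L →L[ℂ] L))
    (hmul : ∀ x y : ↥M, π (x * y) = π x * π y) (hstar : ∀ x : ↥M, π (star x) = star (π x))
    (hone : π 1 = 1)
    (hmul' : ∀ x y : ↥M, σ (x * y) = σ x * σ y) (hstar' : ∀ x : ↥M, σ (star x) = star (σ x))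
    (hone' : σ 1 = 1) (ξ : K) (ξ' : L) (h : ∀ r, ⟪ξ, π r ξ⟫ = ⟪ξ', σ r ξ'⟫) :
    ∃ V : K →L[ℂ] L, (∀ r, V ∘L π r = σ r ∘L V) ∧ V ξ = ξ' ∧
      ∀ r, adjoint V (V (π r ξ)) = π r ξ := by
  let f : ↥M →ₗ[ℂ] K :=
    { toFun := fun r => π r ξ, map_add' := fun a b => by simp, map_smul' := fun a b => by simp }
  let g : ↥M →ₗ[ℂ] L :=
    { toFun := fun r => σ r ξ', map_add' := fun a b => by simp, map_smul' := fun a b => by simp }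
  obtain ⟨V, h1, h2, -, -, h3⟩ := exists_partialIsometry f g (fun r => by
    refine norm_eq_of_inner_self_eq (x := σ r ξ') (y := π r ξ) ?_
    rw [rep_inner π hmul hstar, rep_inner σ hmul' hstar', h])
  refine ⟨V, fun r => h3 _ _ (fun e => ⟨r * e, ?_, ?_⟩) (fun e => ⟨star r * e, ?_⟩), ?_,
    fun r => h2 r⟩
  · change π r (π e ξ) = π (r * e) ξ
    rw [hmul]; rfl
  · change σ r (σ e ξ') = σ (r * e) ξ'
    rw [hmul']; rfl
  · change adjoint (π r) (π e ξ) = π (star r * e) ξ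
    rw [hmul, hstar]; rfl
  · have := h1 1
    change V (π 1 ξ) = σ 1 ξ' at this
    rwa [hone, hone'] at this

theorem adj_commute (π : ↥M →L[ℂ] (K →L[ℂ] K)) (hstar : ∀ x : ↥M, π (star x) = star (π x))
    {T : K →L[ℂ] K} (hT : ∀ r, T * π r = π r * T) (r : ↥M) :
    star T * π r = π r * star T := by
  have h := congrArg star (hT (star r))
  rw [star_mul, star_mul, hstar, star_star] at h
  exact h.symm

theorem inner_amp_adjoint_comp {I K' : Type*} [NormedAddCommGroup K'] [InnerProductSpace ℂ K']
    [CompleteSpace K'] (V : K →L[ℂ] L) (S : K' →L[ℂ] L) (x : L2 I K) (y : L2 I K') :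
    ⟪x, amp I (adjoint V ∘L S) y⟫ = ⟪amp I V x, amp I S y⟫ := by
  rw [amp_comp, amp_adjoint, comp_apply, adjoint_inner_right]

theorem amp_comp_apply {I K' : Type*} [NormedAddCommGroup K'] [InnerProductSpace ℂ K']
    (S : K →L[ℂ] L) (T : K' →L[ℂ] K) (x : L2 I K') :
    amp I (S ∘L T) x = amp I S (amp I T x) := by
  rw [amp_comp, comp_apply]

theorem transfer_vec {I : Type*} (π : ↥M →L[ℂ] (K →L[ℂ] K)) (σ : ↥M →L[ℂ] (L →L[ℂ] L))
    (hmul : ∀ x y : ↥M, π (x * y) = π x * π y) (hstar : ∀ x : ↥M, π (star x) = star (π x))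
    (hone : π 1 = 1)
    (hmul' : ∀ x y : ↥M, σ (x * y) = σ x * σ y) (hstar' : ∀ x : ↥M, σ (star x) = star (σ x))
    (hone' : σ 1 = 1) (ξ : K) (ξ' : L) (h : ∀ r, ⟪ξ, π r ξ⟫ = ⟪ξ', σ r ξ'⟫)
    (z : L2 I K) (hz : ∀ T : K →L[ℂ] K, (∀ r, T * π r = π r * T) →
      ⟪z, amp I T z⟫ = ⟪ξ, T ξ⟫) :
    ∃ ζ : L2 I L, (∀ r, ⟪ζ, amp I (σ r) ζ⟫ = ⟪z, amp I (π r) z⟫) ∧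
      ∀ T : L →L[ℂ] L, (∀ r, T * σ r = σ r * T) → ⟪ζ, amp I T ζ⟫ = ⟪ξ', T ξ'⟫ := by
  obtain ⟨V, hV, hVξ, hVV⟩ := exists_intertwiner π σ hmul hstar hone hmul' hstar' hone' ξ ξ' h
  have hV' : ∀ r, adjoint V ∘L σ r = π r ∘L adjoint V := by
    intro r
    have h1 := congrArg adjoint (hV (star r))
    rw [adjoint_comp, adjoint_comp, hstar, hstar', ← star_eq_adjoint, ← star_eq_adjoint,
      star_star, star_star] at h1
    exact h1.symm
  have hcj : ∀ T : L →L[ℂ] L, (∀ r, T * σ r = σ r * T) →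
      ∀ r, (adjoint V ∘L (T ∘L V)) * π r = π r * (adjoint V ∘L (T ∘L V)) := by
    intro T hT r
    change adjoint V ∘L (T ∘L (V ∘L π r)) = (π r ∘L adjoint V) ∘L (T ∘L V)
    rw [hV, ← hV']
    have h2 : T ∘L σ r = σ r ∘L T := hT r
    rw [← comp_assoc T, h2]
    rfl
  set P : K →L[ℂ] K := adjoint V ∘L V with hP
  have hPc : ∀ r, P * π r = π r * P := by
    intro r
    have := hcj 1 (fun r => by rw [one_mul, mul_one]) r
    exact this
  have hPz : amp I P z = z := by
    have h1 : ∀ r, (star (1 - P) * (1 - P)) * π r = π r * (star (1 - P) * (1 - P)) := by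
      intro r
      have h2 : ∀ r, (1 - P) * π r = π r * (1 - P) := by
        intro r; rw [sub_mul, mul_sub, hPc, one_mul, mul_one]
      have h3 := adj_commute π hstar h2 r
      rw [mul_assoc, h2, ← mul_assoc, h3, mul_assoc]
    have h2 := hz _ h1
    have h4 : (1 - P) ξ = 0 := by
      have := hVV 1
      rw [hone] at this
      change ξ - adjoint V (V ξ) = 0
      exact sub_eq_zero.2 this.symm
    have h5 : (star (1 - P) * (1 - P)) ξ = 0 := by
      change star (1 - P) ((1 - P) ξ) = 0
      rw [h4, map_zero]
    have h6 := inner_amp_adjoint_comp (I := I) (1 - P) (1 - P) z z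
    rw [h5, inner_zero_right] at h2
    have h7 : ⟪amp I (1 - P) z, amp I (1 - P) z⟫ = 0 := h6.symm.trans h2
    rw [inner_self_eq_zero, map_sub, amp_one] at h7
    exact (sub_eq_zero.1 h7).symm
  have key : ∀ T : L →L[ℂ] L,
      ⟪amp I V z, amp I T (amp I V z)⟫ = ⟪z, amp I (adjoint V ∘L (T ∘L V)) z⟫ := by
    intro T
    rw [inner_amp_adjoint_comp, amp_comp_apply]
  refine ⟨amp I V z, fun r => ?_, fun T hT => ?_⟩
  · rw [key, ← hV r, ← comp_assoc]
    change ⟪z, amp I (P * π r) z⟫ = _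
    rw [hPc]
    have h1 : amp I (π r * P) z = amp I (π r) (amp I P z) := amp_comp_apply _ _ _
    rw [h1, hPz]
  · rw [key, hz _ (hcj T hT)]
    change ⟪ξ, adjoint V (T (V ξ))⟫ = _
    rw [adjoint_inner_right, hVξ]

theorem exists_W {I : Type*} (σ : ↥M →L[ℂ] (L →L[ℂ] L))
    (hstar' : ∀ x : ↥M, σ (star x) = star (σ x))
    (ξ' : L) (ζ : L2 I L)
    (h : ∀ T : L →L[ℂ] L, (∀ r, T * σ r = σ r * T) → ⟪ζ, amp I T ζ⟫ = ⟪ξ', T ξ'⟫) :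
    ∃ (W : L →L[ℂ] L2 I L) (b : L →L[ℂ] L), W ξ' = ζ ∧ b ξ' = 0 ∧
      (∀ k, ‖b k‖ ^ 2 + ‖W k‖ ^ 2 = ‖k‖ ^ 2) ∧
      ∀ T : L →L[ℂ] L, (∀ r, T * σ r = σ r * T) → W ∘L T = amp I T ∘L W ∧ b * T = T * b := by
  let C : Submodule ℂ (L →L[ℂ] L) :=
    { carrier := {T | ∀ r, T * σ r = σ r * T}
      add_mem' := fun {a b} ha hb r => by rw [add_mul, mul_add, ha r, hb r]
      zero_mem' := fun r => by rw [zero_mul, mul_zero]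
      smul_mem' := fun c a ha r => by rw [smul_mul_assoc, mul_smul_comm, ha r] }
  have hCs : ∀ T ∈ C, star T ∈ C := fun T hT => adj_commute σ hstar' hT
  have hCm : ∀ S ∈ C, ∀ T ∈ C, S * T ∈ C := fun S hS T hT r => by
    rw [mul_assoc, hT r, ← mul_assoc, hS r, mul_assoc]
  have hC1 : (1 : L →L[ℂ] L) ∈ C := fun r => by rw [one_mul, mul_one]
  let f : C →ₗ[ℂ] L :=
    { toFun := fun T => (T : L →L[ℂ] L) ξ', map_add' := fun a b => by simp,
      map_smul' := fun a b => by simp }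
  let g : C →ₗ[ℂ] L2 I L :=
    { toFun := fun T => amp I (T : L →L[ℂ] L) ζ
      map_add' := fun a b => by
        rw [Submodule.coe_add, map_add]; rfl
      map_smul' := fun a b => by
        rw [Submodule.coe_smul, map_smul]; rfl }
  obtain ⟨W, h1, h2, h4, -, h3⟩ := exists_partialIsometry f g (fun T => by
    refine norm_eq_of_inner_self_eq (x := amp I (T : L →L[ℂ] L) ζ) (y := (T : L →L[ℂ] L) ξ') ?_
    have h5 := h _ (hCm _ (hCs _ T.2) _ T.2)
    rw [amp_mul, amp_star, star_eq_adjoint, star_eq_adjoint] at h5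
    change ⟪ζ, adjoint (amp I (T : L →L[ℂ] L)) (amp I (T : L →L[ℂ] L) ζ)⟫ =
      ⟪ξ', adjoint (T : L →L[ℂ] L) ((T : L →L[ℂ] L) ξ')⟫ at h5
    rwa [adjoint_inner_right, adjoint_inner_right] at h5)
  have hWT : ∀ T ∈ C, W ∘L T = amp I T ∘L W := by
    intro T hT
    refine h3 _ _ (fun e => ⟨⟨T * e, hCm _ hT _ e.2⟩, rfl, ?_⟩)
      (fun e => ⟨⟨star T * e, hCm _ (hCs _ hT) _ e.2⟩, rfl⟩)
    change amp I T (amp I (e : L →L[ℂ] L) ζ) = amp I (T * (e : L →L[ℂ] L)) ζ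
    rw [amp_mul]; rfl
  have hWT' : ∀ T ∈ C, T ∘L adjoint W = adjoint W ∘L amp I T := by
    intro T hT
    have h5 := congrArg adjoint (hWT _ (hCs _ hT))
    rw [adjoint_comp, adjoint_comp, amp_star, ← star_eq_adjoint, ← star_eq_adjoint,
      star_star, star_star] at h5
    exact h5
  refine ⟨W, 1 - adjoint W ∘L W, ?_, ?_, ?_, ?_⟩
  · have := h1 ⟨1, hC1⟩
    change W ξ' = amp I 1 ζ at this
    rwa [amp_one] at this
  · have := h2 ⟨1, hC1⟩
    change adjoint W (W ξ') = ξ' at this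
    change ξ' - adjoint W (W ξ') = 0
    exact sub_eq_zero.2 this.symm
  · intro k
    set m := adjoint W (W k) with hm
    have h6 : ⟪m, m⟫ = ⟪m, k⟫ := by
      nth_rewrite 2 [hm]
      rw [adjoint_inner_right, hm, h4, adjoint_inner_left]
    have h7 : ⟪m, k⟫ = ⟪W k, W k⟫ := by
      rw [hm, adjoint_inner_left]
    have h8 : ‖k‖ ^ 2 = ‖k - m‖ ^ 2 + ‖m‖ ^ 2 := by
      have h9 : ⟪k - m, m⟫ = 0 := by
        rw [inner_sub_left, sub_eq_zero, ← inner_conj_symm, ← h6, inner_conj_symm]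
      have h10 := norm_add_sq_eq_norm_sq_add_norm_sq_of_inner_eq_zero (𝕜 := ℂ) (k - m) m h9
      rw [sub_add_cancel] at h10
      rw [sq, sq, sq]; exact h10
    have h11 : ‖m‖ = ‖W k‖ := norm_eq_of_inner_self_eq (h6.trans h7)
    change ‖k - m‖ ^ 2 + ‖W k‖ ^ 2 = ‖k‖ ^ 2
    rw [h8, h11]
  · intro T hT
    refine ⟨hWT T hT, ?_⟩
    rw [sub_mul, mul_sub, one_mul, mul_one]
    congr 1
    change adjoint W ∘L (W ∘L T) = (T ∘L adjoint W) ∘L W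
    rw [hWT T hT, hWT' T hT]
    rfl

/-- An operator commuting with the commutant of the amplification is an amplification. -/
theorem amp_of_commute {I : Type*} (i₀ : I) (X : L2 I H →L[ℂ] L2 I H)
    (hX : ∀ T : L2 I H →L[ℂ] L2 I H,
      (∀ r : ↥M, T * amp I (r : H →L[ℂ] H) = amp I (r : H →L[ℂ] H) * T) → X * T = T * X) :
    ∃ c : ↥M, X = amp I (c : H →L[ℂ] H) := by
  have hone : ∀ T' ∈ M.commutant, ∀ i j : I, ∀ r : ↥M,
      (inL i ∘L (T' ∘L evL j)) * amp I (r : H →L[ℂ] H) =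
        amp I (r : H →L[ℂ] H) * (inL i ∘L (T' ∘L evL j)) := by
    intro T' hT' i j r
    ext v : 1
    change inL i (T' ((r : H →L[ℂ] H) (v j))) = amp I (r : H →L[ℂ] H) (inL i (T' (v j)))
    rw [amp_inL]
    have := VonNeumannAlgebra.mem_commutant_iff.1 hT' r r.2
    exact congrArg (fun S : H →L[ℂ] H => inL i (S (v j))) this.symm
  have hX' : ∀ T' ∈ M.commutant, ∀ i j : I, ∀ v : L2 I H,
      X (inL i (T' (v j))) = inL i (T' (X v j)) := by
    intro T' hT' i j v
    exact congrArg (fun S : L2 I H →L[ℂ] L2 I H => S v) (hX _ (hone T' hT' i j))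
  have h1 : (1 : H →L[ℂ] H) ∈ M.commutant := one_mem _
  let c : H →L[ℂ] H := evL i₀ ∘L (X ∘L inL i₀)
  have hc : ∀ k, c k = X (inL i₀ k) i₀ := fun k => rfl
  have hcM : c ∈ M := by
    rw [← VonNeumannAlgebra.commutant_commutant M, VonNeumannAlgebra.mem_commutant_iff]
    intro T' hT'
    ext k
    change T' (X (inL i₀ k) i₀) = X (inL i₀ (T' k)) i₀
    have := hX' T' hT' i₀ i₀ (inL i₀ k)
    rw [inL_apply_self] at this
    rw [this, inL_apply_self]
  refine ⟨⟨c, hcM⟩, ?_⟩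
  ext v i
  have := hX' 1 h1 i₀ i v
  change X (inL i₀ (v i)) = inL i₀ (X v i) at this
  rw [amp_apply]
  change X v i = c (v i)
  rw [hc, this, inL_apply_self]

end Backward

section Assembly

open ContinuousLinearMap

set_option linter.unusedSectionVars false

/-- Amplification of the identity representation. -/
def ampM (I : Type*) (M : VonNeumannAlgebra H) : ↥M →L[ℂ] (L2 I H →L[ℂ] L2 I H) :=
  amp I ∘L coeL M

theorem ampM_apply (I : Type*) (r : ↥M) : ampM I M r = amp I (r : H →L[ℂ] H) := rfl

theorem ampM_mul (I : Type*) (r s : ↥M) : ampM I M (r * s) = ampM I M r * ampM I M s :=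
  amp_mul _ _

theorem ampM_star (I : Type*) (r : ↥M) : ampM I M (star r) = star (ampM I M r) :=
  amp_star _

theorem ampM_one (I : Type*) : ampM I M 1 = 1 := amp_one

/-- A normal positive functional is a vector functional on the amplification. -/
theorem exists_vec (ω : ↥M →L[ℂ] ℂ) (hs : IsPositiveFunctional ω) (hn : IsNormalFunctional ω) :
    ∃ ξ : L2 (ℕ ⊕ ℕ) H, ∀ r, ω r = ⟪ξ, ampM (ℕ ⊕ ℕ) M r ξ⟫ := by
  obtain ⟨x, y, hx, hy, h⟩ := hn
  exact positive_normal (coeL M : ↥M →ₗ[ℂ] (H →L[ℂ] H)) (fun _ _ => rfl) (fun _ => rfl) rfl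
    (fun r => ω r) hs x y hx hy h

theorem exists_vecB {K : Type u} [NormedAddCommGroup K] [InnerProductSpace ℂ K] [CompleteSpace K]
    (g : (K →L[ℂ] K) →L[ℂ] ℂ) (hs : IsStateB g) (hn : IsNormalFunctionalB g) :
    ∃ ξ : L2 (ℕ ⊕ ℕ) K, ∀ T, g T = ⟪ξ, amp (ℕ ⊕ ℕ) T ξ⟫ := by
  obtain ⟨x, y, hx, hy, h⟩ := hn
  exact positive_normal (LinearMap.id : (K →L[ℂ] K) →ₗ[ℂ] (K →L[ℂ] K)) (fun _ _ => rfl)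
    (fun _ => rfl) rfl (fun r => g r) hs.1 x y hx hy h

theorem mem_of_commute {S : H →L[ℂ] H} (h : ∀ T ∈ M.commutant, T * S = S * T) : S ∈ M := by
  rw [← VonNeumannAlgebra.commutant_commutant M, VonNeumannAlgebra.mem_commutant_iff]
  exact h

/-- The channel associated with a square summable column of elements of `M`. -/
theorem exists_channel {J : Type u} (a : J → ↥M)
    (h1 : ∀ h : H, HasSum (fun j => ‖((a j : ↥M) : H →L[ℂ] H) h‖ ^ 2) (‖h‖ ^ 2)) :
    ∃ φ : ↥M →L[ℂ] ↥M, ∀ (x : ↥M) (h k : H),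
      HasSum (fun j => ⟪((a j : ↥M) : H →L[ℂ] H) h,
          ((x : ↥M) : H →L[ℂ] H) (((a j : ↥M) : H →L[ℂ] H) k)⟫)
        ⟪h, ((φ x : ↥M) : H →L[ℂ] H) k⟫ := by
  let V : H →L[ℂ] L2 J H := colL (fun j => (a j : H →L[ℂ] H)) h1
  let φ₀ : ↥M →L[ℂ] (H →L[ℂ] H) := conjL V ∘L ampM J M
  have hφ₀ : ∀ r h k, ⟪h, φ₀ r k⟫ = ⟪V h, amp J (r : H →L[ℂ] H) (V k)⟫ :=
    fun r h k => inner_conjL V (amp J (r : H →L[ℂ] H)) h k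
  have hVT : ∀ T ∈ M.commutant, ∀ k, V (T k) = amp J T (V k) := by
    intro T hT k
    ext j
    rw [amp_apply]
    exact congrArg (fun S : H →L[ℂ] H => S k)
      (VonNeumannAlgebra.mem_commutant_iff.1 hT (a j) (a j).2)
  have hmem : ∀ r, φ₀ r ∈ M := by
    intro r
    refine mem_of_commute (fun T hT => ?_)
    ext k
    apply ext_inner_left ℂ
    intro h
    change ⟪h, T (φ₀ r k)⟫ = ⟪h, φ₀ r (T k)⟫
    have hT' : adjoint T ∈ M.commutant := star_mem hT
    rw [← adjoint_inner_left, hφ₀, hφ₀, hVT T hT, hVT _ hT', amp_adjoint, adjoint_inner_left]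
    have h3 : T * (r : H →L[ℂ] H) = (r : H →L[ℂ] H) * T :=
      (VonNeumannAlgebra.mem_commutant_iff.1 hT r r.2).symm
    have h4 := congrArg (fun S => amp J S (V k)) h3
    have h5 : amp J (T * (r : H →L[ℂ] H)) (V k) = amp J T (amp J (r : H →L[ℂ] H) (V k)) :=
      amp_comp_apply _ _ _
    have h6 : amp J ((r : H →L[ℂ] H) * T) (V k) = amp J (r : H →L[ℂ] H) (amp J T (V k)) :=
      amp_comp_apply _ _ _
    rw [← h5, ← h6, h3]
  let φ : ↥M →L[ℂ] ↥M := LinearMap.mkContinuous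
    { toFun := fun r => (⟨φ₀ r, hmem r⟩ : ↥M)
      map_add' := fun r s => Subtype.ext (map_add φ₀ r s)
      map_smul' := fun c s => Subtype.ext (map_smul φ₀ c s) } ‖φ₀‖
    (fun r => φ₀.le_opNorm r)
  refine ⟨φ, fun r h k => ?_⟩
  have h7 : ⟪h, (φ r : H →L[ℂ] H) k⟫ = ⟪V h, amp J (r : H →L[ℂ] H) (V k)⟫ := hφ₀ r h k
  rw [h7]
  exact lp.hasSum_inner (𝕜 := ℂ) (V h) (amp J (r : H →L[ℂ] H) (V k))

theorem hasSum_ulift_sum {I : Type} {E : Type*} [AddCommMonoid E] [TopologicalSpace E]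
    [ContinuousAdd E] (f : ULift.{u} (I ⊕ Unit) → E) (s : E)
    (h : HasSum (fun i => f ⟨Sum.inl i⟩) s) : HasSum f (s + f ⟨Sum.inr ()⟩) := by
  rw [← Equiv.ulift.symm.hasSum_iff]
  refine HasSum.sum (f := f ∘ Equiv.ulift.symm) h ?_
  exact hasSum_unique (fun u : Unit => f ⟨Sum.inr u⟩)

theorem backward {K : Type u} [NormedAddCommGroup K] [InnerProductSpace ℂ K] [CompleteSpace K]
    (ω ρ : ↥M →L[ℂ] ℂ) (hωs : IsState ω) (hωn : IsNormalFunctional ω)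
    (π : ↥M →L[ℂ] (K →L[ℂ] K))
    (hmul : ∀ x y : ↥M, π (x * y) = π x * π y) (hstar : ∀ x : ↥M, π (star x) = star (π x))
    (hone : π 1 = 1) (ξ : K) (hξ : ∀ r : ↥M, ω r = ⟪ξ, π r ξ⟫)
    (tρ : (K →L[ℂ] K) →L[ℂ] ℂ) (hs : IsStateB tρ) (hn : IsNormalFunctionalB tρ)
    (hρ : ∀ r : ↥M, tρ (π r) = ρ r)
    (hc : ∀ T : K →L[ℂ] K, (∀ r : ↥M, T * π r = π r * T) → tρ T = ⟪ξ, T ξ⟫) :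
    ∃ φ : ↥M →L[ℂ] ↥M, IsQuantumChannel φ ∧ ω.comp φ = ρ := by
  obtain ⟨ξ', hξ'⟩ := exists_vec ω hωs.1 hωn
  obtain ⟨z, hz⟩ := exists_vecB tρ hs hn
  obtain ⟨ζ, hζ1, hζ2⟩ := transfer_vec (I := ℕ ⊕ ℕ) π (ampM (ℕ ⊕ ℕ) M) hmul hstar hone
    (ampM_mul _) (ampM_star _) (ampM_one _) ξ ξ' (fun r => by rw [← hξ, ← hξ']) z
    (fun T hT => by rw [← hz, hc T hT])
  obtain ⟨W, b, hW, hb, hWb, hWT⟩ := exists_W (ampM (ℕ ⊕ ℕ) M) (ampM_star _) ξ' ζ hζ2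
  obtain ⟨cb, hcb⟩ := amp_of_commute (M := M) (Sum.inl 0) b (fun T hT => (hWT T hT).2)
  have hX : ∀ i : ℕ ⊕ ℕ, ∃ c : ↥M, evL i ∘L W = amp (ℕ ⊕ ℕ) (c : H →L[ℂ] H) := by
    intro i
    refine amp_of_commute (M := M) (Sum.inl 0) _ (fun T hT => ?_)
    change evL i ∘L (W ∘L T) = T ∘L (evL i ∘L W)
    rw [(hWT T hT).1]
    ext v : 1
    rfl
  choose c hcc using hX
  let a : ULift.{u} ((ℕ ⊕ ℕ) ⊕ Unit) → ↥M := fun j => Sum.elim c (fun _ => cb) j.down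
  have hWc : ∀ v i, W v i = amp (ℕ ⊕ ℕ) (c i : H →L[ℂ] H) v := by
    intro v i
    rw [← hcc i]; rfl
  have h1 : ∀ h : H, HasSum (fun j => ‖((a j : ↥M) : H →L[ℂ] H) h‖ ^ 2) (‖h‖ ^ 2) := by
    intro h
    let i₀ : ℕ ⊕ ℕ := Sum.inl 0
    have h2 := hWb (inL i₀ h)
    have h3 := L2_hasSum_norm (W (inL i₀ h))
    simp only [hWc, amp_inL, norm_inL] at h3
    rw [hcb, amp_inL, norm_inL, norm_inL, add_comm] at h2
    rw [← h2]
    exact hasSum_ulift_sum (fun j => ‖((a j : ↥M) : H →L[ℂ] H) h‖ ^ 2) _ h3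
  obtain ⟨φ, hφ⟩ := exists_channel a h1
  refine ⟨φ, ⟨_, a, h1, hφ⟩, ?_⟩
  ext r
  have h2 := channel_hasSum h1 hφ ω hωn r
  have h3 : ∀ j, ω (star (a j) * r * a j) = ⟪ampM (ℕ ⊕ ℕ) M (a j) ξ', ampM (ℕ ⊕ ℕ) M r
      (ampM (ℕ ⊕ ℕ) M (a j) ξ')⟫ := by
    intro j
    have h4 := rep_inner (ampM (ℕ ⊕ ℕ) M) (ampM_mul _) (ampM_star _) (a j) (r * a j) ξ' ξ'
    rw [mul_assoc, hξ', ← h4, ampM_mul]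
    rfl
  simp only [h3] at h2
  have h5 := lp.hasSum_inner (𝕜 := ℂ) ζ (amp (ℕ ⊕ ℕ) (ampM (ℕ ⊕ ℕ) M r) ζ)
  rw [hζ1, ← hz, hρ] at h5
  have h6 : ∀ i, ζ i = ampM (ℕ ⊕ ℕ) M (c i) ξ' := by
    intro i
    rw [← hW, hWc]; rfl
  simp only [amp_apply, h6] at h5
  have h7 := hasSum_ulift_sum (fun j => ⟪ampM (ℕ ⊕ ℕ) M (a j) ξ', ampM (ℕ ⊕ ℕ) M r
      (ampM (ℕ ⊕ ℕ) M (a j) ξ')⟫) _ h5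
  have h8 : ampM (ℕ ⊕ ℕ) M (a ⟨Sum.inr ()⟩) ξ' = 0 := by
    rw [← hb, hcb]; rfl
  simp only [h8, inner_zero_left, add_zero] at h7
  exact h2.unique h7

end Assembly

section Final

open ContinuousLinearMap

set_option linter.unusedSectionVars false

/-- The functional `T ↦ ⟪η, T ζ⟫`. -/
def vecF {K : Type*} [NormedAddCommGroup K] [InnerProductSpace ℂ K] (η ζ : K) :
    (K →L[ℂ] K) →L[ℂ] ℂ :=
  (innerSL ℂ η) ∘L (ContinuousLinearMap.apply ℂ K ζ)

theorem vecF_apply {K : Type*} [NormedAddCommGroup K] [InnerProductSpace ℂ K] (η ζ : K)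
    (T : K →L[ℂ] K) : vecF η ζ T = ⟪η, T ζ⟫ := rfl

theorem summable_single {K : Type*} [NormedAddCommGroup K] (η : K) :
    Summable fun n : ℕ => ‖(if n = 0 then η else 0)‖ ^ 2 := by
  refine summable_of_ne_finset_zero (s := {0}) (fun n hn => ?_)
  have : n ≠ 0 := by simpa using hn
  simp [this]

theorem vecF_normal {K : Type u} [NormedAddCommGroup K] [InnerProductSpace ℂ K] [CompleteSpace K]
    (η ζ : K) : IsNormalFunctionalB (vecF η ζ) := by
  refine ⟨fun n => if n = 0 then η else 0, fun n => if n = 0 then ζ else 0,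
    summable_single η, summable_single ζ, fun T => ?_⟩
  have := hasSum_single (f := fun n : ℕ => ⟪(if n = 0 then η else 0 : K),
    T (if n = 0 then ζ else 0)⟫) 0 (fun n hn => by simp [hn])
  simpa [vecF_apply] using this

theorem vecF_state {K : Type u} [NormedAddCommGroup K] [InnerProductSpace ℂ K] [CompleteSpace K]
    (η : K) (h : ⟪η, η⟫ = 1) : IsStateB (vecF η η) := by
  refine ⟨fun T => ?_, h⟩
  rw [vecF_apply]
  change 0 ≤ ⟪η, adjoint T (T η)⟫
  rw [adjoint_inner_right, inner_self_eq_norm_sq_to_K]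
  have h2 : (0 : ℂ) ≤ ((‖T η‖ ^ 2 : ℝ) : ℂ) := Complex.zero_le_real.2 (sq_nonneg _)
  rw [Complex.ofReal_pow] at h2
  exact h2

/-- The infinite amplification as a faithful normal representation. -/
def ampRep (M : VonNeumannAlgebra H) : FaithfulNormalRep M where
  space := L2 (ℕ ⊕ ℕ) H
  π := ampM (ℕ ⊕ ℕ) M
  map_mul' := ampM_mul _
  map_star' := ampM_star _
  map_one' := ampM_one _
  faithful' := by
    intro r s h
    apply Subtype.ext
    ext k
    have h1 := congrArg (fun T : L2 (ℕ ⊕ ℕ) H →L[ℂ] L2 (ℕ ⊕ ℕ) H => T (inL (Sum.inl 0) k)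
      (Sum.inl 0)) h
    simp only [ampM_apply, amp_apply, inL_apply_self] at h1
    exact h1
  normal' := by
    rintro g ⟨x, y, hx, hy, h⟩
    obtain ⟨x', y', hx'', hy'', h3⟩ := reindex (fun p : ℕ × (ℕ ⊕ ℕ) => x p.1 p.2)
      (fun p : ℕ × (ℕ ⊕ ℕ) => y p.1 p.2) (summable_double x hx) (summable_double y hy)
    refine ⟨x', y', hx'', hy'', fun r => h3 _ _ ?_⟩
    exact hasSum_double x y hx hy _ _ (h (ampM (ℕ ⊕ ℕ) M r))

theorem vec_normal_amp (η ζ : L2 (ℕ ⊕ ℕ) H) :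
    IsNormalFunctional ((vecF η ζ).comp (ampM (ℕ ⊕ ℕ) M)) :=
  (ampRep M).normal' (vecF η ζ) (vecF_normal η ζ)

/-- Normality of matrix coefficients in the GNS representation. -/
theorem gns_normal {K : Type u} [NormedAddCommGroup K] [InnerProductSpace ℂ K] [CompleteSpace K]
    (ω : ↥M →L[ℂ] ℂ) (hωs : IsState ω) (hωn : IsNormalFunctional ω)
    (π : ↥M →L[ℂ] (K →L[ℂ] K))
    (hmul : ∀ x y : ↥M, π (x * y) = π x * π y) (hstar : ∀ x : ↥M, π (star x) = star (π x))
    (hone : π 1 = 1) (ξ : K) (hξ : ∀ r : ↥M, ω r = ⟪ξ, π r ξ⟫)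
    (hd : Dense {η : K | ∃ r : ↥M, η = π r ξ}) (η ζ : K) :
    ∃ g : ↥M →L[ℂ] ℂ, IsNormalFunctional g ∧ ∀ r, g r = ⟪η, π r ζ⟫ := by
  obtain ⟨ξ', hξ'⟩ := exists_vec ω hωs.1 hωn
  obtain ⟨V, hV, -, hVV⟩ := exists_intertwiner π (ampM (ℕ ⊕ ℕ) M) hmul hstar hone
    (ampM_mul _) (ampM_star _) (ampM_one _) ξ ξ' (fun r => by rw [← hξ, ← hξ'])
  have h1 : ∀ k, adjoint V (V k) = k := by
    have : (fun k => adjoint V (V k)) = fun k => k := by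
      refine Continuous.ext_on hd (by fun_prop) continuous_id ?_
      rintro k ⟨r, rfl⟩
      exact hVV r
    exact fun k => congrFun this k
  refine ⟨_, vec_normal_amp (V η) (V ζ), fun r => ?_⟩
  change ⟪V η, (ampM (ℕ ⊕ ℕ) M r ∘L V) ζ⟫ = _
  rw [← hV]
  change ⟪V η, V (π r ζ)⟫ = _
  rw [← adjoint_inner_left, h1]

/-- Existence of the GNS representation. -/
theorem exists_gns (ω : ↥M →L[ℂ] ℂ) (hωs : IsState ω) (hωn : IsNormalFunctional ω) :
    ∃ (K : Type u) (_ : NormedAddCommGroup K) (_ : InnerProductSpace ℂ K) (_ : CompleteSpace K)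
      (π : ↥M →L[ℂ] (K →L[ℂ] K)),
      (∀ x y : ↥M, π (x * y) = π x * π y) ∧ (∀ x : ↥M, π (star x) = star (π x)) ∧
      π 1 = 1 ∧ ∃ ξ : K, (∀ r : ↥M, ω r = ⟪ξ, π r ξ⟫) ∧
        Dense {η : K | ∃ r : ↥M, η = π r ξ} := by
  obtain ⟨ξ', hξ'⟩ := exists_vec ω hωs.1 hωn
  let σ := ampM (ℕ ⊕ ℕ) M
  have hσm : ∀ r s v, σ (r * s) v = σ r (σ s v) := fun r s v => by
    change ampM (ℕ ⊕ ℕ) M (r * s) v = _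
    rw [ampM_mul]; rfl
  have hσ1 : ∀ v, σ 1 v = v := fun v => by
    change ampM (ℕ ⊕ ℕ) M 1 v = _
    rw [ampM_one]; rfl
  let g : ↥M →ₗ[ℂ] L2 (ℕ ⊕ ℕ) H :=
    { toFun := fun r => σ r ξ', map_add' := fun a b => by simp, map_smul' := fun a b => by simp }
  let K₀ : Submodule ℂ (L2 (ℕ ⊕ ℕ) H) := (LinearMap.range g).topologicalClosure
  have : CompleteSpace K₀ := (Submodule.isClosed_topologicalClosure _).completeSpace_coe
  have hK : (K₀ : Set (L2 (ℕ ⊕ ℕ) H)) = closure (Set.range g) := by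
    rw [Submodule.topologicalClosure_coe, LinearMap.coe_range]
  have hinv : ∀ r, ∀ v ∈ K₀, σ r v ∈ K₀ := by
    intro r v hv
    have hv' : v ∈ closure (Set.range g) := hK ▸ hv
    have : σ r v ∈ closure (Set.range g) := by
      refine map_mem_closure (σ r).continuous hv' ?_
      rintro _ ⟨s, rfl⟩
      exact ⟨r * s, hσm r s ξ'⟩
    rw [← hK] at this
    exact this
  let U : K₀ →L[ℂ] L2 (ℕ ⊕ ℕ) H := K₀.subtypeL
  let π : ↥M →L[ℂ] (K₀ →L[ℂ] K₀) := conjL U ∘L σ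
  have hπi : ∀ r (h k : K₀), ⟪h, π r k⟫ = ⟪(h : L2 (ℕ ⊕ ℕ) H), σ r k⟫ :=
    fun r h k => inner_conjL U (σ r) h k
  have hπ : ∀ r (k : K₀), π r k = ⟨σ r k, hinv r k k.2⟩ := by
    intro r k
    apply ext_inner_left ℂ
    intro h
    rw [hπi]; rfl
  have hπ' : ∀ r (k : K₀), ((π r k : K₀) : L2 (ℕ ⊕ ℕ) H) = σ r k := by
    intro r k; rw [hπ]
  have hmem : ∀ r, g r ∈ K₀ := fun r => Submodule.le_topologicalClosure _ ⟨r, rfl⟩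
  have hξm : ξ' ∈ K₀ := by
    have := hmem 1
    change σ 1 ξ' ∈ K₀ at this
    rwa [hσ1] at this
  refine ⟨K₀, inferInstance, inferInstance, inferInstance, π, ?_, ?_, ?_, ⟨ξ', hξm⟩, ?_, ?_⟩
  · intro r s
    ext1 k
    apply Subtype.ext
    change ((π (r * s) k : K₀) : L2 (ℕ ⊕ ℕ) H) = (π r (π s k) : K₀)
    rw [hπ', hπ', hπ', hσm]
  · intro r
    rw [star_eq_adjoint, eq_adjoint_iff]
    intro h k
    rw [hπi, ← inner_conj_symm, hπi, inner_conj_symm]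
    change ⟪ampM (ℕ ⊕ ℕ) M (star r) h, _⟫ = ⟪(h : L2 (ℕ ⊕ ℕ) H), ampM (ℕ ⊕ ℕ) M r k⟫
    rw [ampM_star, star_eq_adjoint, adjoint_inner_left]
  · ext1 k
    apply Subtype.ext
    rw [hπ', hσ1]; rfl
  · intro r
    rw [hπi, hξ']
  · intro k
    rw [closure_subtype]
    have hk : (k : L2 (ℕ ⊕ ℕ) H) ∈ closure (Set.range g) := hK ▸ k.2
    refine closure_mono ?_ hk
    rintro _ ⟨r, rfl⟩
    refine ⟨π r ⟨ξ', hξm⟩, ⟨r, rfl⟩, ?_⟩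
    rw [hπ']; rfl

end Final

/-- **Theorem.** For normal states `ω`, `ρ` on a von Neumann algebra `M`, the
following are equivalent:
(i) there is a quantum channel `φ` on `M` with `ω ∘ φ = ρ`;
(ii) for every faithful normal representation `P` of `M` and every normal state
on `B(P.space)` extending `ω`, there is a normal state extending `ρ` agreeing
with it on the commutant of the image of `M`;
(iii) for some faithful normal representation of `M` in which `ω` is the
restriction of a vector state `ω̃`, there is a normal state on the ambient
algebra restricting to `ρ` on `M` and to `ω̃` on the commutant;
(iv) for the GNS representation of `M` induced by `ω` (any unital cyclic
representation `π` with cyclic vector `ξ` representing `ω`), `ρ` annihilates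
`ker π` and there is a normal state on the ambient algebra inducing `ρ` on
`π(M)` and agreeing with the vector state of `ξ` on the commutant of
`π(M)`. -/
theorem quantumChannel_transfer_iff
    (ω ρ : ↥M →L[ℂ] ℂ) (hωs : IsState ω) (hρs : IsState ρ)
    (hωn : IsNormalFunctional ω) (hρn : IsNormalFunctional ρ) :
    ((∃ φ : ↥M →L[ℂ] ↥M, IsQuantumChannel φ ∧ ω.comp φ = ρ) ↔
      (∀ P : FaithfulNormalRep M, ∀ tω : (P.space →L[ℂ] P.space) →L[ℂ] ℂ,
        IsStateB tω → IsNormalFunctionalB tω → (∀ r : ↥M, tω (P.π r) = ω r) →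
        ∃ tρ : (P.space →L[ℂ] P.space) →L[ℂ] ℂ,
          IsStateB tρ ∧ IsNormalFunctionalB tρ ∧ (∀ r : ↥M, tρ (P.π r) = ρ r) ∧
          ∀ T : P.space →L[ℂ] P.space,
            (∀ r : ↥M, T * P.π r = P.π r * T) → tω T = tρ T)) ∧
    ((∃ φ : ↥M →L[ℂ] ↥M, IsQuantumChannel φ ∧ ω.comp φ = ρ) ↔
      (∃ P : FaithfulNormalRep M, ∃ ξ : P.space,
        (∀ r : ↥M, ω r = ⟪ξ, P.π r ξ⟫) ∧
        ∃ tρ : (P.space →L[ℂ] P.space) →L[ℂ] ℂ,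
          IsStateB tρ ∧ IsNormalFunctionalB tρ ∧ (∀ r : ↥M, tρ (P.π r) = ρ r) ∧
          ∀ T : P.space →L[ℂ] P.space,
            (∀ r : ↥M, T * P.π r = P.π r * T) → tρ T = ⟪ξ, T ξ⟫)) ∧
    ((∃ φ : ↥M →L[ℂ] ↥M, IsQuantumChannel φ ∧ ω.comp φ = ρ) ↔
      (∀ (K : Type u) [NormedAddCommGroup K] [InnerProductSpace ℂ K] [CompleteSpace K]
        (π : ↥M →L[ℂ] (K →L[ℂ] K)),
        (∀ x y : ↥M, π (x * y) = π x * π y) → (∀ x : ↥M, π (star x) = star (π x)) →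
        π 1 = 1 →
        ∀ ξ : K, (∀ r : ↥M, ω r = ⟪ξ, π r ξ⟫) →
          Dense {η : K | ∃ r : ↥M, η = π r ξ} →
          ((∀ r : ↥M, π r = 0 → ρ r = 0) ∧
            ∃ tρ : (K →L[ℂ] K) →L[ℂ] ℂ, IsStateB tρ ∧ IsNormalFunctionalB tρ ∧
              (∀ r : ↥M, tρ (π r) = ρ r) ∧
              ∀ T : K →L[ℂ] K, (∀ r : ↥M, T * π r = π r * T) → tρ T = ⟪ξ, T ξ⟫))) := by
  have h12 : (∃ φ : ↥M →L[ℂ] ↥M, IsQuantumChannel φ ∧ ω.comp φ = ρ) →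
      (∀ P : FaithfulNormalRep M, ∀ tω : (P.space →L[ℂ] P.space) →L[ℂ] ℂ,
        IsStateB tω → IsNormalFunctionalB tω → (∀ r : ↥M, tω (P.π r) = ω r) →
        ∃ tρ : (P.space →L[ℂ] P.space) →L[ℂ] ℂ,
          IsStateB tρ ∧ IsNormalFunctionalB tρ ∧ (∀ r : ↥M, tρ (P.π r) = ρ r) ∧
          ∀ T : P.space →L[ℂ] P.space,
            (∀ r : ↥M, T * P.π r = P.π r * T) → tω T = tρ T) := by
    intro hφ P tω hs hn hω
    obtain ⟨tρ, h1, h2, h3, h4⟩ := forward ω ρ hφ P.π P.map_mul' P.map_star' P.map_one'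
      (fun η ζ => ⟨_, P.normal' _ (vecF_normal η ζ), fun r => rfl⟩) tω hs hn hω
    exact ⟨tρ, h1, h2, h3, fun T hT => (h4 T hT).symm⟩
  have h23 : (∀ P : FaithfulNormalRep M, ∀ tω : (P.space →L[ℂ] P.space) →L[ℂ] ℂ,
        IsStateB tω → IsNormalFunctionalB tω → (∀ r : ↥M, tω (P.π r) = ω r) →
        ∃ tρ : (P.space →L[ℂ] P.space) →L[ℂ] ℂ,
          IsStateB tρ ∧ IsNormalFunctionalB tρ ∧ (∀ r : ↥M, tρ (P.π r) = ρ r) ∧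
          ∀ T : P.space →L[ℂ] P.space,
            (∀ r : ↥M, T * P.π r = P.π r * T) → tω T = tρ T) →
      (∃ P : FaithfulNormalRep M, ∃ ξ : P.space,
        (∀ r : ↥M, ω r = ⟪ξ, P.π r ξ⟫) ∧
        ∃ tρ : (P.space →L[ℂ] P.space) →L[ℂ] ℂ,
          IsStateB tρ ∧ IsNormalFunctionalB tρ ∧ (∀ r : ↥M, tρ (P.π r) = ρ r) ∧
          ∀ T : P.space →L[ℂ] P.space,
            (∀ r : ↥M, T * P.π r = P.π r * T) → tρ T = ⟪ξ, T ξ⟫) := by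
    intro h
    obtain ⟨ξ, hξ⟩ := exists_vec ω hωs.1 hωn
    have h1 : ⟪ξ, ξ⟫ = 1 := by
      have := hξ 1
      rw [ampM_one, hωs.2] at this
      exact this.symm
    obtain ⟨tρ, h2, h3, h4, h5⟩ := h (ampRep M) (vecF ξ ξ) (vecF_state ξ h1) (vecF_normal ξ ξ)
      (fun r => (hξ r).symm)
    exact ⟨ampRep M, ξ, hξ, tρ, h2, h3, h4, fun T hT => (h5 T hT).symm⟩
  have h31 : (∃ P : FaithfulNormalRep M, ∃ ξ : P.space,
        (∀ r : ↥M, ω r = ⟪ξ, P.π r ξ⟫) ∧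
        ∃ tρ : (P.space →L[ℂ] P.space) →L[ℂ] ℂ,
          IsStateB tρ ∧ IsNormalFunctionalB tρ ∧ (∀ r : ↥M, tρ (P.π r) = ρ r) ∧
          ∀ T : P.space →L[ℂ] P.space,
            (∀ r : ↥M, T * P.π r = P.π r * T) → tρ T = ⟪ξ, T ξ⟫) →
      (∃ φ : ↥M →L[ℂ] ↥M, IsQuantumChannel φ ∧ ω.comp φ = ρ) := by
    rintro ⟨P, ξ, hξ, tρ, h1, h2, h3, h4⟩
    exact backward ω ρ hωs hωn P.π P.map_mul' P.map_star' P.map_one' ξ hξ tρ h1 h2 h3 h4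
  refine ⟨⟨h12, fun h => h31 (h23 h)⟩, ⟨fun h => h23 (h12 h), h31⟩, ?_, ?_⟩
  · intro hφ K _ _ _ π hmul hstar hone ξ hξ hd
    have h1 : ⟪ξ, ξ⟫ = 1 := by
      have := hξ 1
      rw [hone, hωs.2] at this
      exact this.symm
    obtain ⟨tρ, h2, h3, h4, h5⟩ := forward ω ρ hφ π hmul hstar hone
      (gns_normal ω hωs hωn π hmul hstar hone ξ hξ hd) (vecF ξ ξ) (vecF_state ξ h1)
      (vecF_normal ξ ξ) (fun r => (hξ r).symm)
    refine ⟨fun r hr => ?_, tρ, h2, h3, h4, fun T hT => h5 T hT⟩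
    rw [← h4, hr, map_zero]
  · intro h
    obtain ⟨K, _, _, _, π, hmul, hstar, hone, ξ, hξ, hd⟩ := exists_gns ω hωs hωn
    obtain ⟨-, tρ, h1, h2, h3, h4⟩ := h K π hmul hstar hone ξ hξ hd
    exact backward ω ρ hωs hωn π hmul hstar hone ξ hξ tρ h1 h2 h3 h4

end VonNeumannAlgebraPaper

end
end
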